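/- Let n > 3 and let C be a crumpled n-cube such that π₁(Int C) is finitely generated. Then C is not a maximal element in the 'strictly wilder than' partial ordering: there exists a crumpled n-cube C̃ that is strictly wilder than C. (Corollary 5.1) -/

import Mathlib

noncomputable section

open Metric Set unitInterval

/-- The ambient Euclidean space `ℝ^{n+1}` in which the sphere `S^n` lives. -/
abbrev Amb (n : ℕ) := EuclideanSpace ℝ (Fin (n + 1))

/-- The unit sphere `S^n` inside `ℝ^{n+1}`. -/
def Sph (n : ℕ) : Set (Amb n) := Metric.sphere 0 1

/-- A crumpled `n`-cube: the union of the image `bd` of a topological embedding of the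
sphere `S^{n-1}` into `S^n` together with one of the connected components `int` of
`S^n \ bd`. -/
structure CrumpledCube (n : ℕ) where
  bd : Set (Amb n)
  int : Set (Amb n)
  bd_subset_sphere : bd ⊆ Sph n
  exists_embedding : ∃ e : ↥(Sph (n - 1)) → Amb n,
      Continuous e ∧ Function.Injective e ∧ Set.range e = bd
  int_component : ∃ x, x ∈ Sph n \ bd ∧ int = connectedComponentIn (Sph n \ bd) x

namespace CrumpledCube

/-- The underlying set of a crumpled cube. -/
def carrier {n : ℕ} (C : CrumpledCube n) : Set (Amb n) := C.bd ∪ C.int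

lemma bd_subset_carrier {n : ℕ} (C : CrumpledCube n) : C.bd ⊆ C.carrier :=
  Set.subset_union_left

end CrumpledCube

/-- `f : C → D` is a map associated with the triple `(C, D, h)`: it is continuous,
restricts to `h` on `Bd C`, and satisfies `f⁻¹(Bd D) = Bd C`. -/
def IsAssociatedMap {n : ℕ} (C D : CrumpledCube n) (h : ↥C.bd ≃ₜ ↥D.bd)
    (f : ↥C.carrier → ↥D.carrier) : Prop :=
  Continuous f ∧
    (∀ (x : ↥C.carrier) (hx : (x : Amb n) ∈ C.bd),
      ((f x : ↥D.carrier) : Amb n) = ((h ⟨(x : Amb n), hx⟩ : ↥D.bd) : Amb n)) ∧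
    (∀ x : ↥C.carrier, ((f x : ↥D.carrier) : Amb n) ∈ D.bd ↔ (x : Amb n) ∈ C.bd)

/-- The triple `(C, D, h)` belongs to the collection `𝒲_n`. -/
def MemW {n : ℕ} (C D : CrumpledCube n) (h : ↥C.bd ≃ₜ ↥D.bd) : Prop :=
  ∃ f : ↥C.carrier → ↥D.carrier, IsAssociatedMap C D h f

/-- The image `h(T)` of a subset `T` of `Bd C` under a boundary homeomorphism
`h : Bd C → Bd D`, as a subset of the ambient space. -/
def bdImage {n : ℕ} {C D : CrumpledCube n} (h : ↥C.bd ≃ₜ ↥D.bd) (T : Set (Amb n)) :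
    Set (Amb n) :=
  (fun x : ↥C.bd => ((h x : ↥D.bd) : Amb n)) '' {x : ↥C.bd | (x : Amb n) ∈ T}

/-- `T` is a homotopy taming set for the crumpled cube `C`. -/
def IsHomotopyTamingSet {n : ℕ} (C : CrumpledCube n) (T : Set (Amb n)) : Prop :=
  T ⊆ C.bd ∧
    ∀ (m : C(I × I, ↥C.carrier)) (ε : ℝ), 0 < ε →
      ∃ m' : C(I × I, ↥C.carrier),
        (∀ x, dist (m x) (m' x) < ε) ∧ ∀ x, ((m' x : ↥C.carrier) : Amb n) ∈ T ∪ C.int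

/-- `Bd C` is locally collared in `C` at the point `p`. -/
def LocallyCollaredAt {n : ℕ} (C : CrumpledCube n) (p : ↥C.carrier) : Prop :=
  ∃ N : Set ↥C.carrier, IsOpen N ∧ p ∈ N ∧
    ∃ φ : ↥N ≃ₜ ↥(N ∩ {x : ↥C.carrier | (x : Amb n) ∈ C.bd}) × ↥(Set.Ico (0 : ℝ) 1),
      ∀ (x : ↥N) (hx : ((x : ↥C.carrier) : Amb n) ∈ C.bd),
        φ x = (⟨(x : ↥C.carrier), ⟨x.2, hx⟩⟩, ⟨0, ⟨le_rfl, zero_lt_one⟩⟩)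

/-- The wild set of a crumpled cube: the points of `Bd C` at which `Bd C` fails to be
locally collared in `C`. -/
def wildSet {n : ℕ} (C : CrumpledCube n) : Set (Amb n) :=
  {p | ∃ hp : p ∈ C.bd, ¬ LocallyCollaredAt C ⟨p, C.bd_subset_carrier hp⟩}

/-- `C` is strictly wilder than `D`. -/
def StrictlyWilder {n : ℕ} (C D : CrumpledCube n) : Prop :=
  (∃ h : ↥C.bd ≃ₜ ↥D.bd, MemW C D h) ∧ ∀ H : ↥D.bd ≃ₜ ↥C.bd, ¬ MemW D C H

/-- A crumpled `n`-cube is a closed `n`-cell-complement if the complement of its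
interior in `S^n` is an `n`-cell. -/
def IsClosedCellComplement {n : ℕ} (C : CrumpledCube n) : Prop :=
  Nonempty (↥(Sph n \ C.int) ≃ₜ ↥(Metric.closedBall (0 : EuclideanSpace ℝ (Fin n)) 1))

section

section Brouwer
open MeasureTheory
variable {E : Type*} [NormedAddCommGroup E] [InnerProductSpace ℝ E] [FiniteDimensional ℝ E]

lemma exists_polynomial_eval_eq_det (A : E →L[ℝ] E) :
    ∃ p : Polynomial ℝ, p.natDegree ≤ Module.finrank ℝ E ∧
      ∀ t : ℝ, p.eval t = (1 + t • A : E →L[ℝ] E).det := by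
  classical
  let b := Module.finBasis ℝ E
  let M := LinearMap.toMatrix b b (A : E →ₗ[ℝ] E)
  refine ⟨Matrix.det ((Polynomial.X : Polynomial ℝ) • M.map Polynomial.C +
    (1 : Matrix _ _ ℝ).map Polynomial.C), ?_, fun t => ?_⟩
  · simpa using Polynomial.natDegree_det_X_add_C_le M 1
  · have h : (1 + t • A : E →L[ℝ] E).det = LinearMap.det ((1 + t • A : E →L[ℝ] E) : E →ₗ[ℝ] E) :=
        rfl
    rw [h, ← LinearMap.det_toMatrix b, ← Polynomial.coe_evalRingHom, RingHom.map_det]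
    congr 1
    ext i j
    simp [M, LinearMap.toMatrix_apply, Matrix.one_apply, Module.Basis.repr_self,
        Finsupp.single_apply,
      eq_comm]
    split_ifs <;> simp [add_comm, mul_comm]

omit [FiniteDimensional ℝ E] in
lemma segment_meets_sphere {x y : E} {N : ℝ} (hx : ‖x‖ ≤ N) (hy : N ≤ ‖y‖) :
    ∃ z, ‖z‖ = N ∧ ‖x - z‖ ≤ ‖x - y‖ := by
  have hc : ContinuousOn (fun t : ℝ => ‖AffineMap.lineMap x y t‖) (Icc 0 1) := by
    apply Continuous.continuousOn; fun_prop
  obtain ⟨t, ht, h⟩ := intermediate_value_Icc zero_le_one hc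
    (show N ∈ Icc _ _ from ⟨by simpa using hx, by simpa using hy⟩)
  refine ⟨_, h, ?_⟩
  rw [← dist_eq_norm, ← dist_eq_norm, dist_left_lineMap, Real.norm_of_nonneg ht.1]
  exact mul_le_of_le_one_left dist_nonneg ht.2

variable [MeasurableSpace E] [BorelSpace E]

theorem no_smooth_retraction {K : E → E} (hK : ContDiff ℝ 1 K) {N : ℝ} (hN : 0 < N)
    (hn : ∀ x, ‖K x‖ = N) (hid : ∀ x, ‖x‖ = N → K x = x) : False := by
  classical
  let μ : Measure E := volume
  set u : E → E := fun x => K x - x with hu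
  have hud : ContDiff ℝ 1 u := hK.sub contDiff_id
  have hdiff : Differentiable ℝ u := hud.differentiable (by norm_num)
  have hcf : Continuous (fderiv ℝ u) := hud.continuous_fderiv (by norm_num)
  -- Lipschitz extension by zero
  obtain ⟨L, hL⟩ : ∃ L : ℝ, ∀ x ∈ closedBall (0 : E) N, ‖fderiv ℝ u x‖ ≤ L :=
    (isCompact_closedBall 0 N).exists_bound_of_continuousOn hcf.continuousOn
  have hL0 : 0 ≤ L := (norm_nonneg _).trans (hL 0 (by simp [hN.le]))
  have hlip : ∀ x ∈ closedBall (0 : E) N, ∀ y ∈ closedBall (0 : E) N, ‖u x - u y‖ ≤ L * ‖x - y‖ :=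
    fun x hx y hy => (convex_closedBall (0 : E) N).norm_image_sub_le_of_norm_fderiv_le
      (fun z _ => hdiff z) hL hy hx
  let w : E → E := fun x => if ‖x‖ ≤ N then u x else 0
  have hwin : ∀ x, ‖x‖ ≤ N → w x = u x := fun x h => if_pos h
  have hwout : ∀ x, N ≤ ‖x‖ → w x = 0 := fun x h => by
    rcases h.eq_or_lt with h | h
    · simp [w, h.symm, hu, hid x h.symm]
    · simp [w, not_le.2 h]
  have hwl1 : ∀ x y, ‖x‖ ≤ N → N ≤ ‖y‖ → ‖w x - w y‖ ≤ L * ‖x - y‖ := fun x y hx hy => by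
    obtain ⟨z, hz, hzd⟩ := segment_meets_sphere hx hy
    have : w y = u z := by rw [hwout y hy, ← hwin z hz.le, hwout z hz.ge]
    rw [hwin x hx, this]
    exact (hlip x (by simpa using hx) z (by simpa using hz.le)).trans (by gcongr)
  have hwl : ∀ x y, ‖w x - w y‖ ≤ L * ‖x - y‖ := fun x y => by
    rcases le_total ‖x‖ N with hx | hx <;> rcases le_total ‖y‖ N with hy | hy
    · rw [hwin x hx, hwin y hy]; exact hlip x (by simpa using hx) y (by simpa using hy)
    · exact hwl1 x y hx hy
    · rw [norm_sub_rev, norm_sub_rev x]; exact hwl1 y x hy hx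
    · rw [hwout x hx, hwout y hy]; simp; positivity
  -- small times
  obtain ⟨δ, hδ, hdet⟩ : ∃ δ > 0, ∀ A : E →L[ℝ] E, ‖A‖ < δ → 0 < (1 + A).det := by
    have hc : Continuous fun A : E →L[ℝ] E => (1 + A).det :=
      ContinuousLinearMap.continuous_det.comp (continuous_const.add continuous_id)
    have := (hc.tendsto 0).eventually_const_lt (u := 0)
      (by rw [add_zero]; simp [ContinuousLinearMap.det, ContinuousLinearMap.one_def])
    obtain ⟨δ, hδ, h⟩ := Metric.eventually_nhds_iff.1 this
    exact ⟨δ, hδ, fun A hA => h (by simpa using hA)⟩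
  set τ : ℝ := min (1 / 2 / (L + 1)) (min 1 (δ / 2 / (L + 1))) with hτ
  have hτ0 : 0 < τ := by positivity
  have hvol : ∀ t, 0 < t → t ≤ τ →
      ∫ x in ball (0 : E) N,
          (1 + t • fderiv ℝ u x : E →L[ℝ] E).det = volume.real (ball (0 : E) N) := by
    intro t ht htτ
    have htL : t * L < 1 / 2 + 1 / 4 := by
      have h1 : t ≤ 1 / 2 / (L + 1) := htτ.trans (min_le_left _ _)
      rw [le_div_iff₀ (by positivity)] at h1
      nlinarith
    have ht1 : t ≤ 1 := htτ.trans ((min_le_right _ _).trans (min_le_left _ _))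
    have htd : t * L < δ := by
      have h1 : t ≤ δ / 2 / (L + 1) := htτ.trans ((min_le_right _ _).trans (min_le_right _ _))
      rw [le_div_iff₀ (by positivity)] at h1
      nlinarith
    let F : E → E := fun x => x + t • w x
    have hFinj : Function.Injective F := fun x y hxy => by
      have h1 : x - y = -(t • (w x - w y)) := by
        have : x + t • w x = y + t • w y := hxy
        rw [smul_sub, neg_sub, sub_eq_sub_iff_add_eq_add, this, add_comm]
      have h2 : ‖x - y‖ ≤ t * (L * ‖x - y‖) := by
        calc ‖x - y‖ = ‖t • (w x - w y)‖ := by rw [h1, norm_neg]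
          _ = t * ‖w x - w y‖ := by rw [norm_smul, Real.norm_of_nonneg ht.le]
          _ ≤ _ := by gcongr; exact hwl x y
      have : ‖x - y‖ = 0 := by nlinarith [norm_nonneg (x - y)]
      exact sub_eq_zero.1 (norm_eq_zero.1 this)
    have happ : ApproximatesLinearOn F ((ContinuousLinearEquiv.refl ℝ E : E ≃L[ℝ] E) : E →L[ℝ] E)
        univ ((3 / 4 : NNReal)) := by
      intro x _ y _
      have : F x - F y - ((ContinuousLinearEquiv.refl ℝ E : E ≃L[ℝ] E) : E →L[ℝ] E) (x - y)
          = t • (w x - w y) := by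
        simp only [F, ContinuousLinearEquiv.coe_refl, ContinuousLinearMap.coe_id', id,
            smul_sub]; abel
      rw [this, norm_smul, Real.norm_of_nonneg ht.le]
      have := hwl x y
      push_cast
      calc t * ‖w x - w y‖ ≤ t * (L * ‖x - y‖) := by gcongr
        _ ≤ _ := by nlinarith [norm_nonneg (x - y)]
    have hFsurj : Function.Surjective F := by
      rcases subsingleton_or_nontrivial E with hs | hs
      · exact fun y => ⟨y, Subsingleton.elim _ _⟩
      refine happ.surjective (Or.inr ?_)
      simp only [ContinuousLinearEquiv.refl_symm, ContinuousLinearEquiv.coe_refl]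
      rw [ContinuousLinearMap.nnnorm_id, inv_one]
      rw [div_lt_one (by norm_num)]; norm_num
    have hFin : ∀ x, ‖x‖ < N → ‖F x‖ ≤ N := fun x hx => by
      have : F x = (1 - t) • x + t • K x := by
        simp only [F, hwin x hx.le, hu, smul_sub, sub_smul, one_smul]; abel
      rw [this]
      calc _ ≤ ‖(1 - t) • x‖ + ‖t • K x‖ := norm_add_le _ _
        _ = (1 - t) * ‖x‖ + t * N := by
          rw [norm_smul, norm_smul, hn, Real.norm_of_nonneg ht.le,
              Real.norm_of_nonneg (by linarith)]
        _ ≤ N := by nlinarith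
    have hFout : ∀ x, N ≤ ‖x‖ → F x = x := fun x hx => by simp [F, hwout x hx]
    have himg : F '' ball (0 : E) N = ball (0 : E) N := by
      ext y
      simp only [mem_image, mem_ball_zero_iff]
      constructor
      · rintro ⟨x, hx, rfl⟩
        refine (hFin x hx).lt_of_ne fun h => ?_
        have := hFinj (hFout (F x) h.ge)
        rw [this] at h; exact hx.ne h
      · intro hy
        obtain ⟨x, rfl⟩ := hFsurj y
        refine ⟨x, ?_, rfl⟩
        by_contra hx
        rw [hFout x (not_lt.1 hx)] at hy; exact hx hy
    have hF' : ∀ x ∈ ball (0 : E) N,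
        HasFDerivWithinAt F (1 + t • fderiv ℝ u x : E →L[ℝ] E) (ball 0 N) x := fun x hx => by
      have h1 : HasFDerivAt (fun x => x + t • u x) (1 + t • fderiv ℝ u x : E →L[ℝ] E) x :=
        (hasFDerivAt_id x).add ((hdiff x).hasFDerivAt.const_smul t)
      refine h1.hasFDerivWithinAt.congr (fun y hy => ?_) ?_
      · simp only [F]; rw [hwin y (by simpa using (mem_ball_zero_iff.1 hy).le)]
      · simp only [F]; rw [hwin x (by simpa using (mem_ball_zero_iff.1 hx).le)]
    have := integral_image_eq_integral_abs_det_fderiv_smul volume measurableSet_ball hF'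
      hFinj.injOn (fun _ => (1 : ℝ))
    rw [himg] at this
    simp only [smul_eq_mul, mul_one, setIntegral_const] at this
    rw [this]
    refine setIntegral_congr_fun measurableSet_ball fun x hx => ?_
    refine (abs_of_pos (hdet _ ?_)).symm
    rw [norm_smul, Real.norm_of_nonneg ht.le]
    exact lt_of_le_of_lt (by gcongr; exact hL x (ball_subset_closedBall hx)) htd
  have hzero : ∀ x, (1 + (1 : ℝ) • fderiv ℝ u x : E →L[ℝ] E).det = 0 := fun x => by
    by_contra hne
    have hKd : HasFDerivAt K (1 + (1 : ℝ) • fderiv ℝ u x : E →L[ℝ] E) x := by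
      have h1 := (hasFDerivAt_id (𝕜 := ℝ) x).add ((hdiff x).hasFDerivAt.const_smul (1 : ℝ))
      refine h1.congr_of_eventuallyEq (Filter.Eventually.of_forall fun y => ?_)
      simp [hu]
    set A : E →L[ℝ] E := 1 + (1 : ℝ) • fderiv ℝ u x
    have hsurj : Function.Surjective A :=
      (LinearEquiv.ofIsUnitDet (f := (A : E →ₗ[ℝ] E)) (v := Module.finBasis ℝ E)
        (v' := Module.finBasis ℝ E) (by
          rw [LinearMap.det_toMatrix]; exact isUnit_iff_ne_zero.2 hne)).surjective
    obtain ⟨v, hv⟩ := hsurj (K x)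
    have h2 : HasFDerivAt (fun y => inner ℝ (K y) (K y)) _ x := hKd.inner ℝ hKd
    have h3 : (fun y => inner ℝ (K y) (K y)) = fun _ => N ^ 2 := by
      ext y; rw [real_inner_self_eq_norm_sq, hn]
    rw [h3] at h2
    have h4 := h2.unique (hasFDerivAt_const _ _)
    have h5 := congrArg (fun T => T v) h4
    simp [fderivInnerCLM_apply, hv, hn] at h5
    exact hN.ne' h5
  -- interpolation
  set d := Module.finrank ℝ E
  let ν : ℕ → ℝ := fun i => τ / (i + 1)
  have hνinj : Set.InjOn ν (Finset.range (d + 1)) := fun i _ j _ h => by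
    have h : τ / ((i : ℝ) + 1) = τ / (j + 1) := h
    rw [div_eq_div_iff (by positivity) (by positivity)] at h
    have := mul_left_cancel₀ hτ0.ne' h
    exact_mod_cast (add_right_cancel this).symm
  let c : ℕ → ℝ := fun i => (Lagrange.basis (Finset.range (d + 1)) ν i).eval 1
  have hpoly : ∀ p : Polynomial ℝ, p.natDegree ≤ d →
      p.eval 1 = ∑ i ∈ Finset.range (d + 1), p.eval (ν i) * c i := fun p hp => by
    have h := Lagrange.eq_interpolate (s := Finset.range (d + 1)) (v := ν) hνinj (f := p) (by
      refine lt_of_le_of_lt Polynomial.degree_le_natDegree ?_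
      rw [Finset.card_range]; exact_mod_cast Nat.lt_succ_of_le hp)
    conv_lhs => rw [h]
    simp [Lagrange.interpolate_apply, Polynomial.eval_finsetSum, c]
  have hc1 : ∑ i ∈ Finset.range (d + 1), c i = 1 := by
    have := hpoly 1 (by simp)
    simpa using this.symm
  have hinteg : ∀ t : ℝ, IntegrableOn (fun x => (1 + t • fderiv ℝ u x : E →L[ℝ] E).det)
      (ball (0 : E) N) :=
    fun t => ((ContinuousLinearMap.continuous_det.comp
      (continuous_const.add (hcf.const_smul t))).continuousOn.integrableOn_compact
        (isCompact_closedBall 0 N)).mono_set ball_subset_closedBall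
  have key : ∫ x in ball (0 : E) N, (1 + (1 : ℝ) • fderiv ℝ u x : E →L[ℝ] E).det =
      ∑ i ∈ Finset.range (d + 1),
        (∫ x in ball (0 : E) N, (1 + ν i • fderiv ℝ u x : E →L[ℝ] E).det) * c i := by
    rw [show (fun x => (1 + (1 : ℝ) • fderiv ℝ u x : E →L[ℝ] E).det) = fun x =>
      ∑ i ∈ Finset.range (d + 1), (1 + ν i • fderiv ℝ u x : E →L[ℝ] E).det * c i from ?_]
    · rw [integral_finsetSum _ fun i _ => (hinteg (ν i)).mul_const _]
      simp_rw [integral_mul_const]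
    · ext x
      obtain ⟨p, hp, hp'⟩ := exists_polynomial_eval_eq_det (fderiv ℝ u x)
      simp_rw [← hp']
      exact hpoly p hp
  have hpos : 0 < volume.real (ball (0 : E) N) :=
    ENNReal.toReal_pos (measure_ball_pos _ _ hN).ne' measure_ball_lt_top.ne
  rw [Finset.sum_congr rfl (fun i _ => by
    rw [hvol (ν i) (by positivity) (div_le_self hτ0.le (by simp))]), ← Finset.mul_sum, hc1] at key
  simp only [hzero, integral_zero, mul_one] at key
  exact hpos.ne key

omit [MeasurableSpace E] [BorelSpace E] in
/-- A continuous self-map of a Euclidean space which is the identity far out has a zero. -/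
theorem exists_zero_of_eq_self_outside {K : E → E} (hK : Continuous K) (R : ℝ)
    (hid : ∀ x, R ≤ ‖x‖ → K x = x) : ∃ x, K x = 0 := by
  borelize E
  by_contra! hne
  wlog hR : 0 < R generalizing R
  · exact this (max R 1) (fun x hx => hid x ((le_max_left _ _).trans hx)) (by positivity)
  obtain ⟨δ, hδ, hKδ⟩ : ∃ δ > 0, ∀ x, δ ≤ ‖K x‖ := by
    obtain ⟨x, -, hx⟩ := (isCompact_closedBall (0 : E) R).exists_isMinOn ⟨0, by simp [hR.le]⟩
      hK.norm.continuousOn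
    refine ⟨min ‖K x‖ R, lt_min (norm_pos_iff.2 (hne x)) hR, fun y => ?_⟩
    rcases le_total ‖y‖ R with h | h
    · exact (min_le_left _ _).trans (hx (by simpa using h))
    · rw [hid y h]; exact (min_le_right _ _).trans h
  obtain ⟨v, hv, hvd, hvs⟩ := Continuous.exists_contDiff_approx (E := E) (F := E)
    (f := fun x => K x - x) 1 (hK.sub continuous_id)
    (ε := fun _ => δ) continuous_const (fun _ => hδ)
  have hv0 : ∀ x, R ≤ ‖x‖ → v x = 0 := fun x hx => by
    by_contra h
    exact hvs (Function.mem_support.2 h) (by simp [hid x hx])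
  have hKv : ∀ x, v x + x ≠ 0 := fun x h => by
    have h1 := hvd x
    have h2 := hKδ x
    rw [dist_eq_norm, eq_neg_of_add_eq_zero_left h, norm_sub_rev] at h1
    simp at h1
    linarith
  refine no_smooth_retraction (E := E) (K := fun x => (R / ‖v x + x‖) • (v x + x)) ?_ hR
    (fun x => ?_) (fun x hx => ?_)
  · have h1 : ContDiff ℝ 1 fun x => v x + x :=
        (by exact_mod_cast hv : ContDiff ℝ 1 v).add contDiff_id
    exact (contDiff_const.div (h1.norm ℝ hKv) fun x => norm_ne_zero_iff.2 (hKv x)).smul h1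
  · rw [norm_smul, norm_div, norm_norm, Real.norm_of_nonneg hR.le,
      div_mul_cancel₀ _ (norm_ne_zero_iff.2 (hKv x))]
  · simp [hv0 x hx.ge, hx, hR.ne']

end Brouwer

end

section

section Connectivity

lemma IsPreconnected.diff_of_local {X : Type*} [TopologicalSpace X] {U N h : Set X}
    (hU : IsPreconnected U) (hN : IsOpen N) (hNU : N ⊆ U) (hh : IsOpen (U \ h))
    (hc : IsPreconnected (N \ h)) (hne : (N \ h).Nonempty) (hhN : h ∩ U ⊆ N) :
    IsPreconnected (U \ h) := by
  rw [isPreconnected_iff_subset_of_disjoint]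
  intro u v hu hv hcov hdisj
  have aux : ∀ u v : Set X, IsOpen u → IsOpen v → U \ h ⊆ u ∪ v → (U \ h) ∩ (u ∩ v) = ∅ →
      N \ h ⊆ u → U \ h ⊆ u := by
    intro u v hu hv hcov hdisj hNu
    have key : U ⊆ (u ∩ (U \ h)) ∪ N := by
      have h1 : U ⊆ (u ∩ (U \ h)) ∪ N ∪ v ∩ (U \ h) := by
        intro x hx
        by_cases hxh : x ∈ h
        · exact Or.inl (Or.inr (hhN ⟨hxh, hx⟩))
        · rcases hcov ⟨hx, hxh⟩ with h2 | h2
          · exact Or.inl (Or.inl ⟨h2, hx, hxh⟩)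
          · exact Or.inr ⟨h2, hx, hxh⟩
      have h2 : U ∩ (((u ∩ (U \ h)) ∪ N) ∩ (v ∩ (U \ h))) = ∅ := by
        ext x
        simp only [mem_inter_iff, mem_union, mem_sdiff, mem_empty_iff_false, iff_false]
        rintro ⟨hx, h1, hxv, -, hxh⟩
        have hxu : x ∈ u := by
          rcases h1 with h1 | h1
          · exact h1.1
          · exact hNu ⟨h1, hxh⟩
        have : x ∈ (U \ h) ∩ (u ∩ v) := ⟨⟨hx, hxh⟩, hxu, hxv⟩
        rw [hdisj] at this; exact this
      rcases (isPreconnected_iff_subset_of_disjoint.1 hU) ((u ∩ (U \ h)) ∪ N) (v ∩ (U \ h))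
        ((hu.inter hh).union hN) (hv.inter hh) h1 h2 with h1 | h1
      · exact h1
      · obtain ⟨x, hx⟩ := hne
        have : x ∈ (U \ h) ∩ (u ∩ v) :=
          ⟨⟨hNU hx.1, hx.2⟩, hNu hx, (h1 (hNU hx.1)).1⟩
        rw [hdisj] at this; exact this.elim
    intro x hx
    rcases key hx.1 with h1 | h1
    · exact h1.1
    · exact hNu ⟨h1, hx.2⟩
  have hsub : N \ h ⊆ U \ h := sdiff_subset_sdiff_left hNU
  rcases (isPreconnected_iff_subset_of_disjoint.1 hc) u v hu hv (hsub.trans hcov)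
    (by rw [← subset_empty_iff, ← hdisj]; exact inter_subset_inter_left _ hsub) with h1 | h1
  · exact Or.inl (aux u v hu hv hcov hdisj h1)
  · exact Or.inr (aux v u hv hu (by rwa [union_comm]) (by rwa [inter_comm v u]) h1)

variable {E : Type*} [NormedAddCommGroup E] [InnerProductSpace ℝ E]

lemma isConnected_ball_diff_singleton (hE : 1 < Module.rank ℝ E) (c : E) {r : ℝ} (hr : 0 < r) :
    IsConnected (ball c r \ {c}) := by
  let f := OpenPartialHomeomorph.univBall c r
  have h := (isConnected_compl_singleton_of_one_lt_rank hE (0 : E)).image f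
    (OpenPartialHomeomorph.continuous_univBall c r).continuousOn
  have hinj : Function.Injective f := fun x y hxy =>
    f.injOn (by simp [f, OpenPartialHomeomorph.univBall_source])
      (by simp [f, OpenPartialHomeomorph.univBall_source]) hxy
  have h0 : f 0 = c := OpenPartialHomeomorph.univBall_apply_zero c r
  have him : f '' univ = ball c r := by
    rw [← OpenPartialHomeomorph.univBall_source c r, f.image_source_eq_target,
      OpenPartialHomeomorph.univBall_target c hr]
  rwa [compl_eq_univ_sdiff, image_sdiff hinj, him, image_singleton, h0] at h

lemma IsPreconnected.diff_finite (hE : 1 < Module.rank ℝ E) {V : Set E} (hV : IsOpen V)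
    (hc : IsPreconnected V) {Z : Set E} (hZ : Z.Finite) : IsPreconnected (V \ Z) := by
  induction Z, hZ using Set.Finite.induction_on with
  | empty => simpa
  | @insert a Z ha hZ ih =>
    rw [insert_eq, union_comm, ← sdiff_sdiff]
    have hop : IsOpen (V \ Z) := hV.sdiff hZ.isClosed
    by_cases haV : a ∈ V \ Z
    · obtain ⟨r, hr, hrV⟩ := Metric.isOpen_iff.1 hop a haV
      have h := isConnected_ball_diff_singleton hE a hr
      refine ih.diff_of_local isOpen_ball hrV (hop.sdiff isClosed_singleton) h.2 h.1 ?_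
      rintro x ⟨rfl, -⟩; exact mem_ball_self hr
    · rwa [sdiff_singleton_eq_self haV]

end Connectivity

section Supported

/-- The homeomorphism `g` is the identity outside a compact subset of `V`. -/
def SuppIn {X : Type*} [TopologicalSpace X] (g : X ≃ₜ X) (V : Set X) : Prop :=
  ∃ K ⊆ V, IsCompact K ∧ ∀ x ∉ K, g x = x

namespace SuppIn
variable {X : Type*} [TopologicalSpace X] {g h : X ≃ₜ X} {V W : Set X}

lemma refl : SuppIn (Homeomorph.refl X) V := ⟨∅, by simp⟩

lemma mono (hg : SuppIn g V) (h : V ⊆ W) : SuppIn g W :=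
  let ⟨K, hK, hc, hi⟩ := hg; ⟨K, hK.trans h, hc, hi⟩

lemma apply_eq (hg : SuppIn g V) {x : X} (hx : x ∉ V) : g x = x :=
  let ⟨_, hK, _, hi⟩ := hg; hi x fun h => hx (hK h)

lemma apply_mem_iff (hg : SuppIn g V) {x : X} : g x ∈ V ↔ x ∈ V := by
  constructor
  · intro h; by_contra hx; rw [hg.apply_eq hx] at h; exact hx h
  · intro h; by_contra hx
    have := g.injective (hg.apply_eq hx)
    rw [this] at hx; exact hx h

lemma apply_mem_iff_of_subset (hg : SuppIn g V) (hVW : V ⊆ W) {x : X} : g x ∈ W ↔ x ∈ W :=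
  (hg.mono hVW).apply_mem_iff

lemma symm (hg : SuppIn g V) : SuppIn g.symm V := by
  obtain ⟨K, hK, hc, hi⟩ := hg
  refine ⟨K, hK, hc, fun x hx => ?_⟩
  rw [g.symm_apply_eq, hi x hx]

lemma trans (hg : SuppIn g V) (hh : SuppIn h V) : SuppIn (g.trans h) V := by
  obtain ⟨K, hK, hc, hi⟩ := hg
  obtain ⟨K', hK', hc', hi'⟩ := hh
  refine ⟨K ∪ K', union_subset hK hK', hc.union hc', fun x hx => ?_⟩
  rw [mem_union, not_or] at hx
  simp [hi x hx.1, hi' x hx.2]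

end SuppIn

variable {E : Type*} [NormedAddCommGroup E] [NormedSpace ℝ E]

lemma exists_homeomorph_of_lipschitz_perturbation [CompleteSpace E] {w : E → E} {c : NNReal}
    (hw : LipschitzWith c w) (hc : c < 1) : ∃ h : E ≃ₜ E, ∀ x, h x = x + w x := by
  have happ : ApproximatesLinearOn (fun x => x + w x)
      ((ContinuousLinearEquiv.refl ℝ E : E ≃L[ℝ] E) : E →L[ℝ] E) univ c := by
    intro x _ y _
    have : x + w x - (y + w y) - ((ContinuousLinearEquiv.refl ℝ E : E ≃L[ℝ] E) : E →L[ℝ] E) (x - y)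
        = w x - w y := by
      simp only [ContinuousLinearEquiv.coe_refl, ContinuousLinearMap.coe_id', id]; abel
    rw [this]
    simpa [dist_eq_norm] using hw.dist_le_mul x y
  have hcond : Subsingleton E ∨
      c < ‖((ContinuousLinearEquiv.refl ℝ E).symm : E →L[ℝ] E)‖₊⁻¹ := by
    rcases subsingleton_or_nontrivial E with hs | hs
    · exact Or.inl hs
    · right
      rw [ContinuousLinearEquiv.refl_symm, ContinuousLinearEquiv.coe_refl,
        ContinuousLinearMap.nnnorm_id, inv_one]; exact hc
  exact ⟨happ.toHomeomorph _ hcond, fun x => rfl⟩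

variable [FiniteDimensional ℝ E]

lemma exists_suppIn_ball (c v : E) {r : ℝ} (hv : ‖v‖ < r) :
    ∃ g : E ≃ₜ E, SuppIn g (closedBall c r) ∧ g c = c + v := by
  have hr : 0 < r := (norm_nonneg v).trans_lt hv
  have hL : LipschitzWith (NNReal.mk (‖v‖ / r)
      (by positivity)) fun x : E => max 0 (1 - dist x c / r) • v := by
    refine LipschitzWith.of_dist_le_mul fun x y => ?_
    rw [dist_eq_norm, ← sub_smul, norm_smul, NNReal.coe_mk]
    have h1 : ‖max 0 (1 - dist x c / r) - max 0 (1 - dist y c / r)‖ ≤ dist x y / r := by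
      rw [Real.norm_eq_abs, max_comm 0, max_comm 0]
      refine (abs_max_sub_max_le_abs _ _ _).trans ?_
      rw [show (1 - dist x c / r) - (1 - dist y c / r) = (dist y c - dist x c) / r by ring,
        abs_div, abs_of_pos hr]
      gcongr
      rw [dist_comm x y]; exact abs_dist_sub_le y x c
    calc _ ≤ dist x y / r * ‖v‖ := by gcongr
      _ = _ := by ring
  obtain ⟨g, hg⟩ := exists_homeomorph_of_lipschitz_perturbation hL
    (by rw [← NNReal.coe_lt_coe]; simpa using (div_lt_one hr).2 hv)
  refine ⟨g, ⟨_, subset_rfl, isCompact_closedBall c r, fun x hx => ?_⟩, ?_⟩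
  · rw [hg, max_eq_left, zero_smul, add_zero]
    rw [mem_closedBall, not_le] at hx
    rw [sub_nonpos, le_div_iff₀ hr]; linarith
  · simp [hg]

theorem exists_suppIn_apply_eq {V : Set E} (hV : IsOpen V) (hc : IsPreconnected V) {p q : E}
    (hp : p ∈ V) (hq : q ∈ V) : ∃ g : E ≃ₜ E, SuppIn g V ∧ g p = q := by
  let T : Set E := {x | ∃ g : E ≃ₜ E, SuppIn g V ∧ g p = x}
  have step : ∀ x ∈ V, ∃ r > 0, ball x r ⊆ V ∧ ∀ y ∈ ball x r, (y ∈ T ↔ x ∈ T) := by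
    intro x hx
    obtain ⟨r, hr, hrV⟩ := Metric.nhds_basis_closedBall.mem_iff.1 (hV.mem_nhds hx)
    refine ⟨r, hr, ball_subset_closedBall.trans hrV, fun y hy => ?_⟩
    obtain ⟨g, hg, hgx⟩ := exists_suppIn_ball x (y - x) (r := r) (by
      rwa [← dist_eq_norm])
    replace hg := hg.mono hrV
    have hgy : g x = y := by rw [hgx]; abel
    constructor
    · rintro ⟨k, hk, hkp⟩
      exact ⟨k.trans g.symm, hk.trans hg.symm, by simp [hkp, ← hgy]⟩
    · rintro ⟨k, hk, hkp⟩
      exact ⟨k.trans g, hk.trans hg, by simp [hkp, hgy]⟩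
  have hpT : p ∈ T := ⟨Homeomorph.refl E, SuppIn.refl, rfl⟩
  have h1 : IsOpen (V ∩ T) := Metric.isOpen_iff.2 fun x hx => by
    obtain ⟨r, hr, hrV, h⟩ := step x hx.1
    exact ⟨r, hr, fun y hy => ⟨hrV hy, (h y hy).2 hx.2⟩⟩
  have h2 : IsOpen (V \ T) := Metric.isOpen_iff.2 fun x hx => by
    obtain ⟨r, hr, hrV, h⟩ := step x hx.1
    exact ⟨r, hr, fun y hy => ⟨hrV hy, fun hy' => hx.2 ((h y hy).1 hy')⟩⟩
  have := hc.subset_left_of_subset_union h1 h2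
    (disjoint_left.2 fun x hx hx' => hx'.2 hx.2) (by rw [inter_union_sdiff]) ⟨p, hp, hp, hpT⟩
  exact (this hq).2

lemma IsPreconnected.diff_finite_of_finiteDimensional (hE : 1 < Module.rank ℝ E) {V : Set E}
    (hV : IsOpen V) (hc : IsPreconnected V) {Z : Set E} (hZ : Z.Finite) :
    IsPreconnected (V \ Z) := by
  let L := toEuclidean (E := E)
  have hr : 1 < Module.rank ℝ (EuclideanSpace ℝ (Fin (Module.finrank ℝ E))) := by
    rw [← Module.finrank_eq_rank, Nat.one_lt_cast] at hE ⊢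
    rwa [finrank_euclideanSpace_fin]
  have h := (hc.image L L.continuous.continuousOn).diff_finite hr
    (show IsOpen (L '' V) from L.toHomeomorph.isOpenMap V hV) (hZ.image L)
  rw [← image_sdiff L.injective] at h
  exact L.toHomeomorph.isPreconnected_image.1 h

theorem exists_suppIn_image_subset (hE : 1 < Module.rank ℝ E) {V β Z : Set E} (hV : IsOpen V)
    (hc : IsPreconnected V) (hβ : IsOpen β) (hβV : (β ∩ V).Nonempty) (hZ : Z.Finite) (hZV : Z ⊆ V) :
    ∃ g : E ≃ₜ E, SuppIn g V ∧ g '' Z ⊆ β := by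
  have : Nontrivial E := by
    refine (rank_pos_iff_nontrivial (R := ℝ)).1 (zero_le.trans_lt hE)
  induction Z, hZ using Set.Finite.induction_on with
  | empty => exact ⟨Homeomorph.refl E, SuppIn.refl, by simp⟩
  | @insert a Z ha hZ ih =>
    obtain ⟨g, hg, hgZ⟩ := ih ((subset_insert _ _).trans hZV)
    have hfin : (g '' Z).Finite := hZ.image g
    have hinf : (β ∩ V).Infinite := by
      obtain ⟨x, hx⟩ := hβV
      exact infinite_of_mem_nhds x ((hβ.inter hV).mem_nhds hx)
    obtain ⟨q, hq, hqZ⟩ := (hinf.sdiff hfin).nonempty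
    obtain ⟨k, hk, hka⟩ := exists_suppIn_apply_eq (hV.sdiff hfin.isClosed)
      (hc.diff_finite_of_finiteDimensional hE hV hfin) (p := g a) (q := q)
      ⟨hg.apply_mem_iff.2 (hZV (mem_insert _ _)), fun ⟨b, hb, hba⟩ => ha (g.injective hba ▸ hb)⟩
      ⟨hq.2, hqZ⟩
    refine ⟨g.trans k, hg.trans (hk.mono sdiff_subset), ?_⟩
    rintro _ ⟨x, hx, rfl⟩
    rcases hx with rfl | hx
    · simpa [hka] using hq.1
    · have : g x ∈ g '' Z := mem_image_of_mem g hx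
      simpa [hk.apply_eq fun h => h.2 this] using hgZ this

end Supported

end

section

section Degree
open MeasureTheory
variable {E : Type*} [NormedAddCommGroup E] [InnerProductSpace ℝ E] [FiniteDimensional ℝ E]

lemma finite_preimage_of_det_ne_zero {p : E → E} (hp : Differentiable ℝ p) {c : E} {S : Set E}
    (hS : Bornology.IsBounded S) (hreg : ∀ x, p x = c → (fderiv ℝ p x).det ≠ 0) :
    (S ∩ p ⁻¹' {c}).Finite := by
  have hcomp : IsCompact (closure S ∩ p ⁻¹' {c}) :=
    hS.isCompact_closure.inter_right (isClosed_singleton.preimage hp.continuous)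
  refine Set.Finite.subset (hcomp.finite ?_) (inter_subset_inter_left _ subset_closure)
  rw [isDiscrete_iff_nhdsNE]
  rintro x ⟨-, hx⟩
  have hx : p x = c := hx
  let e := LinearEquiv.ofIsUnitDet (f := (fderiv ℝ p x : E →ₗ[ℝ] E)) (v := Module.finBasis ℝ E)
        (v' := Module.finBasis ℝ E) (by
          rw [LinearMap.det_toMatrix]; exact isUnit_iff_ne_zero.2 (hreg x hx))
  have hev : ∀ᶠ z in nhdsWithin x {x}ᶜ, p z ≠ c := by
    exact (hp x).hasFDerivAt.eventually_ne ⟨_, e.toContinuousLinearEquiv.antilipschitz⟩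
  rw [Filter.inf_principal_eq_bot]
  exact hev.mono fun z hz hz' => hz hz'.2

lemma continuousOn_leftInvOn_of_isCompact {X Y : Type*} [TopologicalSpace X] [TopologicalSpace Y]
    [T2Space Y] {f : X → Y} {k : Y → X} {s : Set X} (hs : IsCompact s) (hf : ContinuousOn f s)
    (hk : ∀ x ∈ s, k (f x) = x) : ContinuousOn k (f '' s) := by
  rw [continuousOn_iff_isClosed]
  intro t ht
  refine ⟨f '' (s ∩ t), ((hs.inter_right ht).image_of_continuousOn
    (hf.mono inter_subset_left)).isClosed, ?_⟩
  ext y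
  constructor
  · rintro ⟨hy, x, hx, rfl⟩
    rw [mem_preimage, hk x hx] at hy
    exact ⟨⟨x, ⟨hx, hy⟩, rfl⟩, x, hx, rfl⟩
  · rintro ⟨⟨x, hx, rfl⟩, hy⟩
    exact ⟨by rw [mem_preimage, hk x hx.1]; exact hx.2, hy⟩

theorem exists_finite_zeros {g : E → E} (hg : Continuous g) {δ : ℝ} (hδ : 0 < δ)
    (hb : Bornology.IsBounded {x | ‖g x‖ < δ}) :
    ∃ G : E → E, Continuous G ∧ (∀ x, δ ≤ ‖g x‖ → G x = g x) ∧ {x | G x = 0}.Finite := by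
  borelize E
  obtain ⟨p, hp, hpd, -⟩ := hg.exists_contDiff_approx 1
    (ε := fun _ => δ / 4) continuous_const (fun _ => by positivity)
  have hpdiff : Differentiable ℝ p := hp.differentiable (by norm_num)
  obtain ⟨c, hc, hcr⟩ : ∃ c ∈ ball (0 : E) (δ / 4), ∀ x, p x = c → (fderiv ℝ p x).det ≠ 0 := by
    have h0 := addHaar_image_eq_zero_of_det_fderivWithin_eq_zero (volume : Measure E)
      (s := {x | (fderiv ℝ p x).det = 0}) (f := p) (f' := fderiv ℝ p)
      (fun x _ => (hpdiff x).hasFDerivAt.hasFDerivWithinAt) (fun x hx => hx)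
    have h1 : 0 < volume (ball (0 : E) (δ / 4)) := measure_ball_pos _ _ (by positivity)
    by_contra! hcon
    have : ball (0 : E) (δ / 4) ⊆ p '' {x | (fderiv ℝ p x).det = 0} := fun c hc => by
      obtain ⟨x, hx, hx'⟩ := hcon c hc
      exact ⟨x, hx', hx⟩
    exact (measure_mono_null this h0 ▸ h1).ne rfl
  have hcn : ‖c‖ < δ / 4 := by simpa using hc
  let l : E → ℝ := fun x => min 1 (max 0 (2 - 2 * ‖g x‖ / δ))
  have hl : Continuous l := by fun_prop
  have hl0 : ∀ x, 0 ≤ l x := fun x => by simp [l]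
  have hl1 : ∀ x, l x ≤ 1 := fun x => by simp [l]
  refine ⟨fun x => g x + l x • (p x - c - g x),
    hg.add (hl.smul ((hp.continuous.sub continuous_const).sub hg)), fun x hx => ?_, ?_⟩
  · have : l x = 0 := by
      have : 2 - 2 * ‖g x‖ / δ ≤ 0 := by
        rw [sub_nonpos, le_div_iff₀ hδ]; linarith
      simp [l, max_eq_left this]
    simp [this]
  · refine (finite_preimage_of_det_ne_zero hpdiff hb hcr).subset fun x hx => ?_
    have hx : g x + l x • (p x - c - g x) = 0 := hx
    have h1 : ‖p x - c - g x‖ < δ / 2 := by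
      calc _ = ‖(p x - g x) - c‖ := by congr 1; abel
        _ ≤ ‖p x - g x‖ + ‖c‖ := norm_sub_le _ _
        _ < δ / 4 + δ / 4 := by
          have := hpd x
          rw [dist_eq_norm] at this
          exact add_lt_add this hcn
        _ = _ := by ring
    have h2 : ‖g x‖ < δ / 2 := by
      rw [eq_neg_of_add_eq_zero_left hx, norm_neg, norm_smul, Real.norm_of_nonneg (hl0 x)]
      exact (mul_le_of_le_one_left (norm_nonneg _) (hl1 x)).trans_lt h1
    have h3 : l x = 1 := by
      have : 1 ≤ 2 - 2 * ‖g x‖ / δ := by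
        have : 2 * ‖g x‖ / δ ≤ 1 := by rw [div_le_one hδ]; linarith
        linarith
      simp [l, this]
    refine ⟨by show ‖g x‖ < δ; linarith, ?_⟩
    rw [h3, one_smul, add_sub_cancel, sub_eq_zero] at hx
    exact hx

lemma ContinuousOn.exists_extension_of_isClosed {X : Type*} [TopologicalSpace X] [NormalSpace X]
    {f : X → E} {s : Set X} (hs : IsClosed s) (hf : ContinuousOn f s) :
    ∃ g : X → E, Continuous g ∧ ∀ x ∈ s, g x = f x := by
  have : TietzeExtension E := TietzeExtension.of_tvs ℝ
  obtain ⟨g, hg⟩ := ContinuousMap.exists_restrict_eq hs (⟨s.domRestrict f, hf.domRestrict⟩ : C(s,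
      E))
  exact ⟨g, g.continuous, fun x hx => congrArg (fun h : C(s, E) => h ⟨x, hx⟩) hg⟩

/-- A zero-free map on a compact set extends to a map of the whole space with finitely many
zeros. -/
theorem exists_extension_finite_zeros [Nontrivial E] {B : Set E} (hB : IsCompact B) {k : E → E}
    (hk : ContinuousOn k B) (hk0 : ∀ x ∈ B, k x ≠ 0) :
    ∃ G : E → E, Continuous G ∧ (∀ x ∈ B, G x = k x) ∧ {x | G x = 0}.Finite := by
  obtain ⟨g, hg, hgk⟩ := hk.exists_extension_of_isClosed hB.isClosed
  obtain ⟨v, hv⟩ := exists_ne (0 : E)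
  obtain ⟨R, hR⟩ := hB.isBounded.subset_closedBall (0 : E)
  obtain ⟨m, hm, hmB⟩ : ∃ m > 0, ∀ x ∈ B, m ≤ ‖k x‖ := by
    rcases B.eq_empty_or_nonempty with rfl | hne
    · exact ⟨1, one_pos, by simp⟩
    · obtain ⟨x, hx, hmin⟩ := hB.exists_isMinOn hne hk.norm
      exact ⟨‖k x‖, norm_pos_iff.2 (hk0 x hx), fun y hy => hmin hy⟩
  let l : E → ℝ := fun x => min 1 (max 0 (‖x‖ - R))
  have hl : Continuous l := by fun_prop
  obtain ⟨G, hG, hGg, hfin⟩ := exists_finite_zeros (g := fun x => (1 - l x) • g x + l x • v)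
    (((continuous_const.sub hl).smul hg).add (hl.smul continuous_const))
    (lt_min hm (norm_pos_iff.2 hv)) (by
      refine isBounded_closedBall (x := (0 : E)) (r := R + 1) |>.subset fun x hx => ?_
      rw [mem_closedBall_zero_iff]
      by_contra! h
      have : l x = 1 := by
        have : 1 ≤ ‖x‖ - R := by linarith
        simp [l, this]
      have hx : ‖(1 - l x) • g x + l x • v‖ < min m ‖v‖ := hx
      rw [this] at hx
      simp at hx)
  refine ⟨G, hG, fun x hx => ?_, hfin⟩
  have h0 : l x = 0 := by
    have : ‖x‖ - R ≤ 0 := by simpa using hR hx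
    simp [l, this]
  have h1 : (1 - l x) • g x + l x • v = k x := by simp [h0, hgk x hx]
  rw [hGg x, h1]
  rw [h1]; exact (min_le_left _ _).trans (hmB x hx)

omit [FiniteDimensional ℝ E] in
lemma nontrivial_of_one_lt_rank (hE : 1 < Module.rank ℝ E) : Nontrivial E :=
  (rank_pos_iff_nontrivial (R := ℝ)).1 (zero_le.trans_lt hE)

open Classical in
lemma continuous_ite_of_frontier {X Y : Type*} [TopologicalSpace X] [TopologicalSpace Y]
    {f g : X → Y} {s B : Set X} (hs : IsClosed s) (hf : ContinuousOn f s) (hg : Continuous g)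
    (hB : frontier s ⊆ B) (h : ∀ x ∈ B, f x = g x) :
    Continuous fun x => if x ∈ s then f x else g x := by
  refine continuous_if (fun a ha => h a (hB ha)) ?_ hg.continuousOn
  rw [show closure {a | a ∈ s} = s from hs.closure_eq]; exact hf

/-- The image of the unit sphere under an embedding separates the space. -/
theorem not_isPreconnected_compl_of_sphere (hE : 1 < Module.rank ℝ E) {e : E → E}
    (hc : ContinuousOn e (sphere 0 1)) (hi : InjOn e (sphere 0 1)) :
    ¬ IsPreconnected (e '' sphere 0 1)ᶜ := by
  classical
  intro hcon
  have := nontrivial_of_one_lt_rank hE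
  have hS : IsCompact (sphere (0 : E) 1) := isCompact_sphere _ _
  have hT : IsCompact (e '' sphere 0 1) := hS.image_of_continuousOn hc
  let k := Function.invFunOn e (sphere (0 : E) 1)
  have hk : ∀ x ∈ sphere (0 : E) 1, k (e x) = x := fun x hx => hi.leftInvOn_invFunOn hx
  have hkc : ContinuousOn k (e '' sphere 0 1) :=
    continuousOn_leftInvOn_of_isCompact hS hc hk
  obtain ⟨G, hG, hGk, hfin⟩ := exists_extension_finite_zeros hT hkc (by
    rintro _ ⟨x, hx, rfl⟩; rw [hk x hx]
    rintro rfl; simp at hx)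
  obtain ⟨e', he', hee⟩ := hc.exists_extension_of_isClosed hS.isClosed
  obtain ⟨M, hM⟩ := ((isCompact_closedBall (0 : E) 1).image he').isBounded.subset_closedBall (0 : E)
  have hne : ((closedBall 0 M)ᶜ ∩ (e '' sphere 0 1)ᶜ).Nonempty := by
    obtain ⟨R, hR⟩ := (hT.isBounded.union (isBounded_closedBall (x := (0 : E)) (r :=
        M))).subset_closedBall (0 : E)
    obtain ⟨y, hy⟩ := NormedSpace.exists_lt_norm ℝ E R
    have hy' : y ∉ closedBall (0 : E) R := by simpa using hy
    exact ⟨y, fun h => hy' (hR (Or.inr h)), fun h => hy' (hR (Or.inl h))⟩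
  have hZ : {x | G x = 0} ⊆ (e '' sphere 0 1)ᶜ := by
    rintro x hx ⟨y, hy, rfl⟩
    have hx : G (e y) = 0 := hx
    rw [hGk _ (mem_image_of_mem e hy), hk y hy] at hx
    subst hx; simp at hy
  obtain ⟨φ, hφ, hφZ⟩ := exists_suppIn_image_subset hE hT.isClosed.isOpen_compl hcon
    (β := (closedBall 0 M)ᶜ) isClosed_closedBall.isOpen_compl hne hfin hZ
  have hfix : ∀ x ∈ e '' sphere 0 1, φ.symm x = x := fun x hx =>
    hφ.symm.apply_eq (by simpa using hx)
  have hcont := continuous_ite_of_frontier (s := closedBall (0 : E) 1) (B := sphere (0 : E) 1)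
    (f := fun x => G (φ.symm (e' x))) (g := id) isClosed_closedBall
    (hG.comp (φ.symm.continuous.comp he')).continuousOn continuous_id
    (frontier_closedBall_subset_sphere) (fun x hx => by
      have : e x ∈ e '' sphere 0 1 := mem_image_of_mem e hx
      simp only [hee x hx, hfix _ this, hGk _ this, hk x hx, id])
  obtain ⟨x, hx⟩ := exists_zero_of_eq_self_outside hcont 1 (fun x hx => by
    split_ifs with h
    · have h : x ∈ sphere (0 : E) 1 := by
        rw [mem_sphere_zero_iff_norm]; exact le_antisymm (by simpa using h) hx
      have h' : e x ∈ e '' sphere 0 1 := mem_image_of_mem e h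
      simp only [hee x h, hfix _ h', hGk _ h', hk x h]
    · rfl)
  split_ifs at hx with h
  · have h1 := hφZ (mem_image_of_mem φ (show φ.symm (e' x) ∈ {x | G x = 0} from hx))
    rw [φ.apply_symm_apply] at h1
    exact h1 (hM (mem_image_of_mem e' h))
  · rw [id] at hx; simp [hx] at h

/-- A map of compact sets which is injective on the boundary covers the complementary domain. -/
theorem mem_image_of_injOn_boundary (hE : 1 < Module.rank ℝ E) {X B V : Set E} {f : E → E} {c y : E}
    (hX : IsCompact X) (hB : IsCompact B) (hBX : B ⊆ X) (hfr : frontier X ⊆ B) (hcX : c ∈ X)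
    (hcB : c ∉ B) (hf : ContinuousOn f X) (hi : InjOn f B) (hV : IsOpen V) (hVc : IsPreconnected V)
    (hVB : Disjoint V (f '' B)) (hfX : f '' X ⊆ f '' B ∪ V) (hy : y ∈ V) : y ∈ f '' X := by
  classical
  by_contra hyX
  have := nontrivial_of_one_lt_rank hE
  have hB' : IsCompact (f '' B) := hB.image_of_continuousOn (hf.mono hBX)
  let k := Function.invFunOn f B
  have hk : ∀ x ∈ B, k (f x) = x := fun x hx => hi.leftInvOn_invFunOn hx
  have hkc : ContinuousOn k (f '' B) :=
    continuousOn_leftInvOn_of_isCompact hB (hf.mono hBX) hk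
  obtain ⟨G, hG, hGk, hfin⟩ := exists_extension_finite_zeros hB' (hkc.sub continuousOn_const)
    (k := fun x => k x - c) (by
    rintro _ ⟨x, hx, rfl⟩; rw [hk x hx, sub_ne_zero]
    rintro rfl; exact hcB hx)
  have hfX' : IsCompact (f '' X) := hX.image_of_continuousOn hf
  obtain ⟨φ, hφ, hφZ⟩ := exists_suppIn_image_subset hE hV hVc
    (β := (f '' X)ᶜ) hfX'.isClosed.isOpen_compl ⟨y, hyX,
        hy⟩ (hfin.inter_of_left V) inter_subset_right
  have hfix : ∀ x ∈ f '' B, φ.symm x = x := fun x hx =>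
    hφ.symm.apply_eq fun h => disjoint_left.1 hVB h hx
  have hon : ∀ x ∈ B, G (φ.symm (f x)) = x - c := fun x hx => by
    rw [hfix _ (mem_image_of_mem f hx), hGk _ (mem_image_of_mem f hx), hk x hx]
  have hcont := continuous_ite_of_frontier (s := X) (B := B)
    (f := fun x => G (φ.symm (f x))) (g := fun x => x - c) hX.isClosed
    (hG.comp_continuousOn (φ.symm.continuous.comp_continuousOn hf))
    (continuous_id.sub continuous_const) hfr hon
  obtain ⟨R, hR⟩ := hX.isBounded.subset_closedBall c
  obtain ⟨x, hx⟩ := exists_zero_of_eq_self_outside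
    (K := fun x => if x + c ∈ X then G (φ.symm (f (x + c))) else x + c - c)
    (hcont.comp (f := fun x => x + c) (continuous_id.add continuous_const)) (R + 1) (fun x hx => by
      have : x + c ∉ X := fun h => by
        have := hR h
        simp at this; linarith
      simp [this])
  split_ifs at hx with h
  · rcases hfX (mem_image_of_mem f h) with ⟨z, hz, hzx⟩ | h2
    · rw [← hzx, hon z hz, sub_eq_zero] at hx
      exact hcB (hx ▸ hz)
    · have h1 := hφZ (mem_image_of_mem φ
        (show φ.symm (f (x + c)) ∈ {x | G x = 0} ∩ V from ⟨hx, hφ.symm.apply_mem_iff.2 h2⟩))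
      rw [φ.apply_symm_apply] at h1
      exact h1 (mem_image_of_mem f h)
  · rw [add_sub_cancel_right] at hx
    rw [hx, zero_add] at h
    exact h hcX

end Degree

end

section

/-- Thickened torus: `T^{m+2} × ℂ`. -/
abbrev ThickTorus (m : ℕ) := (Fin (m + 2) → Circle) × ℂ

/-- Polar coordinates, with radius `exp a / 2`. -/
def polar (p : Circle × ℝ) : ℂ := (Real.exp p.2 / 2 : ℝ) * p.1

lemma continuous_polar : Continuous polar := by unfold polar; fun_prop

lemma norm_polar (p : Circle × ℝ) : ‖polar p‖ = Real.exp p.2 / 2 := by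
  rw [polar, norm_mul, Complex.norm_real, Circle.norm_coe, mul_one,
    Real.norm_of_nonneg (by positivity)]

lemma polar_injective : Function.Injective polar := by
  rintro ⟨c, a⟩ ⟨c', a'⟩ h
  have h1 : a = a' := by
    have := congrArg norm h
    simpa [norm_polar] using this
  subst h1
  have : (c : ℂ) = c' := by
    simp only [polar] at h
    exact mul_left_cancel₀ (by simp) h
  simp [Circle.ext this]

lemma isOpenMap_polar : IsOpenMap polar := by
  have hs : Function.Surjective (Prod.map Circle.exp (id : ℝ → ℝ)) :=
    Circle.exp_surjective.prodMap Function.surjective_id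
  refine IsOpenMap.of_comp (by fun_prop) hs ?_
  have h : polar ∘ Prod.map Circle.exp (id : ℝ → ℝ) =
      (Homeomorph.mulLeft₀ (1 / 2 : ℂ) (by norm_num)) ∘ Complex.exp ∘
        (Complex.equivRealProdCLM.symm.toHomeomorph ∘ (Homeomorph.prodComm ℝ ℝ)) := by
    ext ⟨s, a⟩
    simp only [polar, Function.comp, Prod.map, id, Homeomorph.coe_prodComm, Prod.swap,
      Homeomorph.coe_mulLeft₀, Circle.coe_exp]
    have : Complex.equivRealProdCLM.symm.toHomeomorph (a, s) = (a : ℂ) + s * Complex.I := by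
      exact Complex.equivRealProdCLM_symm_apply (a, s)
    rw [this, Complex.exp_add]; push_cast; ring
  rw [h]
  exact (Homeomorph.isOpenMap _).comp (Complex.isOpenMap_exp.comp
    ((Homeomorph.isOpenMap _).comp (Homeomorph.isOpenMap _)))

/-- The radial shrinking `w ↦ w / √(1 + ‖w‖²)` of the plane to the unit disc. -/
def shrink (w : ℂ) : ℂ := OpenPartialHomeomorph.univUnitBall w

lemma shrink_eq (w : ℂ) : shrink w = (((√(1 + ‖w‖ ^ 2))⁻¹ : ℝ) : ℂ) * w := by
  rw [shrink, OpenPartialHomeomorph.univUnitBall_apply]; rfl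

lemma shrink_re (w : ℂ) : (shrink w).re = (√(1 + ‖w‖ ^ 2))⁻¹ * w.re := by
  rw [shrink_eq, Complex.re_ofReal_mul]

lemma shrink_im (w : ℂ) : (shrink w).im = (√(1 + ‖w‖ ^ 2))⁻¹ * w.im := by
  rw [shrink_eq, Complex.im_ofReal_mul]

lemma isOpenEmbedding_shrink : Topology.IsOpenEmbedding shrink :=
  OpenPartialHomeomorph.isOpenEmbedding _ rfl

lemma norm_shrink (w : ℂ) : ‖shrink w‖ = (√(1 + ‖w‖ ^ 2))⁻¹ * ‖w‖ := by
  rw [shrink_eq, norm_mul, Complex.norm_real, Real.norm_of_nonneg (by positivity)]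

lemma norm_shrink_lt_one (w : ℂ) : ‖shrink w‖ < 1 := by
  have h := OpenPartialHomeomorph.univUnitBall.map_source (mem_univ w)
  exact mem_ball_zero_iff.1 h

lemma one_lt_norm_of_lt_norm_shrink {w : ℂ} (h : 0.75 < ‖shrink w‖) : 1 < ‖w‖ := by
  by_contra! hw
  have h0 := norm_nonneg w
  have hp : 0 < √(1 + ‖w‖ ^ 2) := by positivity
  have hs : √(1 + ‖w‖ ^ 2) ^ 2 = 1 + ‖w‖ ^ 2 := Real.sq_sqrt (by positivity)
  rw [norm_shrink, ← div_eq_inv_mul, lt_div_iff₀ hp] at h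
  nlinarith

lemma abs_shrink_re_lt (w : ℂ) : |(shrink w).re| < 1 :=
  (Complex.abs_re_le_norm _).trans_lt (norm_shrink_lt_one w)

lemma abs_shrink_im_lt (w : ℂ) : |(shrink w).im| < 1 :=
  (Complex.abs_im_le_norm _).trans_lt (norm_shrink_lt_one w)

lemma norm_shrink_sub_le (w v : ℂ) : ‖shrink w - shrink v‖ ≤ 2 * ‖w - v‖ := by
  set a := √(1 + ‖w‖ ^ 2) with ha
  set b := √(1 + ‖v‖ ^ 2) with hb
  have hs : a ^ 2 = 1 + ‖w‖ ^ 2 := Real.sq_sqrt (by positivity)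
  have ht : b ^ 2 = 1 + ‖v‖ ^ 2 := Real.sq_sqrt (by positivity)
  have ha0 : 0 < a := by positivity
  have hb0 : 0 < b := by positivity
  have ha1 : 1 ≤ a := by nlinarith [norm_nonneg w]
  have hva : ‖v‖ ≤ b := by nlinarith [norm_nonneg v]
  have hwa : ‖w‖ ≤ a := by nlinarith [norm_nonneg w]
  have hd := abs_norm_sub_norm_le w v
  have hab : |b - a| ≤ ‖w - v‖ := by
    have h1 : |b - a| * (b + a) = |‖w‖ - ‖v‖| * (‖w‖ + ‖v‖) := by
      have h2 := abs_of_pos (add_pos hb0 ha0)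
      have h3 := abs_of_nonneg (add_nonneg (norm_nonneg w) (norm_nonneg v))
      calc _ = |(b - a) * (b + a)| := by rw [abs_mul, h2]
        _ = |(‖w‖ - ‖v‖) * (‖w‖ + ‖v‖)| := by
          rw [← abs_neg]; congr 1; linear_combination hs - ht
        _ = _ := by rw [abs_mul, h3]
    by_contra! hlt
    nlinarith [norm_nonneg w, norm_nonneg v, norm_nonneg (w - v)]
  have h : shrink w - shrink v = ((a⁻¹ : ℝ) : ℂ) * (w - v) + (((b - a) / (a * b) : ℝ) : ℂ) * v := by
    have ha' : (a : ℂ) ≠ 0 := by exact_mod_cast ha0.ne'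
    have hb' : (b : ℂ) ≠ 0 := by exact_mod_cast hb0.ne'
    rw [shrink_eq, shrink_eq, ← ha, ← hb]; push_cast; field_simp; ring
  rw [h]
  refine (norm_add_le _ _).trans ?_
  rw [norm_mul, norm_mul, Complex.norm_real, Complex.norm_real, Real.norm_eq_abs, Real.norm_eq_abs,
    abs_div, abs_of_pos (mul_pos ha0 hb0), abs_of_pos (inv_pos.2 ha0)]
  have h1 : a⁻¹ * ‖w - v‖ ≤ ‖w - v‖ :=
    mul_le_of_le_one_left (norm_nonneg _) (inv_le_one_of_one_le₀ ha1)
  have h2 : |b - a| / (a * b) * ‖v‖ ≤ ‖w - v‖ := by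
    rw [div_mul_eq_mul_div, div_le_iff₀ (by positivity)]
    have : ‖v‖ ≤ a * b := hva.trans (le_mul_of_one_le_left hb0.le ha1)
    gcongr
  linarith

/-- The number of children of a node; it is divisible by `64`. -/
def numKids (m : ℕ) : ℕ := 2 ^ (m + 6)

instance (m : ℕ) : NeZero (numKids m) := ⟨by simp [numKids]⟩

/-- The angular scale. -/
def angScale (m : ℕ) : ℝ := 8 * Real.pi / (3 * numKids m)

lemma angScale_pos (m : ℕ) : 0 < angScale m := by
  have : (0 : ℝ) < numKids m := by exact_mod_cast Nat.pos_of_ne_zero (NeZero.ne _)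
  unfold angScale; positivity

/-- The point of the circle at (scaled) angle `x` relative to the centre of the `i`-th child. -/
def arcPt (m : ℕ) (i : Fin (numKids m)) (x : ℝ) : Circle :=
  Circle.exp (angScale m * (0.75 * i + x))

lemma continuous_arcPt (m : ℕ) (i : Fin (numKids m)) : Continuous (arcPt m i) := by
  unfold arcPt; fun_prop

lemma isOpenMap_arcPt (m : ℕ) (i : Fin (numKids m)) : IsOpenMap (arcPt m i) := by
  have : arcPt m i = Circle.exp ∘ (Homeomorph.mulLeft₀ _ (angScale_pos m).ne') ∘
      (Homeomorph.addLeft (0.75 * (i : ℝ))) := rfl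
  rw [this]
  exact isLocalHomeomorph_circleExp.isOpenMap.comp ((Homeomorph.isOpenMap _).comp
    (Homeomorph.isOpenMap _))

/-- The offset vector of the child map. -/
def kidPlane (p : Circle × ℂ) : ℂ := polar (p.1, (shrink p.2).re / 20)

/-- The third coordinate of the child map. -/
def kidSide (p : Circle × ℂ) : ℝ := (shrink p.2).im / 20

/-- The new plane coordinate, depending on the parity of the child. -/
def kidCoord (i : ℕ) (u : ℂ) (t : ℝ) : ℂ := if Even i then ⟨u.im, t⟩ else ⟨t, u.im⟩

/-- The child embeddings of the thickened torus in itself. -/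
def kidMap (m : ℕ) (i : Fin (numKids m)) (p : ThickTorus m) : ThickTorus m :=
  (Fin.cons (arcPt m i (kidPlane (p.1 (Fin.last _), p.2)).re) (Fin.init p.1),
    kidCoord i (kidPlane (p.1 (Fin.last _), p.2)) (kidSide (p.1 (Fin.last _), p.2)))

def splitLast (m : ℕ) : ThickTorus m ≃ₜ (Fin (m + 1) → Circle) × (Circle × ℂ) where
  toFun p := (Fin.init p.1, (p.1 (Fin.last _), p.2))
  invFun p := (Fin.snoc p.1 p.2.1, p.2.2)
  left_inv p := by simp
  right_inv p := by simp
  continuous_toFun := by fun_prop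
  continuous_invFun := by fun_prop

def splitFirst (m : ℕ) : (Fin (m + 1) → Circle) × (Circle × ℂ) ≃ₜ ThickTorus m where
  toFun p := (Fin.cons p.2.1 p.1, p.2.2)
  invFun p := (Fin.tail p.1, (p.1 0, p.2))
  left_inv p := by simp
  right_inv p := by simp
  continuous_toFun := by fun_prop
  continuous_invFun := by fun_prop

def kidSplit : Circle × ℂ ≃ₜ (Circle × ℝ) × ℝ where
  toFun p := ((p.1, p.2.re / 20), p.2.im / 20)
  invFun p := (p.1.1, ⟨p.1.2 * 20, p.2 * 20⟩)
  left_inv p := by simp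
  right_inv p := by simp
  continuous_toFun := by fun_prop
  continuous_invFun := by
    have : Continuous fun p : (Circle × ℝ) × ℝ => (⟨p.1.2 * 20, p.2 * 20⟩ : ℂ) := by
      simp only [Complex.mk_eq_add_mul_I]; fun_prop
    fun_prop

lemma continuous_complex_mk {X : Type*} [TopologicalSpace X] {f g : X → ℝ} (hf : Continuous f)
    (hg : Continuous g) : Continuous fun x => (⟨f x, g x⟩ : ℂ) := by
  simp only [Complex.mk_eq_add_mul_I]; fun_prop

def kidJoin (i : ℕ) : ℂ × ℝ ≃ₜ ℝ × ℂ where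
  toFun p := (p.1.re, kidCoord i p.1 p.2)
  invFun p := if Even i then (⟨p.1, p.2.re⟩, p.2.im) else (⟨p.1, p.2.im⟩, p.2.re)
  left_inv p := by unfold kidCoord; split_ifs <;> simp
  right_inv p := by unfold kidCoord; split_ifs <;> simp
  continuous_toFun := by
    unfold kidCoord
    split_ifs
    · have := continuous_complex_mk (f := fun p : ℂ × ℝ => p.1.im) (g := fun p => p.2)
        (by fun_prop) (by fun_prop)
      fun_prop
    · have := continuous_complex_mk (f := fun p : ℂ × ℝ => p.2) (g := fun p => p.1.im)
        (by fun_prop) (by fun_prop)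
      fun_prop
  continuous_invFun := by
    split_ifs
    · have := continuous_complex_mk (f := fun p : ℝ × ℂ => p.1) (g := fun p => p.2.re)
        (by fun_prop) (by fun_prop)
      fun_prop
    · have := continuous_complex_mk (f := fun p : ℝ × ℂ => p.1) (g := fun p => p.2.im)
        (by fun_prop) (by fun_prop)
      fun_prop

variable {m : ℕ}

lemma kidMap_eq_comp (i : Fin (numKids m)) : kidMap m i = splitFirst m ∘ Prod.map id
    (Prod.map (arcPt m i) id ∘ kidJoin i ∘ Prod.map polar id ∘ kidSplit ∘ Prod.map id shrink) ∘
      splitLast m := rfl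

lemma continuous_kidMap (i : Fin (numKids m)) : Continuous (kidMap m i) := by
  rw [kidMap_eq_comp]
  have := continuous_polar
  have := continuous_arcPt m i
  have := isOpenEmbedding_shrink.continuous
  fun_prop

lemma isOpenMap_kidMap (i : Fin (numKids m)) : IsOpenMap (kidMap m i) := by
  rw [kidMap_eq_comp]
  exact (Homeomorph.isOpenMap _).comp ((IsOpenMap.id.prodMap
    (((isOpenMap_arcPt m i).prodMap IsOpenMap.id).comp ((Homeomorph.isOpenMap _).comp
      ((isOpenMap_polar.prodMap IsOpenMap.id).comp ((Homeomorph.isOpenMap _).comp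
        (IsOpenMap.id.prodMap isOpenEmbedding_shrink.isOpenMap)))))).comp (Homeomorph.isOpenMap _))

lemma exp_twentieth_lt : Real.exp (1 / 20) < 1.0527 := by
  have h1 := Real.add_one_le_exp (-(1 / 20) : ℝ)
  have h2 : Real.exp (1 / 20) * Real.exp (-(1 / 20)) = 1 := by rw [← Real.exp_add]; simp
  nlinarith [Real.exp_pos (1 / 20)]

lemma norm_kidPlane (p : Circle × ℂ) : ‖kidPlane p‖ = Real.exp ((shrink p.2).re / 20) / 2 :=
  norm_polar _

lemma norm_kidPlane_lt (p : Circle × ℂ) : ‖kidPlane p‖ < Real.exp (1 / 20) / 2 := by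
  rw [norm_kidPlane]
  have := (abs_lt.1 (abs_shrink_re_lt p.2)).2
  gcongr

lemma norm_kidPlane_lt' (p : Circle × ℂ) : ‖kidPlane p‖ < 0.527 := by
  linarith [norm_kidPlane_lt p, exp_twentieth_lt]

lemma lt_norm_kidPlane (p : Circle × ℂ) : 0.475 < ‖kidPlane p‖ := by
  rw [norm_kidPlane]
  have := (abs_lt.1 (abs_shrink_re_lt p.2)).1
  have h1 := Real.add_one_le_exp ((shrink p.2).re / 20)
  linarith

lemma abs_kidSide_lt (p : Circle × ℂ) : |kidSide p| < 0.05 := by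
  have := abs_shrink_im_lt p.2
  rw [kidSide, abs_div]; norm_num; linarith

lemma sq_norm_kidPlane (p : Circle × ℂ) :
    ‖kidPlane p‖ ^ 2 = (kidPlane p).re ^ 2 + (kidPlane p).im ^ 2 := by
  rw [Complex.sq_norm, Complex.normSq_apply]; ring

/-- Two descriptions of the same angle differ by a multiple of the spacing. -/
lemma exists_int_of_arcPt_eq {i j : Fin (numKids m)} {x y : ℝ} (h : arcPt m i x = arcPt m j y) :
    ∃ d r : ℤ, x - y = 0.75 * d ∧ d = (j : ℤ) - i + r * numKids m := by
  obtain ⟨r, hr⟩ := Circle.exp_eq_exp.1 h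
  refine ⟨(j : ℤ) - i + r * numKids m, r, ?_, rfl⟩
  have hk : (numKids m : ℝ) ≠ 0 := by exact_mod_cast NeZero.ne _
  have h2 : 2 * Real.pi = angScale m * (0.75 * numKids m) := by
    unfold angScale; field_simp; ring
  have h3 : angScale m * (0.75 * i + x) = angScale m * (0.75 * j + y + r * (0.75 * numKids m)) := by
    rw [hr, h2]; ring
  have h4 := mul_left_cancel₀ (angScale_pos m).ne' h3
  push_cast
  linarith

lemma eq_of_arcPt_eq {i j : Fin (numKids m)} {r : ℤ} (h : (0 : ℤ) = (j : ℤ) - i + r * numKids m) :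
    i = j := by
  have hi := i.2
  have hj := j.2
  have hr : r = 0 := by
    rcases lt_trichotomy r 0 with h0 | h0 | h0
    · nlinarith
    · exact h0
    · nlinarith
  subst hr
  ext; omega

lemma even_numKids (m : ℕ) : Even (numKids m) := ⟨2 ^ (m + 5), by unfold numKids; ring⟩

lemma odd_iff_of_offset {i j : Fin (numKids m)} {d r : ℤ} (hd : d = (j : ℤ) - i + r * numKids m)
    (ho : Odd d) : Even (i : ℕ) ↔ ¬ Even (j : ℕ) := by
  have h := even_numKids m
  have : Even ((r : ℤ) * numKids m) := ((Int.even_coe_nat _).2 h).mul_left r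
  rw [hd, Int.odd_add, iff_true_right this, Int.odd_sub, Int.even_coe_nat, Int.odd_coe_nat,
    ← Nat.not_even_iff_odd] at ho
  tauto

lemma offset_cases {x y : ℝ} {d : ℤ} (h : x - y = 0.75 * d) (hx : |x| < 0.6) (hy : |y| < 0.6) :
    d = 0 ∨ d = 1 ∨ d = -1 := by
  obtain ⟨h1, h2⟩ := abs_lt.1 hx
  obtain ⟨h3, h4⟩ := abs_lt.1 hy
  have : -2 < d := by
    have : (-2 : ℝ) < d := by linarith
    exact_mod_cast this
  have : d < 2 := by
    have : (d : ℝ) < 2 := by linarith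
    exact_mod_cast this
  omega

lemma abs_kidPlane_re_lt (p : Circle × ℂ) : |(kidPlane p).re| < 0.527 :=
  (Complex.abs_re_le_norm _).trans_lt (norm_kidPlane_lt' p)


/-- Offset circles of neighbouring children are disjoint. -/
lemma index_eq_of_kid_eq {i j : Fin (numKids m)} {p p' : Circle × ℂ}
    (h1 : arcPt m i (kidPlane p).re = arcPt m j (kidPlane p').re)
    (h2 : kidCoord i (kidPlane p) (kidSide p) = kidCoord j (kidPlane p') (kidSide p')) :
    i = j ∧ kidPlane p = kidPlane p' ∧ kidSide p = kidSide p' := by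
  obtain ⟨d, r, hd, hdr⟩ := exists_int_of_arcPt_eq h1
  have a1 := abs_kidPlane_re_lt p
  have a2 := abs_kidPlane_re_lt p'
  have key : d ≠ 0 → False := by
    intro h0
    have hc := offset_cases hd (by linarith) (by linarith)
    have hodd : Odd d := by
      rcases hc with h | h | h
      · exact absurd h h0
      · rw [h]; decide
      · rw [h]; decide
    have hpar := odd_iff_of_offset hdr hodd
    have him : (kidPlane p).im ^ 2 < 0.05 ^ 2 ∧ (kidPlane p').im ^ 2 < 0.05 ^ 2 := by
      have b1 := sq_lt_sq' (abs_lt.1 (abs_kidSide_lt p)).1 (abs_lt.1 (abs_kidSide_lt p)).2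
      have b2 := sq_lt_sq' (abs_lt.1 (abs_kidSide_lt p')).1 (abs_lt.1 (abs_kidSide_lt p')).2
      unfold kidCoord at h2
      rw [Complex.ext_iff] at h2
      by_cases hi : Even (i : ℕ)
      · have hj := hpar.1 hi
        simp only [hi, hj, if_true, if_false] at h2
        rw [h2.1, ← h2.2]; exact ⟨b2, b1⟩
      · have hj : Even (j : ℕ) := by tauto
        simp only [hi, hj, if_true, if_false] at h2
        rw [h2.2, ← h2.1]; exact ⟨b2, b1⟩
    have c1 := sq_norm_kidPlane p
    have c2 := sq_norm_kidPlane p'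
    have e1 := lt_norm_kidPlane p
    have e2 := lt_norm_kidPlane p'
    have f1 : (0.45 : ℝ) < |(kidPlane p).re| := by
      refine lt_of_pow_lt_pow_left₀ 2 (abs_nonneg _) ?_
      rw [sq_abs]; nlinarith
    have f2 : (0.45 : ℝ) < |(kidPlane p').re| := by
      refine lt_of_pow_lt_pow_left₀ 2 (abs_nonneg _) ?_
      rw [sq_abs]; nlinarith
    rw [lt_abs] at f1 f2
    rw [abs_lt] at a1 a2
    rcases hc with h | h | h
    · exact h0 h
    · rw [h] at hd; push_cast at hd
      rcases f1 with f1 | f1 <;> rcases f2 with f2 | f2 <;> linarith [a1.1, a1.2, a2.1, a2.2]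
    · rw [h] at hd; push_cast at hd
      rcases f1 with f1 | f1 <;> rcases f2 with f2 | f2 <;> linarith [a1.1, a1.2, a2.1, a2.2]
  have hd0 : d = 0 := by by_contra h; exact key h
  subst hd0
  have hij := eq_of_arcPt_eq hdr
  subst hij
  have hre : (kidPlane p).re = (kidPlane p').re := by
    push_cast at hd; linarith
  refine ⟨rfl, ?_⟩
  unfold kidCoord at h2
  rw [Complex.ext_iff] at h2 ⊢
  split_ifs at h2
  · exact ⟨⟨hre, h2.1⟩, h2.2⟩
  · exact ⟨⟨hre, h2.2⟩, h2.1⟩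

lemma kidMap_eq_iff {i j : Fin (numKids m)} {p p' : ThickTorus m} :
    kidMap m i p = kidMap m j p' ↔ i = j ∧ p = p' := by
  refine ⟨fun h => ?_, by rintro ⟨rfl, rfl⟩; rfl⟩
  have h1 := congrArg (fun x : ThickTorus m => x.1 0) h
  have h2 := congrArg (fun x : ThickTorus m => Fin.tail x.1) h
  have h3 := congrArg Prod.snd h
  simp only [kidMap, Fin.cons_zero, Fin.tail_cons] at h1 h2 h3
  obtain ⟨hij, h4, h5⟩ := index_eq_of_kid_eq h1 h3
  refine ⟨hij, ?_⟩
  have h6 := polar_injective h4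
  simp only [Prod.mk.injEq] at h6
  have h7 : shrink p.2 = shrink p'.2 := by
    simp only [kidSide] at h5
    refine Complex.ext ?_ ?_ <;> linarith [h6.2]
  refine (splitLast m).injective ?_
  exact Prod.ext h2 (Prod.ext h6.1 (isOpenEmbedding_shrink.injective h7))

lemma isOpenEmbedding_kidMap (i : Fin (numKids m)) : Topology.IsOpenEmbedding (kidMap m i) :=
  .of_continuous_injective_isOpenMap (continuous_kidMap i)
    (fun _ _ h => (kidMap_eq_iff.1 h).2) (isOpenMap_kidMap i)

lemma norm_kidMap_le (i : Fin (numKids m)) (p : ThickTorus m) : ‖(kidMap m i p).2‖ ≤ 0.7 := by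
  have h1 := abs_kidSide_lt (p.1 (Fin.last _), p.2)
  have h2 := (Complex.abs_im_le_norm _).trans_lt (norm_kidPlane_lt' (p.1 (Fin.last _), p.2))
  have := Complex.norm_le_abs_re_add_abs_im (kidMap m i p).2
  refine this.trans ?_
  simp only [kidMap, kidCoord]
  split_ifs <;> dsimp only <;> linarith

end

section

variable {m : ℕ}

lemma circle_dist_eq (c d : Circle) : dist c d = ‖(c : ℂ) - d‖ := by
  rw [← dist_eq_norm]; rfl

lemma dist_arcPt_le (i : Fin (numKids m)) (x y : ℝ) :
    dist (arcPt m i x) (arcPt m i y) ≤ angScale m * |x - y| := by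
  have h : arcPt m i x = arcPt m i y * Circle.exp (angScale m * (x - y)) := by
    rw [arcPt, arcPt, ← Circle.exp_add]; congr 1; ring
  rw [circle_dist_eq, h, Circle.coe_mul, ← mul_sub_one, norm_mul, Circle.norm_coe, one_mul,
    Circle.coe_exp, mul_comm _ Complex.I]
  refine (Real.norm_exp_I_mul_ofReal_sub_one_le).trans ?_
  rw [Real.norm_eq_abs, abs_mul, abs_of_pos (angScale_pos m)]

lemma norm_kidPlane_sub_le (p p' : Circle × ℂ) :
    ‖kidPlane p - kidPlane p'‖ ≤ 0.53 * dist p.1 p'.1 + 0.06 * dist p.2 p'.2 := by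
  set a := (shrink p.2).re / 20 with ha
  set b := (shrink p'.2).re / 20 with hb
  have hab : |a - b| ≤ dist p.2 p'.2 / 10 := by
    have h1 := (Complex.abs_re_le_norm _).trans (norm_shrink_sub_le p.2 p'.2)
    rw [Complex.sub_re] at h1
    rw [ha, hb, ← sub_div, abs_div, abs_of_pos (show (0 : ℝ) < 20 by norm_num), dist_eq_norm]
    linarith
  have key : ∀ s t : ℝ, s ≤ 1 / 20 → Real.exp s - Real.exp t ≤ 1.06 * |s - t| := by
    intro s t hs
    have h1 := Real.add_one_le_exp (t - s)
    have h2 : Real.exp t = Real.exp s * Real.exp (t - s) := by rw [← Real.exp_add]; ring_nf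
    have h3 := (Real.exp_le_exp.2 hs).trans exp_twentieth_lt.le
    have h4 := le_abs_self (s - t)
    have h5 := abs_nonneg (s - t)
    have h6 := Real.exp_pos s
    rw [h2]
    nlinarith
  have ha1 : a ≤ 1 / 20 := by have := (abs_lt.1 (abs_shrink_re_lt p.2)).2; linarith
  have hb1 : b ≤ 1 / 20 := by have := (abs_lt.1 (abs_shrink_re_lt p'.2)).2; linarith
  have hexp : |Real.exp a - Real.exp b| ≤ 1.06 * |a - b| := by
    rw [abs_le']
    refine ⟨key a b ha1, ?_⟩
    rw [neg_sub, abs_sub_comm]; exact key b a hb1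
  have h : kidPlane p - kidPlane p' =
      (Real.exp a / 2 : ℝ) * ((p.1 : ℂ) - p'.1) + ((Real.exp a - Real.exp b) / 2 : ℝ) * p'.1 := by
    simp only [kidPlane, polar, ← ha, ← hb]; push_cast; ring
  rw [h]
  refine (norm_add_le _ _).trans ?_
  rw [norm_mul, norm_mul, Circle.norm_coe, Complex.norm_real, Complex.norm_real,
    Real.norm_of_nonneg (by positivity), Real.norm_eq_abs, abs_div, abs_two, circle_dist_eq]
  have h1 := (Real.exp_le_exp.2 ha1).trans exp_twentieth_lt.le
  have h2 := norm_nonneg ((p.1 : ℂ) - p'.1)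
  have : Real.exp a / 2 * ‖(p.1 : ℂ) - p'.1‖ ≤ 0.53 * ‖(p.1 : ℂ) - p'.1‖ := by
    gcongr; linarith
  have := dist_nonneg (x := p.2) (y := p'.2)
  linarith

/-- A metric on the thickened torus which the child maps contract. -/
def wdist (p p' : ThickTorus m) : ℝ :=
  (∑ l : Fin (m + 2), (1 / 2) ^ (l : ℕ) * dist (p.1 l) (p'.1 l)) + (1 / 2) ^ (m + 2) * dist p.2 p'.2

lemma angScale_le (m : ℕ) : angScale m ≤ (1 / 2) ^ (m + 2) * 0.5625 := by
  have h : (numKids m : ℝ) = 2 ^ (m + 2) * 16 := by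
    simp only [numKids]; push_cast; ring
  have hp := Real.pi_lt_d2
  rw [angScale, h, div_le_iff₀ (by positivity)]
  have : ((1 : ℝ) / 2) ^ (m + 2) * 2 ^ (m + 2) = 1 := by rw [← mul_pow]; norm_num
  linear_combination 8 * hp - 27 * this

lemma wdist_kidMap_le (i : Fin (numKids m)) (p p' : ThickTorus m) :
    wdist (kidMap m i p) (kidMap m i p') ≤ 1 / 2 * wdist p p' := by
  unfold wdist
  rw [Fin.sum_univ_succ, Fin.sum_univ_castSucc (n := m + 1)]
  set P := (p.1 (Fin.last (m + 1)), p.2)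
  set P' := (p'.1 (Fin.last (m + 1)), p'.2)
  have hu := norm_kidPlane_sub_le P P'
  have h0 : dist ((kidMap m i p).1 0) ((kidMap m i p').1 0) ≤
      (1 / 2) ^ (m + 2) * 0.5625 * ‖kidPlane P - kidPlane P'‖ := by
    refine (dist_arcPt_le i _ _).trans ?_
    gcongr
    · exact angScale_le m
    · rw [← Complex.sub_re]; exact Complex.abs_re_le_norm _
  have hs : |kidSide P - kidSide P'| ≤ 0.1 * dist p.2 p'.2 := by
    have h1 := (Complex.abs_im_le_norm _).trans (norm_shrink_sub_le p.2 p'.2)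
    rw [Complex.sub_im] at h1
    rw [kidSide, kidSide, ← sub_div, abs_div, abs_of_pos (show (0 : ℝ) < 20 by norm_num),
      dist_eq_norm]
    simp only [P, P'] at *
    linarith
  have h2 : dist (kidMap m i p).2 (kidMap m i p').2 ≤
      ‖kidPlane P - kidPlane P'‖ + 0.1 * dist p.2 p'.2 := by
    rw [dist_eq_norm]
    refine (Complex.norm_le_abs_re_add_abs_im _).trans ?_
    have h3 := Complex.abs_im_le_norm (kidPlane P - kidPlane P')
    rw [Complex.sub_im] at h3
    change |((kidCoord i (kidPlane P) (kidSide P)) - (kidCoord i (kidPlane P') (kidSide P'))).re| +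
      |((kidCoord i (kidPlane P) (kidSide P)) - (kidCoord i (kidPlane P') (kidSide P'))).im| ≤ _
    simp only [kidCoord]
    split_ifs <;> rw [Complex.sub_re, Complex.sub_im] <;> dsimp only <;> linarith
  have h3 : ∑ l : Fin (m + 1), ((1 : ℝ) / 2) ^ ((l.succ : Fin (m + 2)) : ℕ) *
      dist ((kidMap m i p).1 l.succ) ((kidMap m i p').1 l.succ) =
      1 / 2 * ∑ l : Fin (m + 1), (1 / 2) ^ ((l.castSucc : Fin (m + 2)) : ℕ) *
        dist (p.1 l.castSucc) (p'.1 l.castSucc) := by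
    rw [Finset.mul_sum]
    refine Finset.sum_congr rfl fun l _ => ?_
    simp only [kidMap, Fin.cons_succ, Fin.val_succ, Fin.val_castSucc, Fin.init]
    ring
  rw [h3]
  simp only [Fin.val_zero, pow_zero, one_mul, Fin.val_last]
  have hc : (0 : ℝ) < (1 / 2) ^ (m + 2) := by positivity
  have hc2 : ((1 : ℝ) / 2) ^ (m + 1) = 2 * (1 / 2) ^ (m + 2) := by ring
  rw [hc2]
  set c := ((1 : ℝ) / 2) ^ (m + 2)
  have e1 : P.1 = p.1 (Fin.last (m + 1)) := rfl
  have e2 : P'.1 = p'.1 (Fin.last (m + 1)) := rfl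
  have e3 : P.2 = p.2 := rfl
  have e4 : P'.2 = p'.2 := rfl
  rw [e1, e2, e3, e4] at hu
  have d1 := dist_nonneg (x := p.1 (Fin.last (m + 1))) (y := p'.1 (Fin.last (m + 1)))
  have d2 := dist_nonneg (x := p.2) (y := p'.2)
  have := mul_le_mul_of_nonneg_left h2 hc.le
  have := mul_le_mul_of_nonneg_left hu hc.le
  have := mul_nonneg hc.le d1
  have := mul_nonneg hc.le d2
  nlinarith

lemma dist_le_wdist (p p' : ThickTorus m) : dist p p' ≤ 2 ^ (m + 2) * wdist p p' := by
  have hs : ∀ l ∈ (Finset.univ : Finset (Fin (m + 2))),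
      0 ≤ ((1 : ℝ) / 2) ^ (l : ℕ) * dist (p.1 l) (p'.1 l) := fun l _ => by positivity
  have h0 := Finset.sum_nonneg hs
  have hw : 0 ≤ wdist p p' := add_nonneg h0 (by positivity)
  have hone : (2 : ℝ) ^ (m + 2) * (1 / 2) ^ (m + 2) = 1 := by rw [← mul_pow]; norm_num
  rw [Prod.dist_eq, max_le_iff]
  constructor
  · refine (dist_pi_le_iff (by positivity)).2 fun l => ?_
    have h1 := Finset.single_le_sum hs (Finset.mem_univ l)
    have h2 : ((1 : ℝ) / 2) ^ (l : ℕ) * dist (p.1 l) (p'.1 l) ≤ wdist p p' :=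
      h1.trans (le_add_of_nonneg_right (by positivity))
    have h3 : ((1 : ℝ) / 2) ^ (m + 2) ≤ (1 / 2) ^ (l : ℕ) :=
      pow_le_pow_of_le_one (by norm_num) (by norm_num) l.2.le
    calc dist (p.1 l) (p'.1 l) = 2 ^ (m + 2) * ((1 / 2) ^ (m + 2) * dist (p.1 l) (p'.1 l)) := by
          rw [← mul_assoc, hone, one_mul]
      _ ≤ 2 ^ (m + 2) * wdist p p' := by
          gcongr
          exact (mul_le_mul_of_nonneg_right h3 dist_nonneg).trans h2
  · calc dist p.2 p'.2 = 2 ^ (m + 2) * ((1 / 2) ^ (m + 2) * dist p.2 p'.2) := by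
          rw [← mul_assoc, hone, one_mul]
      _ ≤ 2 ^ (m + 2) * wdist p p' := by
          gcongr
          exact le_add_of_nonneg_left h0

/-- The composite of the child maps along a word. -/
def kidWord (m : ℕ) (w : List (Fin (numKids m))) : ThickTorus m → ThickTorus m :=
  w.foldr (fun i f => kidMap m i ∘ f) id

@[simp] lemma kidWord_nil : kidWord m [] = id := rfl

@[simp] lemma kidWord_cons (i : Fin (numKids m)) (w : List (Fin (numKids m))) :
    kidWord m (i :: w) = kidMap m i ∘ kidWord m w := rfl

lemma kidWord_append (v w : List (Fin (numKids m))) :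
    kidWord m (v ++ w) = kidWord m v ∘ kidWord m w := by
  induction v with
  | nil => rfl
  | cons i v ih => rw [List.cons_append, kidWord_cons, ih]; rfl

lemma isOpenEmbedding_kidWord (w : List (Fin (numKids m))) :
    Topology.IsOpenEmbedding (kidWord m w) := by
  induction w with
  | nil => exact .id
  | cons i w ih => exact (isOpenEmbedding_kidMap i).comp ih

lemma kidWord_eq_of_length {v w : List (Fin (numKids m))} (hl : v.length = w.length)
    {p p' : ThickTorus m} (h : kidWord m v p = kidWord m w p') : v = w ∧ p = p' := by
  induction v generalizing w with
  | nil =>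
    obtain rfl : w = [] := by simpa using hl.symm
    exact ⟨rfl, h⟩
  | cons i v ih =>
    obtain _ | ⟨j, w⟩ := w
    · simp at hl
    obtain ⟨rfl, h'⟩ := kidMap_eq_iff.1 h
    obtain ⟨rfl, hp⟩ := ih (by simpa using hl) h'
    exact ⟨rfl, hp⟩

lemma wdist_kidWord_le {w : List (Fin (numKids m))} (hw : w ≠ []) (p p' : ThickTorus m) :
    wdist (kidWord m w p) (kidWord m w p') ≤ (1 / 2) ^ w.length * 12 := by
  induction w with
  | nil => exact absurd rfl hw
  | cons i w ih =>
    by_cases h0 : w = []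
    · subst h0
      have h1 : ∀ c d : Circle, dist c d ≤ 2 := fun c d => by
        rw [circle_dist_eq]
        refine (norm_sub_le _ _).trans ?_
        rw [Circle.norm_coe, Circle.norm_coe]; norm_num
      have h2 : ∑ l : Fin (m + 2), ((1 : ℝ) / 2) ^ (l : ℕ) *
          dist ((kidMap m i p).1 l) ((kidMap m i p').1 l) ≤ 4 := by
        calc _ ≤ ∑ l : Fin (m + 2), ((1 : ℝ) / 2) ^ (l : ℕ) * 2 := by
              gcongr; exact h1 _ _
          _ = (∑ l ∈ Finset.range (m + 2), ((1 : ℝ) / 2) ^ l) * 2 := by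
              rw [← Finset.sum_mul, Fin.sum_univ_eq_sum_range (fun l => ((1 : ℝ) / 2) ^ l)]
          _ ≤ 2 * 2 := by
              gcongr
              exact sum_geometric_two_le _
          _ = 4 := by norm_num
      have h3 : dist (kidMap m i p).2 (kidMap m i p').2 ≤ 2 := by
        rw [dist_eq_norm]
        have := norm_sub_le (kidMap m i p).2 (kidMap m i p').2
        linarith [norm_kidMap_le i p, norm_kidMap_le i p']
      have h4 : ((1 : ℝ) / 2) ^ (m + 2) ≤ 1 := pow_le_one₀ (by norm_num) (by norm_num)
      have h5 : ((1 : ℝ) / 2) ^ (m + 2) * dist (kidMap m i p).2 (kidMap m i p').2 ≤ 1 * 2 := by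
        gcongr
      simp only [kidWord_cons, kidWord_nil, Function.comp_id, List.length_singleton, wdist]
      linarith
    · refine (wdist_kidMap_le i _ _).trans ?_
      have := ih h0
      change 1 / 2 * wdist (kidWord m w p) (kidWord m w p') ≤ _
      rw [List.length_cons, pow_succ]
      linarith

lemma exists_dist_kidWord_lt {ε : ℝ} (hε : 0 < ε) : ∃ j : ℕ, ∀ w : List (Fin (numKids m)),
    j ≤ w.length → ∀ p p', dist (kidWord m w p) (kidWord m w p') < ε := by
  obtain ⟨j, hj⟩ := exists_pow_lt_of_lt_one (y := (1 / 2 : ℝ))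
    (show 0 < ε / (2 ^ (m + 2) * 12) by positivity) (by norm_num)
  refine ⟨j + 1, fun w hw p p' => ?_⟩
  have hne : w ≠ [] := by rintro rfl; simp at hw
  have h1 := wdist_kidWord_le hne p p'
  have h2 : ((1 : ℝ) / 2) ^ w.length ≤ (1 / 2) ^ j :=
    pow_le_pow_of_le_one (by norm_num) (by norm_num) (by omega)
  rw [lt_div_iff₀ (by positivity)] at hj
  calc _ ≤ 2 ^ (m + 2) * wdist (kidWord m w p) (kidWord m w p') := dist_le_wdist _ _
    _ ≤ 2 ^ (m + 2) * ((1 / 2) ^ j * 12) := by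
        gcongr
        exact h1.trans (by gcongr)
    _ < ε := by linarith

end

section

variable {m : ℕ}

/-- The real part of a point of the circle. -/
def cre (c : Circle) : ℝ := (c : ℂ).re

lemma continuous_cre : Continuous cre := by unfold cre; fun_prop

/-- The plane coordinate which is transverse to the circles of children of the parity of `i`. -/
def sideCoord (i : ℕ) (w : ℂ) : ℝ := if Even i then w.im else w.re

lemma continuous_sideCoord (i : ℕ) : Continuous (sideCoord i) := by
  unfold sideCoord; split_ifs <;> fun_prop

/-- The pair consisting of the last circle coordinate and the plane coordinate. -/
def lastPair (p : ThickTorus m) : Circle × ℂ := (p.1 (Fin.last _), p.2)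

lemma kidMap_zero (i : Fin (numKids m)) (p : ThickTorus m) :
    (kidMap m i p).1 0 = arcPt m i (kidPlane (lastPair p)).re := rfl

lemma kidMap_succ (i : Fin (numKids m)) (p : ThickTorus m) (l : Fin (m + 1)) :
    (kidMap m i p).1 l.succ = p.1 l.castSucc := rfl

lemma kidMap_snd (i : Fin (numKids m)) (p : ThickTorus m) :
    (kidMap m i p).2 = kidCoord i (kidPlane (lastPair p)) (kidSide (lastPair p)) := rfl

lemma kidPlane_re (p : Circle × ℂ) :
    (kidPlane p).re = Real.exp ((shrink p.2).re / 20) / 2 * cre p.1 := by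
  simp only [kidPlane, polar, Complex.re_ofReal_mul, cre]

lemma sideCoord_kidCoord_of_iff {i j : ℕ} (h : Even j ↔ Even i) (u : ℂ) (t : ℝ) :
    sideCoord j (kidCoord i u t) = t := by
  unfold sideCoord kidCoord; by_cases hi : Even i <;> simp [h, hi]

lemma sideCoord_kidCoord_of_iff_not {i j : ℕ} (h : Even j ↔ ¬ Even i) (u : ℂ) (t : ℝ) :
    sideCoord j (kidCoord i u t) = u.im := by
  unfold sideCoord kidCoord; by_cases hi : Even i <;> simp [h, hi]

lemma eq_of_kidMap_near {i l : Fin (numKids m)} {p : ThickTorus m} {x : ℝ}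
    (h0 : (kidMap m i p).1 0 = arcPt m l x) (hx : 0.5 < |x|) (hx' : |x| < 0.6)
    (hs : |sideCoord l (kidMap m i p).2| < 0.1) : i = l ∧ (kidPlane (lastPair p)).re = x := by
  rw [kidMap_zero] at h0
  obtain ⟨d, r, hd, hdr⟩ := exists_int_of_arcPt_eq h0
  have a1 := abs_kidPlane_re_lt (lastPair p)
  rcases offset_cases hd (by linarith) hx' with h | h | h
  · subst h
    refine ⟨eq_of_arcPt_eq hdr, ?_⟩
    push_cast at hd; linarith
  all_goals
    exfalso
    have hpar := odd_iff_of_offset hdr (by rw [h]; decide)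
    rw [kidMap_snd, sideCoord_kidCoord_of_iff_not (by tauto)] at hs
    have c1 := sq_norm_kidPlane (lastPair p)
    have e1 := lt_norm_kidPlane (lastPair p)
    have him := sq_lt_sq' (abs_lt.1 hs).1 (abs_lt.1 hs).2
    have f1 : (0.45 : ℝ) < |(kidPlane (lastPair p)).re| := by
      refine lt_of_pow_lt_pow_left₀ 2 (abs_nonneg _) ?_
      rw [sq_abs]; nlinarith
    rw [h] at hd; push_cast at hd
    rw [lt_abs] at f1 hx
    rw [abs_lt] at a1 hx'
    rcases f1 with f1 | f1 <;> rcases hx with f2 | f2 <;> linarith [a1.1, a1.2, hx'.1, hx'.2]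

/-- The part of the thickened torus that is kept above the plane. -/
def keepSet (m : ℕ) : Set (ThickTorus m) := {p | ‖p.2‖ ≤ 1 ∨ 0 ≤ cre (p.1 1)}

/-- A thickened spherical shell over a half of the torus. -/
def shellSet (m : ℕ) : Set (ThickTorus m) := {p | cre (p.1 1) < 0 ∧ 0.9 < ‖p.2‖}

/-- A slab reaching from the shell to the `l`-th child. -/
def slabSet (m : ℕ) (l : Fin (numKids m)) : Set (ThickTorus m) :=
  {p | (∀ j : Fin (m + 1), cre (p.1 j.succ) < 0) ∧
    (∃ x, (-(Real.exp (1 / 20) / 2) < x ∧ x < -(Real.exp (0.75 / 20) / 2)) ∧ p.1 0 = arcPt m l x) ∧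
    |sideCoord l p.2| < 0.1}

/-- The region in which the children are pushed through the plane. -/
def reachSet (m : ℕ) : Set (ThickTorus m) := shellSet m ∪ ⋃ l, slabSet m l

/-- The part of the boundary layer used to connect the successive stages. -/
def legSet (m : ℕ) : Set (ThickTorus m) := {p | (∀ j : Fin (m + 1), 0 < cre (p.1 j.succ)) ∧
    1 < ‖p.2‖}

/-- A connected set outside the children which touches the leg of the child `0`. -/
def postSet (m : ℕ) : Set (ThickTorus m) :=
  {p | (∀ j : Fin (m + 1), 0 < cre (p.1 j.succ)) ∧ (0.9 < ‖p.2‖ ∨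
    ((∃ x, (Real.exp (1 / 20) / 2 ≤ x ∧ x < 0.6) ∧ p.1 0 = arcPt m 0 x) ∧ |p.2.im| < 0.1))}

lemma one_eq_succ (m : ℕ) : (1 : Fin (m + 2)) = (0 : Fin (m + 1)).succ := rfl

lemma legSet_subset_postSet : legSet m ⊆ postSet m := fun _ hp =>
  ⟨hp.1, Or.inl (by linarith [hp.2])⟩

lemma continuous_cre_apply (j : Fin (m + 2)) : Continuous fun p : ThickTorus m => cre (p.1 j) :=
  continuous_cre.comp (by fun_prop)

lemma continuous_norm_snd : Continuous fun p : ThickTorus m => ‖p.2‖ := by fun_prop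

lemma isOpen_legSet : IsOpen (legSet m) := by
  have e : legSet m = (⋂ j : Fin (m + 1), {p | 0 < cre (p.1 j.succ)}) ∩ {p | 1 < ‖p.2‖} := by
    ext p; simp [legSet]
  rw [e]
  exact (isOpen_iInter_of_finite fun j => isOpen_lt continuous_const (continuous_cre_apply _)).inter
    (isOpen_lt continuous_const continuous_norm_snd)

lemma postSet_subset_keepSet : postSet m ⊆ keepSet m := fun _ hp =>
  Or.inr (by rw [one_eq_succ]; exact (hp.1 0).le)

lemma reachSet_cre_neg {p : ThickTorus m} (hp : p ∈ reachSet m) : cre (p.1 1) < 0 := by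
  rcases hp with hp | hp
  · exact hp.1
  · obtain ⟨l, hl⟩ := mem_iUnion.1 hp
    rw [one_eq_succ]; exact hl.1 0

lemma disjoint_reachSet_postSet : Disjoint (reachSet m) (postSet m) := by
  rw [Set.disjoint_left]
  intro p hp hp'
  have h1 := reachSet_cre_neg hp
  have h2 := hp'.1 0
  rw [one_eq_succ] at h1
  linarith

lemma isOpen_reachSet : IsOpen (reachSet m) := by
  refine IsOpen.union ?_ (isOpen_iUnion fun l => ?_)
  · exact (isOpen_lt (continuous_cre_apply _) continuous_const).inter
      (isOpen_lt continuous_const continuous_norm_snd)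
  · have h1 : IsOpen (arcPt m l '' Ioo (-(Real.exp (1 / 20) / 2)) (-(Real.exp (0.75 / 20) / 2))) :=
      isOpenMap_arcPt m l _ isOpen_Ioo
    have h2 := h1.preimage (f := fun p : ThickTorus m => p.1 0) (by fun_prop)
    have e : slabSet m l = (⋂ j : Fin (m + 1), {p | cre (p.1 j.succ) < 0}) ∩
        ((fun p : ThickTorus m => p.1 0) ⁻¹'
          (arcPt m l '' Ioo (-(Real.exp (1 / 20) / 2)) (-(Real.exp (0.75 / 20) / 2))) ∩
        {p | |sideCoord l p.2| < 0.1}) := by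
      ext p
      simp only [slabSet, mem_inter_iff, mem_iInter, mem_ofPred_eq, mem_preimage, mem_image,
          mem_Ioo,
        eq_comm]
    rw [e]
    exact (isOpen_iInter_of_finite fun j => isOpen_lt
        (continuous_cre_apply _) continuous_const).inter
      (h2.inter (isOpen_lt ((continuous_sideCoord l).comp continuous_snd).abs continuous_const))

lemma compl_keepSet_subset : (keepSet m)ᶜ ⊆ reachSet m := by
  intro p hp
  simp only [keepSet, mem_compl_iff, mem_ofPred_eq, not_or, not_le] at hp
  exact Or.inl ⟨hp.2, by linarith [hp.1]⟩

lemma lt_exp_three : (0.5187 : ℝ) < Real.exp (0.75 / 20) / 2 := by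
  have := Real.add_one_le_exp (0.75 / 20 : ℝ)
  linarith

lemma disjoint_reachSet_kidMap (i : Fin (numKids m)) :
    Disjoint (reachSet m) (kidMap m i '' keepSet m) := by
  rw [Set.disjoint_left]
  rintro _ hp ⟨p, hk, rfl⟩
  rcases hp with hp | hp
  · have := norm_kidMap_le i p
    have := hp.2
    linarith
  · obtain ⟨l, hl, ⟨x, hx, hx0⟩, hs⟩ := mem_iUnion.1 hp
    have e1 := exp_twentieth_lt
    have e2 := lt_exp_three
    have hxn : |x| = -x := abs_of_neg (by linarith [hx.2])
    obtain ⟨rfl, hre⟩ := eq_of_kidMap_near hx0 (by rw [hxn]; linarith [hx.2])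
      (by rw [hxn]; linarith [hx.1]) hs
    have h1 : 0.75 < (shrink p.2).re := by
      by_contra! h
      have := Complex.abs_re_le_norm (kidPlane (lastPair p))
      rw [hre, hxn, norm_kidPlane] at this
      have h3 : Real.exp ((shrink p.2).re / 20) ≤ Real.exp (0.75 / 20) :=
        Real.exp_le_exp.2 (by linarith)
      have h4 : (lastPair p).2 = p.2 := rfl
      rw [h4] at this
      linarith [hx.2]
    have h2 : 1 < ‖p.2‖ := one_lt_norm_of_lt_norm_shrink
      (h1.trans_le ((le_abs_self _).trans (Complex.abs_re_le_norm _)))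
    have h3 : ∀ j : Fin (m + 2), cre (p.1 j) < 0 := by
      intro j
      refine Fin.lastCases ?_ (fun j => ?_) j
      · rw [kidPlane_re] at hre
        have h5 := Real.exp_pos ((shrink p.2).re / 20)
        by_contra! h
        have : 0 ≤ Real.exp ((shrink (lastPair p).2).re / 20) / 2 * cre (lastPair p).1 :=
          mul_nonneg (by positivity) h
        linarith [hx.2]
      · rw [← kidMap_succ i]; exact hl j
    rcases hk with hk | hk
    · linarith
    · linarith [h3 1]

lemma disjoint_postSet_kidMap (i : Fin (numKids m)) :
    Disjoint (postSet m) (range (kidMap m i)) := by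
  rw [Set.disjoint_left]
  rintro _ hp ⟨p, rfl⟩
  rcases hp.2 with h | ⟨⟨x, hx, hx0⟩, hs⟩
  · have := norm_kidMap_le i p
    linarith
  · have e2 := Real.add_one_le_exp (1 / 20 : ℝ)
    have hxn : |x| = x := abs_of_nonneg (by linarith [hx.1])
    obtain ⟨-, hre⟩ := eq_of_kidMap_near hx0 (by rw [hxn]; linarith [hx.1])
      (by rw [hxn]; linarith [hx.2]) (by simpa [sideCoord] using hs)
    have h1 := (le_abs_self _).trans (Complex.abs_re_le_norm (kidPlane (lastPair p)))
    have h2 := norm_kidPlane_lt (lastPair p)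
    linarith [hx.1]

lemma isCompact_norm_le (r : ℝ) : IsCompact {p : ThickTorus m | ‖p.2‖ ≤ r} := by
  have : {p : ThickTorus m | ‖p.2‖ ≤ r} = univ ×ˢ closedBall 0 r := by ext; simp
  rw [this]
  exact isCompact_univ.prod (isCompact_closedBall _ _)

/-- The point of the plane with given shrunken real coordinate. -/
def unshrink (a : ℝ) : ℂ := OpenPartialHomeomorph.univUnitBall.symm (a : ℂ)

lemma shrink_unshrink {a : ℝ} (ha : |a| < 1) : shrink (unshrink a) = a :=
  OpenPartialHomeomorph.univUnitBall.right_inv (by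
    rw [OpenPartialHomeomorph.univUnitBall_target]; simpa using ha)

lemma exists_mem_reachSet (l : Fin (numKids m)) :
    ∃ p ∈ (keepSet m)ᶜ, kidMap m l p ∈ reachSet m := by
  have hsh := shrink_unshrink (a := 0.9) (by rw [abs_of_pos] <;> norm_num)
  have hn : cre (Circle.exp Real.pi) = -1 := by simp [cre, Circle.coe_exp]
  refine ⟨(fun _ => Circle.exp Real.pi, unshrink 0.9), ?_, Or.inr (mem_iUnion.2 ⟨l, ?_, ?_, ?_⟩)⟩
  · have : 1 < ‖unshrink 0.9‖ := one_lt_norm_of_lt_norm_shrink (by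
      rw [hsh, Complex.norm_real, Real.norm_of_nonneg] <;> norm_num)
    simp [keepSet, hn, this]
  · intro j
    rw [kidMap_succ, hn]; norm_num
  · refine ⟨_, ?_, kidMap_zero l _⟩
    rw [kidPlane_re]
    simp only [lastPair, hn, hsh, Complex.ofReal_re, mul_neg_one]
    have h1 : Real.exp (0.9 / 20) < Real.exp (1 / 20) := Real.exp_lt_exp.2 (by norm_num)
    have h2 : Real.exp (0.75 / 20) < Real.exp (0.9 / 20) := Real.exp_lt_exp.2 (by norm_num)
    constructor <;> linarith
  · rw [kidMap_snd, sideCoord_kidCoord_of_iff Iff.rfl]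
    simp only [kidSide, lastPair, hsh, Complex.ofReal_im]
    norm_num

lemma exists_mem_closure_legSet :
    ∃ p ∈ postSet m, p ∈ closure (kidMap m 0 '' legSet m) := by
  let f : ℝ → ThickTorus m := fun a =>
    (Fin.cons (arcPt m 0 (Real.exp (a / 20) / 2)) (fun _ => 1), 0)
  have hf : Continuous f := by
    have := continuous_arcPt m 0
    unfold f; fun_prop
  have h1 : (1 : ℝ) ∈ closure (Ioo 0.75 1) := by
    rw [closure_Ioo (by norm_num)]; constructor <;> norm_num
  refine ⟨f 1, ⟨fun j => ?_, Or.inr ⟨⟨_, ⟨le_rfl, ?_⟩, rfl⟩, by simp [f]; norm_num⟩⟩,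
    map_mem_closure hf h1 fun a ha => ?_⟩
  · simp [f, cre]
  · linarith [exp_twentieth_lt]
  · have hab : |a| = a := abs_of_pos (by linarith [ha.1])
    have hsh := shrink_unshrink (a := a) (by rw [hab]; exact ha.2)
    refine ⟨(fun _ => 1, unshrink a), ⟨fun j => by simp [cre], one_lt_norm_of_lt_norm_shrink ?_⟩,
        ?_⟩
    · rw [hsh, Complex.norm_real, Real.norm_eq_abs, hab]; exact ha.1
    · simp only [kidMap, kidSide, hsh, f, kidCoord, kidPlane, polar]
      refine Prod.ext ?_ ?_
      · simp only [Circle.coe_one, mul_one, Complex.ofReal_re]; rfl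
      · simp only [Circle.coe_one, mul_one, Complex.ofReal_im, zero_div]; simp; rfl

lemma isPreconnected_cre_pos : IsPreconnected {c : Circle | 0 < cre c} := by
  have : {c : Circle | 0 < cre c} = Circle.exp '' Ioo (-(Real.pi / 2)) (Real.pi / 2) := by
    ext c
    simp only [mem_ofPred_eq, mem_image, mem_Ioo]
    constructor
    · intro h
      refine ⟨Complex.arg c, abs_lt.1 ?_, Circle.exp_arg c⟩
      rw [Complex.abs_arg_lt_pi_div_two_iff]; exact Or.inl h
    · rintro ⟨x, hx, rfl⟩
      have := Real.cos_pos_of_mem_Ioo hx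
      simpa [cre, Circle.coe_exp, Complex.exp_ofReal_mul_I_re] using this
  rw [this]
  exact isPreconnected_Ioo.image _ Circle.exp.continuous.continuousOn

lemma isPreconnected_cre_neg : IsPreconnected {c : Circle | cre c < 0} := by
  have : {c : Circle | cre c < 0} =
      (fun c => Circle.exp Real.pi * c) '' {c : Circle | 0 < cre c} := by
    ext c
    simp only [mem_ofPred_eq, mem_image]
    constructor
    · intro h
      exact ⟨Circle.exp Real.pi * c, by simpa [cre, Circle.coe_exp] using h, by
        rw [← mul_assoc, ← Circle.exp_add]
        have : Circle.exp (Real.pi + Real.pi) = 1 := by rw [← two_mul]; exact Circle.exp_two_pi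
        rw [this, one_mul]⟩
    · rintro ⟨x, hx, rfl⟩
      simpa [cre, Circle.coe_exp] using hx
  rw [this]
  exact isPreconnected_cre_pos.image _ (by fun_prop)

lemma isPreconnected_norm_mem {s : Set ℝ} (hs : IsPreconnected s) (h0 : ∀ r ∈ s, 0 ≤ r) :
    IsPreconnected {w : ℂ | ‖w‖ ∈ s} := by
  have : {w : ℂ | ‖w‖ ∈ s} = (fun p : Circle × ℝ => (p.2 : ℂ) * p.1) '' (univ ×ˢ s) := by
    ext w
    simp only [mem_ofPred_eq, mem_image, mem_prod, mem_univ, true_and, Prod.exists]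
    constructor
    · intro h
      exact ⟨Circle.exp w.arg, ‖w‖, h, by rw [Circle.coe_exp, Complex.norm_mul_exp_arg_mul_I]⟩
    · rintro ⟨c, r, hr, rfl⟩
      rw [norm_mul, Circle.norm_coe, Complex.norm_real, Real.norm_of_nonneg (h0 r hr), mul_one]
      exact hr
  rw [this]
  exact (isPreconnected_univ.prod hs).image _ (by fun_prop)

/-- A product of preconnected sets of coordinates is preconnected. -/
lemma isPreconnected_box {s : Set Circle} {t : Fin (m + 1) → Set Circle} {u : Set ℂ}
    (hs : IsPreconnected s) (ht : ∀ j, IsPreconnected (t j)) (hu : IsPreconnected u) :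
    IsPreconnected {p : ThickTorus m | p.1 0 ∈ s ∧ (∀ j : Fin (m + 1), p.1 j.succ ∈ t j) ∧
        p.2 ∈ u} := by
  have h : IsPreconnected ((univ.pi (Fin.cons s t : Fin (m + 2) → Set Circle)) ×ˢ u) :=
    (isPreconnected_univ_pi fun i => Fin.cases hs ht i).prod hu
  convert h using 1
  ext p
  simp only [mem_ofPred_eq, mem_prod, mem_univ_pi, Fin.forall_fin_succ (n := m + 1), Fin.cons_zero,
    Fin.cons_succ, and_assoc]

lemma isPreconnected_arc (l : Fin (numKids m)) {s : Set ℝ} (hs : IsPreconnected s) :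
    IsPreconnected {c | ∃ x ∈ s, c = arcPt m l x} := by
  have : {c | ∃ x ∈ s, c = arcPt m l x} = arcPt m l '' s := by ext; simp [eq_comm]
  rw [this]
  exact hs.image _ (continuous_arcPt m l).continuousOn

lemma convex_abs_sideCoord_lt (l : ℕ) : Convex ℝ {w : ℂ | |sideCoord l w| < 0.1} := by
  by_cases h : Even l
  · have : {w : ℂ | |sideCoord l w| < 0.1} = Complex.imLm ⁻¹' (Ioo (-0.1) 0.1) := by
      ext; simp [sideCoord, h, abs_lt]
    rw [this]
    exact (convex_Ioo _ _).linear_preimage _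
  · have : {w : ℂ | |sideCoord l w| < 0.1} = Complex.reLm ⁻¹' (Ioo (-0.1) 0.1) := by
      ext; simp [sideCoord, h, abs_lt]
    rw [this]
    exact (convex_Ioo _ _).linear_preimage _

lemma isPreconnected_postSet : IsPreconnected (postSet m) := by
  have e1 := exp_twentieth_lt
  have h1 := isPreconnected_box (m := m) isPreconnected_univ (fun _ => isPreconnected_cre_pos)
    (isPreconnected_norm_mem (isPreconnected_Ioi (a := (0.9 : ℝ)))
      fun r hr => by have := mem_Ioi.1 hr; linarith)
  have h2 := isPreconnected_box (m := m) (isPreconnected_arc (m := m) 0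
    (isPreconnected_Ico (a := Real.exp (1 / 20) / 2) (b := 0.6)))
    (fun _ => isPreconnected_cre_pos) (u := {w : ℂ | |w.im| < 0.1}) (by
      have : {w : ℂ | |w.im| < 0.1} = Complex.imLm ⁻¹' (Ioo (-0.1) 0.1) := by
        ext; simp [abs_lt]
      rw [this]
      exact ((convex_Ioo _ _).linear_preimage _).isPreconnected)
  have h3 := h1.union (⟨Fin.cons (arcPt m 0 (Real.exp (1 / 20) / 2)) (fun _ => 1), 1⟩) (by
    simp [cre]; norm_num) (by
    exact ⟨⟨_, ⟨le_rfl, by linarith⟩, rfl⟩, fun j => by simp [cre], by simp; norm_num⟩) h2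
  convert h3 using 1
  ext p
  simp only [postSet, mem_ofPred_eq, mem_union, mem_univ, true_and, mem_Ioi, mem_Ico]
  tauto

lemma isPreconnected_reachSet_inter {K : Set ℂ} (hK : Convex ℝ K)
    (hK1 : IsPreconnected {w : ℂ | 0.9 < ‖w‖ ∧ w ∈ K}) (hK2 : (1 : ℂ) ∈ K) (hK3 : Complex.I ∈ K) :
    IsPreconnected (reachSet m ∩ {p | p.2 ∈ K}) := by
  have h1 : IsPreconnected {p : ThickTorus m | p.1 0 ∈ univ ∧ (∀ j : Fin (m + 1), p.1 j.succ ∈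
      (fun j => if j = 0 then {c : Circle | cre c < 0} else univ : Fin (m + 1) → Set Circle) j) ∧
      p.2 ∈ {w : ℂ | 0.9 < ‖w‖ ∧ w ∈ K}} := by
    refine isPreconnected_box isPreconnected_univ (fun j => ?_) hK1
    split_ifs
    · exact isPreconnected_cre_neg
    · exact isPreconnected_univ
  have e1 : {p : ThickTorus m | p.1 0 ∈ univ ∧ (∀ j : Fin (m + 1), p.1 j.succ ∈
      (fun j => if j = 0 then {c : Circle | cre c < 0} else univ : Fin (m + 1) → Set Circle) j) ∧
      p.2 ∈ {w : ℂ | 0.9 < ‖w‖ ∧ w ∈ K}} = shellSet m ∩ {p | p.2 ∈ K} := by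
    ext p
    have : (∀ j : Fin (m + 1), p.1 j.succ ∈ (fun j => if j = 0 then {c : Circle | cre c < 0}
        else univ : Fin (m + 1) → Set Circle) j) ↔ cre (p.1 1) < 0 := by
      constructor
      · intro h; simpa using h 0
      · intro h j
        by_cases hj : j = 0
        · subst hj; simpa using h
        · simp [hj]
    simp only [mem_ofPred_eq, this, shellSet, mem_inter_iff]
    simp [and_assoc]
  rw [e1] at h1
  have h2 : ∀ l, IsPreconnected (slabSet m l ∩ {p | p.2 ∈ K}) := by
    intro l
    have h := isPreconnected_box (m := m) (isPreconnected_arc l (isPreconnected_Ioo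
      (a := -(Real.exp (1 / 20) / 2)) (b := -(Real.exp (0.75 / 20) / 2))))
      (fun _ => isPreconnected_cre_neg) (u := {w : ℂ | |sideCoord l w| < 0.1 ∧ w ∈ K}) (by
        refine (Convex.inter ?_ hK).isPreconnected
        change Convex ℝ {w : ℂ | |sideCoord l w| < 0.1}
        exact convex_abs_sideCoord_lt l)
    convert h using 1
    ext p
    simp only [slabSet, mem_inter_iff, mem_ofPred_eq, mem_Ioo]
    tauto
  have e2 : reachSet m ∩ {p | p.2 ∈ K} =
      ⋃ l, (shellSet m ∩ {p | p.2 ∈ K}) ∪ (slabSet m l ∩ {p | p.2 ∈ K}) := by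
    rw [reachSet, union_inter_distrib_right, iUnion_inter, union_iUnion]
  rw [e2]
  have hn : cre (Circle.exp Real.pi) = -1 := by simp [cre, Circle.coe_exp]
  refine isPreconnected_iUnion ⟨(fun _ => Circle.exp Real.pi, 1), ?_⟩ fun l => ?_
  · refine mem_iInter.2 fun l => Or.inl ⟨⟨?_, ?_⟩, hK2⟩
    · simp only [hn]; norm_num
    · simp; norm_num
  · have hlt : Real.exp (0.75 / 20) < Real.exp (1 / 20) := Real.exp_lt_exp.2 (by norm_num)
    refine h1.union (⟨Fin.cons (arcPt m l (-((Real.exp (1 / 20) / 2 + Real.exp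
        (0.75 / 20) / 2) / 2)))
      (fun _ => Circle.exp Real.pi), if Even (l : ℕ) then 1 else Complex.I⟩) ?_ ?_ (h2 l)
    · refine ⟨⟨?_, ?_⟩, ?_⟩
      · rw [one_eq_succ]; simp only [Fin.cons_succ, hn]; norm_num
      · dsimp only; split_ifs <;> simp <;> norm_num
      · simp only [mem_ofPred_eq]; split_ifs <;> assumption
    · refine ⟨⟨fun j => ?_, ⟨_, ⟨?_, ?_⟩, rfl⟩, ?_⟩, ?_⟩
      · simp only [Fin.cons_succ, hn]; norm_num
      · linarith
      · linarith
      · simp only [sideCoord]; split_ifs <;> simp <;> norm_num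
      · simp only [mem_ofPred_eq]; split_ifs <;> assumption

lemma isPreconnected_reachSet : IsPreconnected (reachSet m) := by
  have := isPreconnected_reachSet_inter (m := m) (K := univ) convex_univ (by
    simpa using isPreconnected_norm_mem (isPreconnected_Ioi (a := (0.9 : ℝ)))
      fun r hr => by have := mem_Ioi.1 hr; linarith) trivial trivial
  simpa using this

lemma reachSet_inter_keepSet : reachSet m ∩ keepSet m = reachSet m ∩ {p | p.2 ∈ closedBall 0 1} :=
    by
  ext p
  simp only [mem_inter_iff, keepSet, mem_ofPred_eq, mem_closedBall_zero_iff]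
  refine and_congr_right fun hp => ?_
  have := reachSet_cre_neg hp
  constructor
  · rintro (h | h)
    · exact h
    · linarith
  · exact Or.inl

lemma isPreconnected_reachSet_inter_keepSet : IsPreconnected (reachSet m ∩ keepSet m) := by
  rw [reachSet_inter_keepSet]
  refine isPreconnected_reachSet_inter (convex_closedBall _ _) ?_ (by simp) (by simp)
  have := isPreconnected_norm_mem (isPreconnected_Ioc (a := (0.9 : ℝ)) (b := 1))
    fun r hr => by have := hr.1; linarith
  simpa using this

lemma nonempty_reachSet_inter_keepSet : (reachSet m ∩ keepSet m).Nonempty := by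
  refine ⟨(fun _ => Circle.exp Real.pi, 1), Or.inl ⟨?_, ?_⟩, Or.inl ?_⟩
  · simp [cre, Circle.coe_exp]
  · simp; norm_num
  · simp

end

section

lemma isOpenEmbedding_polar : Topology.IsOpenEmbedding polar :=
  .of_continuous_injective_isOpenMap continuous_polar polar_injective isOpenMap_polar

/-- A product of circles and a plane embeds into Euclidean space in codimension zero. -/
lemma exists_isOpenEmbedding_torus (d : ℕ) : ∃ J : (Fin d → Circle) × ℂ → ℝ × (Fin (d + 1) → ℝ),
    Topology.IsOpenEmbedding J ∧
      Filter.Tendsto (fun y : ℝ => (J (fun _ => -1, (y : ℂ))).1) Filter.atTop Filter.atTop := by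
  induction d with
  | zero =>
    let e : (Fin 0 → Circle) × ℂ ≃ₜ ℝ × (Fin (0 + 1) → ℝ) :=
      { toFun := fun p => (p.2.re, fun _ => p.2.im)
        invFun := fun p => (fun _ => 1, ⟨p.1, p.2 0⟩)
        left_inv := fun p => Prod.ext (Subsingleton.elim _ _) rfl
        right_inv := fun p => Prod.ext rfl (funext fun i => congrArg p.2 (Subsingleton.elim (α :=
            Fin 1) 0 i))
        continuous_toFun := by fun_prop
        continuous_invFun := by
          have : Continuous fun p : ℝ × (Fin (0 + 1) → ℝ) => (⟨p.1, p.2 0⟩ : ℂ) :=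
            continuous_complex_mk (by fun_prop) (by fun_prop)
          fun_prop }
    exact ⟨e, e.isOpenEmbedding, Filter.tendsto_id⟩
  | succ d ih =>
    obtain ⟨J, hJ, ht⟩ := ih
    let s : (Fin (d + 1) → Circle) × ℂ ≃ₜ Circle × ((Fin d → Circle) × ℂ) :=
      { toFun := fun p => (p.1 0, (Fin.tail p.1, p.2))
        invFun := fun p => (Fin.cons p.1 p.2.1, p.2.2)
        left_inv := fun p => by simp
        right_inv := fun p => by simp
        continuous_toFun := by fun_prop
        continuous_invFun := by fun_prop }
    let e : ℂ × (Fin (d + 1) → ℝ) ≃ₜ ℝ × (Fin (d + 1 + 1) → ℝ) :=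
      { toFun := fun p => (-p.1.re, Fin.cons p.1.im p.2)
        invFun := fun p => (⟨-p.1, p.2 0⟩, Fin.tail p.2)
        left_inv := fun p => by simp
        right_inv := fun p => by simp
        continuous_toFun := by fun_prop
        continuous_invFun := by
          have : Continuous fun p : ℝ × (Fin (d + 1 + 1) → ℝ) => (⟨-p.1, p.2 0⟩ : ℂ) :=
            continuous_complex_mk (by fun_prop) (by fun_prop)
          fun_prop }
    refine ⟨e ∘ Prod.map polar id ∘ (Homeomorph.prodAssoc _ _ _).symm ∘ Prod.map id J ∘ s,
      e.isOpenEmbedding.comp ((isOpenEmbedding_polar.prodMap .id).comp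
        ((Homeomorph.isOpenEmbedding _).comp
            ((Topology.IsOpenEmbedding.id.prodMap hJ).comp s.isOpenEmbedding))), ?_⟩
    have : (fun y :
        ℝ => ((e ∘ Prod.map polar id ∘ (Homeomorph.prodAssoc _ _ _).symm ∘ Prod.map id J ∘ s)
        (fun _ => -1, (y : ℂ))).1) = fun y : ℝ => Real.exp (J (fun _ => -1, (y : ℂ))).1 / 2 := by
      funext y
      change -(polar (-1, (J (fun _ => -1, (y : ℂ))).1)).re = _
      simp [polar, -Complex.ofReal_exp]
    rw [this]
    exact (Real.tendsto_exp_atTop.comp ht).atTop_div_const (by norm_num)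

/-- The thickened torus embeds into Euclidean space as an open set, with unbounded image along
a ray of the plane factor. -/
lemma exists_isOpenEmbedding_thickTorus (m : ℕ) :
    ∃ J : ThickTorus m → EuclideanSpace ℝ (Fin (m + 3)) × ℝ, Topology.IsOpenEmbedding J ∧
      Filter.Tendsto (fun y : ℝ => (J (fun _ => -1, (y : ℂ))).2) Filter.atTop Filter.atTop := by
  obtain ⟨J, hJ, ht⟩ := exists_isOpenEmbedding_torus (m + 2)
  let e : ℝ × (Fin (m + 3) → ℝ) ≃ₜ EuclideanSpace ℝ (Fin (m + 3)) × ℝ :=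
    (Homeomorph.prodComm _ _).trans
      ((EuclideanSpace.equiv (Fin (m + 3)) ℝ).symm.toHomeomorph.prodCongr (Homeomorph.refl ℝ))
  exact ⟨e ∘ J, e.isOpenEmbedding.comp hJ, ht⟩

end

section

variable {m : ℕ}

/-- Homeomorphisms supported in pairwise disjoint sets can be performed simultaneously. -/
lemma exists_homeomorph_glue {X ι : Type*} [TopologicalSpace X] {s : Set ι} (hs : s.Finite)
    {g : ι → X ≃ₜ X} {V : ι → Set X} (hg : ∀ i ∈ s, SuppIn (g i) (V i))
    (hV : ∀ i ∈ s, ∀ j ∈ s, i ≠ j → Disjoint (V i) (V j)) :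
    ∃ h : X ≃ₜ X, (∀ i ∈ s, ∀ x ∈ V i, h x = g i x) ∧ ∀ x, (∀ i ∈ s, x ∉ V i) → h x = x := by
  induction s, hs using Set.Finite.induction_on with
  | empty => exact ⟨Homeomorph.refl X, by simp, by simp⟩
  | @insert a s ha hs ih =>
    obtain ⟨h, h1, h2⟩ := ih (fun i hi => hg i (mem_insert_of_mem _ hi))
      fun i hi j hj => hV i (mem_insert_of_mem _ hi) j (mem_insert_of_mem _ hj)
    have hga := hg a (mem_insert _ _)
    have hdis : ∀ i ∈ s, Disjoint (V i) (V a) := fun i hi =>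
      hV i (mem_insert_of_mem _ hi) a (mem_insert _ _) (by rintro rfl; exact ha hi)
    refine ⟨h.trans (g a), fun i hi x hx => ?_, fun x hx => ?_⟩
    · rcases hi with rfl | hi
      · rw [Homeomorph.trans_apply, h2 x fun j hj hxj => disjoint_left.1 (hdis j hj) hxj hx]
      · rw [Homeomorph.trans_apply, h1 i hi x hx, hga.apply_eq]
        exact disjoint_left.1 (hdis i hi)
          ((hg i (mem_insert_of_mem _ hi)).apply_mem_iff.2 hx)
    · rw [Homeomorph.trans_apply, h2 x fun i hi => hx i (mem_insert_of_mem _ hi),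
        hga.apply_eq (hx a (mem_insert _ _))]

lemma IsPreconnected.exists_mem_closure_diff {X : Type*} [TopologicalSpace X] {S R : Set X}
    (hS : IsPreconnected S) (hR : IsOpen R) (hRS : R ⊆ S) (hne : R.Nonempty) (hne' : R ≠ S) :
    ∃ y ∈ S \ R, y ∈ closure R := by
  by_contra! h
  obtain ⟨x, hx⟩ := hne
  have h1 : S ⊆ R := hS.subset_left_of_subset_union hR (isClosed_closure (s := R)).isOpen_compl
    (disjoint_left.2 fun y hy hy' => hy' (subset_closure hy)) (fun y hy => by
      by_cases hyR : y ∈ R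
      · exact Or.inl hyR
      · exact Or.inr (h y ⟨hy, hyR⟩)) ⟨x, hRS hx, hx⟩
  exact hne' (hRS.antisymm h1)

variable {V : Type*} [NormedAddCommGroup V] [NormedSpace ℝ V] [FiniteDimensional ℝ V]

/-- One node of the construction: the children are pushed through the plane near a point of a
prescribed dense open set of the plane. -/
lemma exists_push [Nontrivial V] {ψ : ThickTorus m → V × ℝ} (hψ : Topology.IsOpenEmbedding ψ)
    (hpos : ∀ p ∈ keepSet m, 0 < (ψ p).2) (hneg : ∃ p, (ψ p).2 ≤ 0) {E : Set V} (hE : IsOpen E)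
    (hEd : Dense E) {δ : ℝ} (hδ : 0 < δ) :
    ∃ g : V × ℝ ≃ₜ V × ℝ, SuppIn g (ψ '' reachSet m) ∧
      (∃ κ ε, ε ≤ δ ∧ closedBall κ ε ⊆ E ∧
        ∀ p ∈ keepSet m, (g (ψ p)).2 ≤ 0 → g (ψ p) ∈ closedBall (κ, 0) ε) ∧
      ∀ l, ∃ p, (g (ψ (kidMap m l p))).2 ≤ 0 := by
  have hrk : 1 < Module.rank ℝ (V × ℝ) := by
    have := Module.finrank_pos (R := ℝ) (M := V)
    rw [← Module.finrank_eq_rank, Nat.one_lt_cast, Module.finrank_prod, Module.finrank_self]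
    omega
  have hup : IsOpen {z : V × ℝ | 0 < z.2} := isOpen_lt continuous_const continuous_snd
  have hGo : IsOpen (ψ '' reachSet m) := hψ.isOpenMap _ isOpen_reachSet
  obtain ⟨q, hqG, hqD⟩ := nonempty_reachSet_inter_keepSet (m := m)
  let S := ψ '' reachSet m ∩ {z : V × ℝ | 0 < z.2}
  have hSo : IsOpen S := hGo.inter hup
  let R := connectedComponentIn S (ψ q)
  have hqS : ψ q ∈ S := ⟨mem_image_of_mem ψ hqG, hpos q hqD⟩
  have hRo : IsOpen R := hSo.connectedComponentIn
  have hRS : R ⊆ S := connectedComponentIn_subset _ _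
  have hRc : IsPreconnected R := isPreconnected_connectedComponentIn
  have hqR : ψ q ∈ R := mem_connectedComponentIn hqS
  have hGD : ψ '' (reachSet m ∩ keepSet m) ⊆ R := by
    refine (isPreconnected_reachSet_inter_keepSet.image ψ
      hψ.continuous.continuousOn).subset_connectedComponentIn (mem_image_of_mem ψ ⟨hqG, hqD⟩) ?_
    rintro _ ⟨p, hp, rfl⟩
    exact ⟨mem_image_of_mem ψ hp.1, hpos p hp.2⟩
  have hext : ∀ T : Set (V × ℝ), IsPreconnected T → T ⊆ S → (R ∩ T).Nonempty → T ⊆ R := by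
    rintro T hT hTS ⟨x, hxR, hxT⟩
    rw [show R = connectedComponentIn S x from connectedComponentIn_eq hxR]
    exact hT.subset_connectedComponentIn hxT hTS
  have hRne : R ≠ ψ '' reachSet m := by
    intro h
    obtain ⟨p, hp⟩ := hneg
    by_cases hpD : p ∈ keepSet m
    · linarith [hpos p hpD]
    · have : ψ p ∈ R := h ▸ mem_image_of_mem ψ (compl_keepSet_subset hpD)
      have h2 : 0 < (ψ p).2 := (hRS this).2
      linarith
  obtain ⟨y, ⟨hyG, hyR⟩, hycl⟩ := (isPreconnected_reachSet.image ψ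
    hψ.continuous.continuousOn).exists_mem_closure_diff hRo (hRS.trans inter_subset_left)
    ⟨_, hqR⟩ hRne
  have hy0 : y.2 = 0 := by
    have h1 : 0 ≤ y.2 :=
        closure_minimal (show R ⊆ {z :
        V × ℝ | 0 ≤ z.2} from fun z hz => le_of_lt (show 0 < z.2 from (hRS hz).2))
      (isClosed_le continuous_const continuous_snd) hycl
    by_contra h
    have hyS : y ∈ S := ⟨hyG, lt_of_le_of_ne h1 (Ne.symm h)⟩
    obtain ⟨r, hr, hrS⟩ := Metric.isOpen_iff.1 hSo y hyS
    obtain ⟨z, hz, hz'⟩ := mem_closure_iff.1 hycl _ isOpen_ball (mem_ball_self hr)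
    exact hyR (hext _ (convex_ball y r).isPreconnected hrS ⟨z, hz', hz⟩ (mem_ball_self hr))
  obtain ⟨r, hr, hrG⟩ := Metric.isOpen_iff.1 hGo y hyG
  have hhalf : ball y r ∩ {z | 0 < z.2} ⊆ R := by
    have hc : Convex ℝ (ball y r ∩ {z : V × ℝ | 0 < z.2}) :=
      (convex_ball y r).inter ((convex_Ioi (0 : ℝ)).linear_preimage (LinearMap.snd ℝ V ℝ))
    obtain ⟨z, hz, hz'⟩ := mem_closure_iff.1 hycl _ isOpen_ball (mem_ball_self hr)
    exact hext _ hc.isPreconnected (inter_subset_inter_left _ hrG) ⟨z, hz', hz, (hRS hz').2⟩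
  obtain ⟨κ, hκ, hκE⟩ := hEd.inter_open_nonempty _ isOpen_ball ⟨y.1, mem_ball_self hr⟩
  obtain ⟨ε₁, hε₁, hεE⟩ := Metric.nhds_basis_closedBall.mem_iff.1 (hE.mem_nhds hκE)
  have hκy : ((κ, 0) : V × ℝ) ∈ ball y r := by
    rw [mem_ball, Prod.dist_eq, hy0, dist_self]
    exact max_lt hκ hr
  obtain ⟨ε₂, hε₂, hεy⟩ := Metric.isOpen_iff.1 isOpen_ball _ hκy
  let ε := min (min ε₁ ε₂) δ
  have hε : 0 < ε := lt_min (lt_min hε₁ hε₂) hδ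
  let b : Set (V × ℝ) := ball (κ, 0) ε
  have hb : b ⊆ ball y r :=
      (ball_subset_ball ((min_le_left _ _).trans (min_le_right _ _))).trans hεy
  have hmem : ∀ t : ℝ, |t| < ε → ((κ, t) : V × ℝ) ∈ b := fun t ht => by
    rw [mem_ball, Prod.dist_eq, dist_self, Real.dist_0_eq_abs]
    exact max_lt hε ht
  have h2 : |ε / 2| < ε := by rw [abs_of_pos (by positivity)]; linarith
  have hRb : IsPreconnected (R ∪ b) := by
    have h1 := hmem (ε / 2) h2
    exact hRc.union (κ, ε / 2) (hhalf ⟨hb h1,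
        show 0 < ε / 2 by positivity⟩) h1 (convex_ball _ _).isPreconnected
  choose x hxD hxG using fun l : Fin (numKids m) => exists_mem_reachSet (m := m) l
  obtain ⟨g, hg, hgb⟩ := exists_suppIn_image_subset hrk (hRo.union isOpen_ball) hRb
    (β := b ∩ {z | z.2 < 0}) (Z := range fun l => ψ (kidMap m l (x l)))
    (isOpen_ball.inter (isOpen_lt continuous_snd continuous_const))
    ⟨(κ, -(ε / 2)), ⟨hmem _ (by rwa [abs_neg]), show -(ε / 2) < 0 by linarith⟩,
      Or.inr (hmem _ (by rwa [abs_neg]))⟩ (finite_range _) (by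
      rintro _ ⟨l, rfl⟩
      exact Or.inl (hGD (mem_image_of_mem ψ ⟨hxG l, Or.inl (by
        have := norm_kidMap_le l (x l); linarith)⟩)))
  refine ⟨g, hg.mono (union_subset (hRS.trans inter_subset_left) (hb.trans hrG)),
    ⟨κ, ε, min_le_right _ _, (closedBall_subset_closedBall ((min_le_left _ _).trans
      (min_le_left _ _))).trans hεE, fun p hp hs => ?_⟩, fun l => ⟨x l, ?_⟩⟩
  · by_cases hpV : ψ p ∈ R ∪ b
    · rcases hg.apply_mem_iff.2 hpV with h | h
      · exact absurd (hRS h).2 (not_lt.2 hs)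
      · exact ball_subset_closedBall h
    · rw [hg.apply_eq hpV] at hs
      linarith [hpos p hp]
  · exact (hgb ⟨_, mem_range_self l, rfl⟩).2.le

end

section

variable {m : ℕ} {V : Type*} [NormedAddCommGroup V]

/-- A sequence of homeomorphisms pushing the children of successive stages of an embedded tower
of tori through the plane `V × 0`, near points of prescribed sets. -/
structure Tower (J : ThickTorus m → V × ℝ) (E : ℕ → Set V) where
  H : ℕ → V × ℝ ≃ₜ V × ℝ
  H_zero (x) : H 0 x = x
  H_succ (j x) : (∀ w : List (Fin (numKids m)), w.length = j → x ∉ J ∘ kidWord m w '' reachSet m) →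
    H (j + 1) x = H j x
  H_range (j) (w : List (Fin (numKids m))) : w.length = j → ∀ p,
    ∃ p', H (j + 1) (J (kidWord m w p)) = H j (J (kidWord m w p'))
  H_range' (j) (w : List (Fin (numKids m))) : w.length = j → ∀ p,
    ∃ p', H j (J (kidWord m w p)) = H (j + 1) (J (kidWord m w p'))
  H_pos (w : List (Fin (numKids m))) : ∀ p ∈ keepSet m, 0 < (H w.length (J (kidWord m w p))).2
  H_neg (w : List (Fin (numKids m))) : ∃ p, (H w.length (J (kidWord m w p))).2 ≤ 0
  H_small (j) (w : List (Fin (numKids m))) : w.length = j + 1 → ∃ κ ε, ε ≤ 1 / (j + 1 : ℝ) ∧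
    closedBall κ ε ⊆ E j ∧
      ∀ p, (H (j + 1) (J (kidWord m w p))).2 ≤ 0 → H (j + 1) (J (kidWord m w p)) ∈ closedBall (κ,
          0) ε

lemma disjoint_image_kidWord {X : Type*} {J : ThickTorus m → X} (hJ : Function.Injective J)
    {v w : List (Fin (numKids m))} (hl : v.length = w.length) (h : v ≠ w)
        (s t : Set (ThickTorus m)) :
    Disjoint (J ∘ kidWord m v '' s) (J ∘ kidWord m w '' t) := by
  rw [Set.disjoint_left]
  rintro _ ⟨p, -, rfl⟩ ⟨q, -, hq⟩
  exact h (kidWord_eq_of_length hl (hJ hq.symm)).1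

lemma range_kidWord_concat_subset {w : List (Fin (numKids m))} {l : Fin (numKids m)}
    (p : ThickTorus m) : kidWord m (w ++ [l]) p = kidWord m w (kidMap m l p) := by
  rw [kidWord_append, kidWord_cons, kidWord_nil]; rfl

variable [NormedSpace ℝ V] [FiniteDimensional ℝ V] [Nontrivial V]

lemma exists_tower_step {J : ThickTorus m → V × ℝ} (hJ : Topology.IsOpenEmbedding J) {E : Set V}
    (hE : IsOpen E) (hEd : Dense E) {j : ℕ} {H : V × ℝ ≃ₜ V × ℝ}
    (hpos : ∀ w : List (Fin (numKids m)), w.length = j → ∀ p ∈ keepSet m,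
        0 < (H (J (kidWord m w p))).2)
    (hneg : ∀ w : List (Fin (numKids m)), w.length = j → ∃ p, (H (J (kidWord m w p))).2 ≤ 0) :
    ∃ H' : V × ℝ ≃ₜ V × ℝ,
      (∀ x, (∀ w : List (Fin (numKids m)), w.length = j → x ∉ J ∘ kidWord m w '' reachSet m) →
        H' x = H x) ∧
      (∀ w : List (Fin (numKids m)), w.length = j → ∀ p,
        ∃ p', H' (J (kidWord m w p)) = H (J (kidWord m w p'))) ∧
      (∀ w : List (Fin (numKids m)), w.length = j → ∀ p,
        ∃ p', H (J (kidWord m w p)) = H' (J (kidWord m w p'))) ∧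
      (∀ w : List (Fin (numKids m)), w.length = j + 1 →
        ∀ p ∈ keepSet m, 0 < (H' (J (kidWord m w p))).2) ∧
      (∀ w : List (Fin (numKids m)), w.length = j + 1 → ∃ p, (H' (J (kidWord m w p))).2 ≤ 0) ∧
      (∀ w : List (Fin (numKids m)), w.length = j + 1 → ∃ κ ε, ε ≤ 1 / (j + 1 : ℝ) ∧
        closedBall κ ε ⊆ E ∧
        ∀ p, (H' (J (kidWord m w p))).2 ≤ 0 → H' (J (kidWord m w p)) ∈ closedBall (κ, 0) ε) := by
  have hψ : ∀ w : List (Fin (numKids m)), Topology.IsOpenEmbedding (H ∘ J ∘ kidWord m w) := fun w =>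
    H.isOpenEmbedding.comp (hJ.comp (isOpenEmbedding_kidWord w))
  have key : ∀ w : List (Fin (numKids m)), ∃ g : V × ℝ ≃ₜ V × ℝ, w.length = j →
      SuppIn g ((H ∘ J ∘ kidWord m w) '' reachSet m) ∧
      (∃ κ ε, ε ≤ 1 / (j + 1 : ℝ) ∧ closedBall κ ε ⊆ E ∧ ∀ p ∈ keepSet m,
        (g ((H ∘ J ∘ kidWord m w) p)).2 ≤ 0 → g ((H ∘ J ∘ kidWord m w) p) ∈ closedBall (κ, 0) ε) ∧
      ∀ l, ∃ p, (g ((H ∘ J ∘ kidWord m w) (kidMap m l p))).2 ≤ 0 := by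
    intro w
    by_cases hw : w.length = j
    · obtain ⟨g, hg⟩ := exists_push (hψ w) (hpos w hw) (hneg w hw) hE hEd
        (δ := 1 / (j + 1 : ℝ)) (by positivity)
      exact ⟨g, fun _ => hg⟩
    · exact ⟨Homeomorph.refl _, fun h => absurd h hw⟩
  choose g hg using key
  obtain ⟨G, hG1, hG2⟩ := exists_homeomorph_glue (List.finite_length_eq (Fin (numKids m)) j)
    (g := g) (V := fun w => (H ∘ J ∘ kidWord m w) '' reachSet m)
    (fun w hw => (hg w hw).1) (fun v hv w hw hvw => disjoint_image_kidWord
      (J := H ∘ J) (H.injective.comp hJ.injective) (hv.trans hw.symm) hvw _ _)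
  have hGe : ∀ w : List (Fin (numKids m)), w.length = j → ∀ p,
      G (H (J (kidWord m w p))) = g w (H (J (kidWord m w p))) := by
    intro w hw p
    by_cases hp : H (J (kidWord m w p)) ∈ (H ∘ J ∘ kidWord m w) '' reachSet m
    · exact hG1 w hw _ hp
    · rw [(hg w hw).1.apply_eq hp, hG2]
      intro v hv hpv
      by_cases hvw : v = w
      · subst hvw; exact hp hpv
      · exact disjoint_left.1 (disjoint_image_kidWord (J := H ∘ J) (H.injective.comp hJ.injective)
          (hv.trans (Eq.symm hw)) hvw (reachSet m) univ) hpv ⟨p, trivial, rfl⟩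
  have hrange : ∀ w : List (Fin (numKids m)), w.length = j → ∀ x,
      g w x ∈ range (H ∘ J ∘ kidWord m w) ↔ x ∈ range (H ∘ J ∘ kidWord m w) := fun w hw x =>
    (hg w hw).1.apply_mem_iff_of_subset (image_subset_range _ _)
  have hsplit : ∀ w : List (Fin (numKids m)), w.length = j + 1 → ∃ v l, v.length = j ∧
      w = v ++ [l] := by
    intro w hw
    have hne : w ≠ [] := by rintro rfl; simp at hw
    exact ⟨w.dropLast, w.getLast hne, by simp [hw], (List.dropLast_append_getLast hne).symm⟩
  refine ⟨H.trans G, fun x hx => ?_, fun w hw p => ?_, fun w hw p => ?_, fun w hw p hp => ?_,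
    fun w hw => ?_, fun w hw => ?_⟩
  · rw [Homeomorph.trans_apply, hG2]
    rintro w hw ⟨p, hp, hpx⟩
    exact hx w hw ⟨p, hp, H.injective hpx⟩
  · rw [Homeomorph.trans_apply, hGe w hw]
    obtain ⟨p', hp'⟩ := (hrange w hw _).2 ⟨p, rfl⟩
    exact ⟨p', hp'.symm⟩
  · obtain ⟨p', hp'⟩ := (hrange w hw ((g w).symm (H (J (kidWord m w p))))).1 (by
      rw [Homeomorph.apply_symm_apply]; exact ⟨p, rfl⟩)
    refine ⟨p', ?_⟩
    rw [Homeomorph.trans_apply, hGe w hw]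
    rw [show H (J (kidWord m w p')) = _ from hp', Homeomorph.apply_symm_apply]
  · obtain ⟨v, l, hv, rfl⟩ := hsplit w hw
    rw [Homeomorph.trans_apply, range_kidWord_concat_subset, hGe v hv, (hg v hv).1.apply_eq]
    · exact hpos v hv _ (Or.inl (by have := norm_kidMap_le l p; linarith))
    · rintro ⟨q, hq, hqp⟩
      have := (hψ v).injective hqp
      exact disjoint_left.1 (disjoint_reachSet_kidMap l) hq ⟨p, hp, this.symm⟩
  · obtain ⟨v, l, hv, rfl⟩ := hsplit w hw
    obtain ⟨p, hp⟩ := (hg v hv).2.2 l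
    refine ⟨p, ?_⟩
    rw [Homeomorph.trans_apply, range_kidWord_concat_subset, hGe v hv]
    exact hp
  · obtain ⟨v, l, hv, rfl⟩ := hsplit w hw
    obtain ⟨κ, ε, h1, h2, h3⟩ := (hg v hv).2.1
    refine ⟨κ, ε, h1, h2, fun p hp => ?_⟩
    rw [Homeomorph.trans_apply, range_kidWord_concat_subset, hGe v hv] at hp ⊢
    exact h3 _ (Or.inl (by have := norm_kidMap_le l p; linarith)) hp

theorem exists_tower {J : ThickTorus m → V × ℝ} (hJ : Topology.IsOpenEmbedding J) {E : ℕ → Set V}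
    (hE : ∀ j, IsOpen (E j)) (hEd : ∀ j, Dense (E j)) (hpos : ∀ p ∈ keepSet m, 0 < (J p).2)
    (hneg : ∃ p, (J p).2 ≤ 0) : Nonempty (Tower J E) := by
  let P : ℕ → (V × ℝ ≃ₜ V × ℝ) → Prop := fun j H =>
    (∀ w : List (Fin (numKids m)), w.length = j → ∀ p ∈ keepSet m, 0 < (H (J (kidWord m w p))).2) ∧
    (∀ w : List (Fin (numKids m)), w.length = j → ∃ p, (H (J (kidWord m w p))).2 ≤ 0)
  have h0 : P 0 (Homeomorph.refl _) := by
    constructor <;> intro w hw <;> rw [List.length_eq_zero_iff.1 hw]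
    · exact hpos
    · exact hneg
  choose next hnext using fun (j : ℕ) (H : {H // P j H}) =>
    exists_tower_step hJ (hE j) (hEd j) H.2.1 H.2.2
  let F : ∀ j, {H // P j H} := fun j => Nat.rec ⟨_, h0⟩
    (fun j H => ⟨next j H, (hnext j H).2.2.2.1, (hnext j H).2.2.2.2.1⟩) j
  have hF : ∀ j, (F (j + 1)).1 = next j (F j) := fun j => rfl
  exact ⟨{
    H := fun j => (F j).1
    H_zero := fun x => rfl
    H_succ := fun j x hx => by rw [hF]; exact (hnext j (F j)).1 x hx
    H_range := fun j w hw p => by rw [hF]; exact (hnext j (F j)).2.1 w hw p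
    H_range' := fun j w hw p => by rw [hF]; exact (hnext j (F j)).2.2.1 w hw p
    H_pos := fun w p hp => (F w.length).2.1 w rfl p hp
    H_neg := fun w => (F w.length).2.2 w rfl
    H_small := fun j w hw => by rw [hF]; exact (hnext j (F j)).2.2.2.2.2 w hw }⟩

end

section

variable {m : ℕ} {V : Type*} [NormedAddCommGroup V]

/-- The tube with address `w`. -/
def tube {X : Type*} (J : ThickTorus m → X) (w : List (Fin (numKids m))) : Set X :=
  range (J ∘ kidWord m w)

/-- A compact set containing the children of the tube with a given address. -/
def hullSet (m : ℕ) : Set (ThickTorus m) := {p | ‖p.2‖ ≤ 0.7}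

/-- The intersection of the stages of the tower. -/
def towerSet {X : Type*} (J : ThickTorus m → X) : Set X := {x | ∀ j, ∃ w, w.length = j ∧
    x ∈ tube J w}

/-- A sequence of addresses, each extending the previous one by a letter. -/
def IsBranch (w : ℕ → List (Fin (numKids m))) : Prop :=
  (∀ j, (w j).length = j) ∧ ∀ j, ∃ l, w (j + 1) = w j ++ [l]

section Tube

variable {X : Type*} {J : ThickTorus m → X}

lemma tube_append_subset (v u : List (Fin (numKids m))) : tube J (v ++ u) ⊆ tube J v := by
  rintro _ ⟨p, rfl⟩
  exact ⟨kidWord m u p, by simp only [Function.comp_apply, kidWord_append]⟩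

lemma tube_concat_subset (v : List (Fin (numKids m))) (l : Fin (numKids m)) :
    tube J (v ++ [l]) ⊆ J ∘ kidWord m v '' hullSet m := by
  rintro _ ⟨p, rfl⟩
  exact ⟨kidMap m l p, norm_kidMap_le l p, by
    simp only [Function.comp_apply, range_kidWord_concat_subset]⟩

lemma image_hull_subset (v : List (Fin (numKids m))) :
    J ∘ kidWord m v '' hullSet m ⊆ tube J v := image_subset_range _ _

lemma eq_of_mem_tube (hJ : Function.Injective J) {v w : List (Fin (numKids m))}
    (hl : v.length = w.length) {x : X} (hv : x ∈ tube J v) (hw : x ∈ tube J w) : v = w := by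
  by_contra h
  have := disjoint_image_kidWord hJ hl h univ univ
  rw [image_univ, image_univ] at this
  exact disjoint_left.1 this hv hw

lemma exists_append_of_mem_tube (hJ : Function.Injective J) {v w : List (Fin (numKids m))}
    (hl : w.length ≤ v.length) {x : X} (hv : x ∈ tube J v) (hw : x ∈ tube J w) :
    ∃ u, v = w ++ u := by
  refine ⟨v.drop w.length, ?_⟩
  have h1 : x ∈ tube J (v.take w.length) := by
    rw [← List.take_append_drop w.length v] at hv
    exact tube_append_subset _ _ hv
  rw [← eq_of_mem_tube hJ (by simp [hl]) h1 hw, List.length_take, min_eq_left hl,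
    List.take_append_drop]

lemma isOpen_tube [TopologicalSpace X] (hJ : Topology.IsOpenEmbedding J) (w) : IsOpen (tube J w) :=
  (hJ.comp (isOpenEmbedding_kidWord w)).isOpen_range

lemma isCompact_image_hull [TopologicalSpace X] (hJ : Continuous J) (w : List (Fin (numKids m))) :
    IsCompact (J ∘ kidWord m w '' hullSet m) :=
  (isCompact_norm_le _).image (hJ.comp (isOpenEmbedding_kidWord w).continuous)

lemma exists_isBranch_of {P : List (Fin (numKids m)) → Prop} (h1 : ∀ v u, P (v ++ u) → P v)
    (h2 : ∀ v w, v.length = w.length → P v → P w → v = w) (h3 : ∀ j, ∃ w, w.length = j ∧ P w) :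
    ∃ w, IsBranch w ∧ ∀ j, P (w j) := by
  choose w hw hxw using h3
  refine ⟨w, ⟨hw, fun j => ?_⟩, hxw⟩
  have hne : w (j + 1) ≠ [] := by intro h; have := hw (j + 1); simp [h] at this
  have h := List.dropLast_append_getLast hne
  refine ⟨(w (j + 1)).getLast hne, ?_⟩
  rw [← h2 (w (j + 1)).dropLast (w j) (by simp [hw])
    (by have := hxw (j + 1); rw [← h] at this; exact h1 _ _ this) (hxw j), h]

lemma exists_isBranch_of_mem_towerSet (hJ : Function.Injective J) {x : X} (hx : x ∈ towerSet J) :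
    ∃ w, IsBranch w ∧ ∀ j, x ∈ tube J (w j) :=
  exists_isBranch_of (fun _ _ h => tube_append_subset _ _ h)
    (fun _ _ hl hv hw => eq_of_mem_tube hJ hl hv hw) hx

lemma IsBranch.exists_mem_tube [TopologicalSpace X] [T2Space X] (hJ : Continuous J)
    {w : ℕ → List (Fin (numKids m))} (hw : IsBranch w) : ∃ a, ∀ j, a ∈ tube J (w j) := by
  have h := IsCompact.nonempty_iInter_of_sequence_nonempty_isCompact_isClosed
    (fun j => J ∘ kidWord m (w j) '' hullSet m) (fun j => by
      obtain ⟨l, hl⟩ := hw.2 j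
      rw [hl]
      exact (image_hull_subset _).trans (tube_concat_subset _ _))
    (fun j => ⟨_, mem_image_of_mem _ (show (fun _ => 1,
        0) ∈ hullSet m by simp [hullSet]; norm_num)⟩)
    (isCompact_image_hull hJ _) (fun j => (isCompact_image_hull hJ _).isClosed)
  obtain ⟨a, ha⟩ := h
  exact ⟨a, fun j => image_hull_subset _ (mem_iInter.1 ha j)⟩

lemma exists_dist_tube_lt {X : Type*} [PseudoMetricSpace X] {J : ThickTorus m →
    X} (hJ : Continuous J)
    {ε : ℝ} (hε : 0 < ε) : ∃ j, ∀ w : List (Fin (numKids m)), j ≤ w.length →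
      ∀ x ∈ tube J w, ∀ y ∈ tube J w, dist x y < ε := by
  have hu := (isCompact_norm_le (m := m) 0.7).uniformContinuousOn_of_continuous hJ.continuousOn
  obtain ⟨δ, hδ, h⟩ := Metric.uniformContinuousOn_iff.1 hu ε hε
  obtain ⟨j, hj⟩ := exists_dist_kidWord_lt (m := m) hδ
  refine ⟨j + 1, ?_⟩
  rintro w hw _ ⟨p, rfl⟩ _ ⟨q, rfl⟩
  refine h _ ?_ _ ?_ (hj w (by omega) p q)
  all_goals
    cases w with
    | nil => simp at hw
    | cons l w => exact norm_kidMap_le l _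

end Tube

namespace Tower

variable {J : ThickTorus m → V × ℝ} {E : ℕ → Set V} (T : Tower J E)

/-- The position of the tube with address `w` after all pushes. -/
def pushed (w : List (Fin (numKids m))) : Set (V × ℝ) := T.H w.length '' tube J w

/-- The intersection of the pushed stages of the tower. -/
def limitSet : Set (V × ℝ) := {x | ∀ j, ∃ w, w.length = j ∧ x ∈ T.pushed w}

lemma H_eq_of_notMem {j : ℕ} {x : V × ℝ} (hx : ∀ w, w.length = j → x ∉ tube J w) :
    ∀ i, T.H (j + i) x = T.H j x := by
  intro i
  induction i with
  | zero => rfl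
  | succ i ih =>
    rw [← ih, ← add_assoc]
    refine T.H_succ _ _ fun w hw hxw => hx (w.take j) (by simp [hw]) ?_
    rw [← List.take_append_drop j w] at hxw
    exact tube_append_subset _ _ (image_subset_range _ _ hxw)

variable (hJ : Topology.IsOpenEmbedding J)
include hJ

lemma image_tube (w : List (Fin (numKids m))) (i : ℕ) :
    T.H (w.length + i) '' tube J w = T.pushed w := by
  induction i with
  | zero => rfl
  | succ i ih =>
    rw [← ih, ← add_assoc]
    apply Subset.antisymm
    · rintro _ ⟨x, hx, rfl⟩
      by_cases h : ∃ v, v.length = w.length + i ∧ x ∈ tube J v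
      · obtain ⟨v, hv, hxv⟩ := h
        obtain ⟨u, rfl⟩ := exists_append_of_mem_tube hJ.injective (by omega) hxv hx
        obtain ⟨p, rfl⟩ := hxv
        obtain ⟨p', hp'⟩ := T.H_range _ _ hv p
        exact ⟨_, tube_append_subset w u ⟨p', rfl⟩, hp'.symm⟩
      · push Not at h
        exact ⟨x, hx, (T.H_eq_of_notMem h 1).symm⟩
    · rintro _ ⟨x, hx, rfl⟩
      by_cases h : ∃ v, v.length = w.length + i ∧ x ∈ tube J v
      · obtain ⟨v, hv, hxv⟩ := h
        obtain ⟨u, rfl⟩ := exists_append_of_mem_tube hJ.injective (by omega) hxv hx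
        obtain ⟨p, rfl⟩ := hxv
        obtain ⟨p', hp'⟩ := T.H_range' _ _ hv p
        exact ⟨_, tube_append_subset w u ⟨p', rfl⟩, hp'.symm⟩
      · push Not at h
        exact ⟨x, hx, T.H_eq_of_notMem h 1⟩

lemma image_tube_of_le {w : List (Fin (numKids m))} {i : ℕ} (hi : w.length ≤ i) :
    T.H i '' tube J w = T.pushed w := by
  obtain ⟨i, rfl⟩ := Nat.exists_eq_add_of_le hi
  exact T.image_tube hJ w i

lemma pushed_append_subset (v u : List (Fin (numKids m))) : T.pushed (v ++ u) ⊆ T.pushed v := by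
  rw [pushed, ← T.image_tube_of_le hJ (w := v) (i := (v ++ u).length) (by simp)]
  exact image_mono (tube_append_subset _ _)

lemma eq_of_mem_pushed {v w : List (Fin (numKids m))} (hl : v.length = w.length) {x : V × ℝ}
    (hv : x ∈ T.pushed v) (hw : x ∈ T.pushed w) : v = w := by
  obtain ⟨y, hy, rfl⟩ := hv
  obtain ⟨y', hy', h⟩ := hw
  rw [hl] at h
  exact eq_of_mem_tube hJ.injective hl hy ((T.H _).injective h ▸ hy')

lemma isOpen_pushed (w) : IsOpen (T.pushed w) := (T.H _).isOpenMap _ (isOpen_tube hJ w)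

/-- A compact set between a pushed tube and its pushed children. -/
lemma exists_isCompact_pushed (w : List (Fin (numKids m))) :
    ∃ K, IsCompact K ∧ K ⊆ T.pushed w ∧ ∀ l, T.pushed (w ++ [l]) ⊆ K := by
  refine ⟨T.H (w.length + 1) '' (J ∘ kidWord m w '' hullSet m),
    (isCompact_image_hull hJ.continuous w).image (T.H _).continuous, ?_, fun l => ?_⟩
  · rw [← T.image_tube hJ w 1]
    exact image_mono (image_hull_subset _)
  · rw [pushed, List.length_append, List.length_singleton]
    exact image_mono (tube_concat_subset w l)

lemma exists_isBranch {x : V × ℝ} (hx : x ∈ T.limitSet) :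
    ∃ w, IsBranch w ∧ ∀ j, x ∈ T.pushed (w j) :=
  exists_isBranch_of (fun v u h => T.pushed_append_subset hJ v u h)
    (fun _ _ hl hv hw => T.eq_of_mem_pushed hJ hl hv hw) hx

lemma mem_pushed_iff_of_isBranch {x : V × ℝ} {w : ℕ → List (Fin (numKids m))} (hw : IsBranch w)
    (hx : ∀ j, x ∈ T.pushed (w j)) (v) : x ∈ T.pushed v ↔ v = w v.length :=
  ⟨fun h => T.eq_of_mem_pushed hJ (hw.1 _).symm h (hx _), fun h => h ▸ hx _⟩

lemma exists_mem_limitSet_of_isBranch {w : ℕ → List (Fin (numKids m))} (hw : IsBranch w) :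
    ∃ z : V × ℝ, z.2 ≤ 0 ∧ ∀ j, z ∈ T.pushed (w j) := by
  choose K hK hKw hwK using T.exists_isCompact_pushed hJ
  have hcl : IsClosed {z : V × ℝ | z.2 ≤ 0} := isClosed_le continuous_snd continuous_const
  obtain ⟨z, hz⟩ := IsCompact.nonempty_iInter_of_sequence_nonempty_isCompact_isClosed
    (fun j => K (w j) ∩ {z | z.2 ≤ 0}) (fun j => by
      obtain ⟨l, hl⟩ := hw.2 j
      refine inter_subset_inter_left _ ?_
      rw [hl]
      exact (hKw _).trans (hwK _ l))
    (fun j => by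
      obtain ⟨l, hl⟩ := hw.2 j
      obtain ⟨p, hp⟩ := T.H_neg (w (j + 1))
      exact ⟨_, hwK (w j) l (hl ▸ ⟨_, ⟨p, rfl⟩, rfl⟩), hp⟩)
    ((hK _).inter_right hcl) (fun j => ((hK _).inter_right hcl).isClosed)
  rw [mem_iInter] at hz
  exact ⟨z, (hz 0).2, fun j => hKw _ (hz j).1⟩

omit hJ in
lemma small {j : ℕ} {w : List (Fin (numKids m))} (hw : w.length = j + 1) : ∃ κ ε,
    ε ≤ 1 / (j + 1 : ℝ) ∧
    closedBall κ ε ⊆ E j ∧ ∀ z ∈ T.pushed w, z.2 ≤ 0 → z ∈ closedBall (κ, 0) ε := by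
  obtain ⟨κ, ε, h1, h2, h3⟩ := T.H_small j w hw
  refine ⟨κ, ε, h1, h2, ?_⟩
  rintro _ ⟨_, ⟨p, rfl⟩, rfl⟩
  rw [hw]
  exact h3 p

omit hJ in
lemma dist_le_of_mem_pushed {j : ℕ} {w : List (Fin (numKids m))} (hw : w.length = j + 1)
    {z z' : V × ℝ} (hz : z ∈ T.pushed w) (hz' : z' ∈ T.pushed w) (h : z.2 ≤ 0) (h' : z'.2 ≤ 0) :
    dist z z' ≤ 2 * (1 / (j + 1 : ℝ)) := by
  obtain ⟨κ, ε, h1, -, h3⟩ := T.small hw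
  have a := h3 z hz h
  have b := h3 z' hz' h'
  rw [mem_closedBall] at a b
  linarith [dist_triangle_right z z' (κ, 0)]

lemma mem_plane {z : V × ℝ} (hz : z ∈ T.limitSet) (h : z.2 ≤ 0) : z.2 = 0 ∧ ∀ j, z.1 ∈ E j := by
  obtain ⟨w, hw, hzw⟩ := T.exists_isBranch hJ hz
  refine ⟨?_, fun j => ?_⟩
  · refine tendsto_nhds_unique tendsto_const_nhds (squeeze_zero_norm (fun j => ?_)
      tendsto_one_div_add_atTop_nhds_zero_nat)
    obtain ⟨κ, ε, h1, -, h3⟩ := T.small (hw.1 (j + 1))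
    have := h3 z (hzw _) h
    rw [mem_closedBall, Prod.dist_eq, Real.dist_0_eq_abs] at this
    exact (le_max_right _ _).trans (this.trans h1)
  · obtain ⟨κ, ε, -, h2, h3⟩ := T.small (hw.1 (j + 1))
    have := h3 z (hzw _) h
    rw [mem_closedBall, Prod.dist_eq] at this
    exact h2 ((le_max_left _ _).trans this)

omit hJ in
/-- Two limit points of the same branch which are not above the plane are equal. -/
lemma eq_of_isBranch {w : ℕ → List (Fin (numKids m))} (hw : IsBranch w) {z z' : V × ℝ}
    (hz : ∀ j, z ∈ T.pushed (w j)) (hz' : ∀ j, z' ∈ T.pushed (w j)) (h : z.2 ≤ 0) (h' : z'.2 ≤ 0) :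
    z = z' := by
  have ht := (tendsto_one_div_add_atTop_nhds_zero_nat (𝕜 := ℝ)).const_mul 2
  rw [mul_zero] at ht
  exact dist_le_zero.1 (ge_of_tendsto' ht fun j =>
    T.dist_le_of_mem_pushed (hw.1 (j + 1)) (hz _) (hz' _) h h')

omit hJ in
lemma limitSet_subset : T.limitSet ⊆ range J := by
  intro x hx
  obtain ⟨w, hw, y, hy, rfl⟩ := hx 0
  rw [hw, T.H_zero]
  obtain ⟨p, rfl⟩ := hy
  exact ⟨_, rfl⟩

lemma isCompact_limitSet : IsCompact T.limitSet := by
  choose K hK hKw hwK using T.exists_isCompact_pushed hJ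
  have hfin := fun j => List.finite_length_eq (Fin (numKids m)) j
  have hc : ∀ j, IsCompact (⋃ w ∈ {w : List (Fin (numKids m)) | w.length = j}, K w) := fun j =>
    (hfin j).isCompact_biUnion fun w _ => hK w
  have : T.limitSet = ⋂ j, ⋃ w ∈ {w : List (Fin (numKids m)) | w.length = j}, K w := by
    ext x
    simp only [mem_iInter, mem_iUnion, exists_prop]
    constructor
    · intro hx j
      obtain ⟨w, hw, hxw⟩ := T.exists_isBranch hJ hx
      obtain ⟨l, hl⟩ := hw.2 j
      exact ⟨w j, hw.1 j, hwK _ l (hl ▸ hxw (j + 1))⟩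
    · intro hx j
      obtain ⟨w, hw, h⟩ := hx j
      exact ⟨w, hw, hKw _ h⟩
  rw [this]
  exact (hc 0).of_isClosed_subset (isClosed_iInter fun j => (hc j).isClosed) (iInter_subset _ 0)

end Tower

end

section

variable {m : ℕ} {V : Type*} [NormedAddCommGroup V]

namespace Tower

variable {J : ThickTorus m → V × ℝ} {E : ℕ → Set V} (T : Tower J E)

/-- The inverse of the limit of the pushes, extended so as to collapse each branch of the limit
set to the corresponding point of the tower. -/
def collapse (z : V × ℝ) : V × ℝ :=
  Classical.epsilon fun a => (∀ w, z ∈ T.pushed w → a ∈ tube J w) ∧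
    ∀ j, (∀ w, w.length = j → z ∉ T.pushed w) → a = (T.H j).symm z

variable (hJ : Topology.IsOpenEmbedding J)
include hJ

lemma notMem_pushed_of_le {z : V × ℝ} {i j : ℕ} (hij : i ≤ j)
    (h : ∀ w, w.length = i → z ∉ T.pushed w) (w) (hw : w.length = j) : z ∉ T.pushed w := by
  intro hz
  rw [← List.take_append_drop i w] at hz
  exact h (w.take i) (by simp [hw, hij]) (T.pushed_append_subset hJ _ _ hz)

omit hJ in
lemma symm_eq_of_le {z : V × ℝ} {i j : ℕ} (hij : i ≤ j)
    (h : ∀ w, w.length = i → z ∉ T.pushed w) : (T.H j).symm z = (T.H i).symm z := by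
  obtain ⟨k, rfl⟩ := Nat.exists_eq_add_of_le hij
  rw [Homeomorph.symm_apply_eq, T.H_eq_of_notMem, Homeomorph.apply_symm_apply]
  intro w hw hz
  exact h w hw ⟨_, hz, by rw [hw, Homeomorph.apply_symm_apply]⟩

lemma collapse_spec (z : V × ℝ) : (∀ w, z ∈ T.pushed w → T.collapse z ∈ tube J w) ∧
    ∀ j, (∀ w, w.length = j → z ∉ T.pushed w) → T.collapse z = (T.H j).symm z := by
  refine Classical.epsilon_spec (p := fun a => (∀ w, z ∈ T.pushed w → a ∈ tube J w) ∧
    ∀ j, (∀ w, w.length = j → z ∉ T.pushed w) → a = (T.H j).symm z) ?_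
  by_cases hz : z ∈ T.limitSet
  · obtain ⟨w, hw, hzw⟩ := T.exists_isBranch hJ hz
    obtain ⟨a, ha⟩ := hw.exists_mem_tube hJ.continuous
    refine ⟨a, fun v hv => ?_, fun j hj => absurd (hzw j) (hj _ (hw.1 j))⟩
    rw [(T.mem_pushed_iff_of_isBranch hJ hw hzw v).1 hv]
    exact ha _
  · simp only [limitSet, mem_ofPred_eq, not_forall, not_exists, not_and] at hz
    obtain ⟨j, hj⟩ := hz
    refine ⟨(T.H j).symm z, fun w hw => ?_, fun i hi => ?_⟩
    · have hl : w.length ≤ j := by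
        by_contra! h
        exact T.notMem_pushed_of_le hJ h.le hj w rfl hw
      rw [← T.image_tube_of_le hJ hl] at hw
      obtain ⟨x, hx, rfl⟩ := hw
      rwa [Homeomorph.symm_apply_apply]
    · rcases le_total i j with h | h
      · exact T.symm_eq_of_le h hi
      · exact (T.symm_eq_of_le h hj).symm

lemma collapse_eq {z : V × ℝ} {j : ℕ} (hj : ∀ w, w.length = j → z ∉ T.pushed w) :
    T.collapse z = (T.H j).symm z := (T.collapse_spec hJ z).2 j hj

lemma collapse_mem_tube_iff {z : V × ℝ} {w : List (Fin (numKids m))} :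
    T.collapse z ∈ tube J w ↔ z ∈ T.pushed w := by
  refine ⟨fun h => ?_, (T.collapse_spec hJ z).1 w⟩
  by_cases hz : z ∈ T.limitSet
  · obtain ⟨v, hv, hzv⟩ := hz w.length
    rwa [← eq_of_mem_tube hJ.injective hv ((T.collapse_spec hJ z).1 v hzv) h]
  · simp only [limitSet, mem_ofPred_eq, not_forall, not_exists, not_and] at hz
    obtain ⟨j, hj⟩ := hz
    rw [← T.image_tube_of_le hJ (le_max_right j w.length)]
    rw [T.collapse_eq hJ (T.notMem_pushed_of_le hJ (le_max_left j w.length) hj)] at h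
    exact ⟨_, h, Homeomorph.apply_symm_apply _ _⟩

lemma collapse_mem_towerSet_iff {z : V × ℝ} : T.collapse z ∈ towerSet J ↔ z ∈ T.limitSet := by
  simp only [towerSet, limitSet, mem_ofPred_eq, T.collapse_mem_tube_iff hJ]

lemma continuous_collapse : Continuous T.collapse := by
  rw [continuous_iff_continuousAt]
  intro z
  by_cases hz : z ∈ T.limitSet
  · rw [Metric.continuousAt_iff']
    intro ε hε
    obtain ⟨j, hj⟩ := exists_dist_tube_lt hJ.continuous hε
    obtain ⟨w, hw, hzw⟩ := hz j
    filter_upwards [(T.isOpen_pushed hJ w).mem_nhds hzw] with y hy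
    exact hj w hw.ge _ ((T.collapse_mem_tube_iff hJ).2 hy) _ ((T.collapse_mem_tube_iff hJ).2 hzw)
  · simp only [limitSet, mem_ofPred_eq, not_forall, not_exists, not_and] at hz
    obtain ⟨j, hj⟩ := hz
    choose K hK hKw hwK using T.exists_isCompact_pushed hJ
    have hc : IsClosed (⋃ w ∈ {w : List (Fin (numKids m)) | w.length = j}, K w) :=
      ((List.finite_length_eq _ j).isCompact_biUnion fun w _ => hK w).isClosed
    refine (T.H (j + 1)).symm.continuous.continuousAt.congr ?_
    filter_upwards [hc.isOpen_compl.mem_nhds (x := z) (by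
      simp only [mem_compl_iff, mem_iUnion, not_exists]
      exact fun w hw h => hj w hw (hKw w h))] with y hy
    refine (T.collapse_eq hJ fun w hw hyw => hy ?_).symm
    have hne : w ≠ [] := by rintro rfl; simp at hw
    rw [← List.dropLast_append_getLast hne] at hyw
    exact mem_biUnion (show w.dropLast.length = j by simp [hw]) (hwK _ _ hyw)

lemma collapse_injOn : InjOn T.collapse {z | z ∈ T.limitSet → z.2 ≤ 0} := by
  intro z hz z' hz' h
  have key : ∀ w, z ∈ T.pushed w ↔ z' ∈ T.pushed w := fun w => by
    rw [← T.collapse_mem_tube_iff hJ, h, T.collapse_mem_tube_iff hJ]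
  by_cases hX : z ∈ T.limitSet
  · have hX' : z' ∈ T.limitSet := by
      rwa [← T.collapse_mem_towerSet_iff hJ, ← h, T.collapse_mem_towerSet_iff hJ]
    obtain ⟨w, hw, hzw⟩ := T.exists_isBranch hJ hX
    exact T.eq_of_isBranch hw hzw (fun j => (key _).1 (hzw j)) (hz hX) (hz' hX')
  · simp only [limitSet, mem_ofPred_eq, not_forall, not_exists, not_and] at hX
    obtain ⟨j, hj⟩ := hX
    rw [T.collapse_eq hJ hj, T.collapse_eq hJ fun w hw => by rw [← key]; exact hj w hw] at h
    exact (T.H j).symm.injective h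

lemma collapse_H {x : V × ℝ} {j : ℕ} (hx : ∀ w, w.length = j → x ∉ tube J w) :
    T.collapse (T.H j x) = x ∧ T.H j x ∉ T.limitSet := by
  have hn : ∀ w, w.length = j → T.H j x ∉ T.pushed w := by
    rintro w hw ⟨y, hy, h⟩
    rw [hw] at h
    exact hx w hw ((T.H j).injective h ▸ hy)
  refine ⟨by rw [T.collapse_eq hJ hn, Homeomorph.symm_apply_apply], fun h => ?_⟩
  obtain ⟨w, hw, hxw⟩ := h j
  exact hn w hw hxw

lemma exists_collapse_eq (x : V × ℝ) : ∃ z, (z ∈ T.limitSet → z.2 ≤ 0) ∧ T.collapse z = x := by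
  by_cases hx : x ∈ towerSet J
  · obtain ⟨w, hw, hxw⟩ := exists_isBranch_of_mem_towerSet hJ.injective hx
    obtain ⟨z, hz, hzw⟩ := T.exists_mem_limitSet_of_isBranch hJ hw
    refine ⟨z, fun _ => hz, dist_le_zero.1 (le_of_forall_pos_lt_add fun ε hε => ?_)⟩
    obtain ⟨j, hj⟩ := exists_dist_tube_lt hJ.continuous hε
    rw [zero_add]
    exact hj (w j) (hw.1 j).ge _ ((T.collapse_mem_tube_iff hJ).2 (hzw j)) _ (hxw j)
  · simp only [towerSet, mem_ofPred_eq, not_forall, not_exists, not_and] at hx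
    obtain ⟨j, hj⟩ := hx
    exact ⟨_, fun h => absurd h (T.collapse_H hJ hj).2, (T.collapse_H hJ hj).1⟩

lemma collapse_eq_self {x : V × ℝ} (hx : x ∉ range J) : T.collapse x = x := by
  have := (T.collapse_H hJ (x := x) (j := 0) fun w hw => by
    rw [List.length_eq_zero_iff.1 hw]; exact hx).1
  rwa [T.H_zero] at this

lemma collapse_mem_range_iff {x : V × ℝ} : T.collapse x ∈ range J ↔ x ∈ range J := by
  have h : T.pushed [] = range J := by
    ext y
    simp only [pushed, List.length_nil, mem_image, T.H_zero, exists_eq_right]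
    rfl
  exact (T.collapse_mem_tube_iff hJ (z := x) (w := [])).trans (by rw [h])

/-- The limit set retracts onto its part in the plane, along the branches. -/
lemma exists_retract : ∃ c : V × ℝ → V, ContinuousOn c T.limitSet ∧
    ∀ z ∈ T.limitSet, (c z, (0 : ℝ)) ∈ T.limitSet ∧ T.collapse (c z, 0) = T.collapse z := by
  have key : ∀ z, ∃ v : V, z ∈ T.limitSet → ∀ w, z ∈ T.pushed w → (v, (0 : ℝ)) ∈ T.pushed w := by
    intro z
    by_cases hz : z ∈ T.limitSet
    · obtain ⟨w, hw, hzw⟩ := T.exists_isBranch hJ hz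
      obtain ⟨y, hy, hyw⟩ := T.exists_mem_limitSet_of_isBranch hJ hw
      have h0 := (T.mem_plane hJ (fun j => ⟨w j, hw.1 j, hyw j⟩) hy).1
      refine ⟨y.1, fun _ v hv => ?_⟩
      rw [← h0, (T.mem_pushed_iff_of_isBranch hJ hw hzw v).1 hv]
      exact hyw _
    · exact ⟨0, fun h => absurd h hz⟩
  choose c hc using key
  have hX : ∀ z ∈ T.limitSet, (c z, (0 : ℝ)) ∈ T.limitSet := fun z hz j => by
    obtain ⟨w, hw, hzw⟩ := hz j
    exact ⟨w, hw, hc z hz w hzw⟩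
  refine ⟨c, ?_, fun z hz => ⟨hX z hz, ?_⟩⟩
  · rw [Metric.continuousOn_iff']
    intro z hz ε hε
    obtain ⟨j, hj⟩ := exists_nat_one_div_lt (half_pos hε)
    obtain ⟨w, hw, hzw⟩ := hz (j + 1)
    filter_upwards [mem_nhdsWithin_of_mem_nhds ((T.isOpen_pushed hJ w).mem_nhds hzw),
      self_mem_nhdsWithin] with y hy hyX
    have := T.dist_le_of_mem_pushed hw (hc y hyX w hy) (hc z hz w hzw) le_rfl le_rfl
    rw [Prod.dist_eq] at this
    linarith [le_max_left (dist (c y) (c z)) (dist (0 : ℝ) 0)]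
  · refine dist_le_zero.1 (le_of_forall_pos_lt_add fun ε hε => ?_)
    obtain ⟨j, hj⟩ := exists_dist_tube_lt hJ.continuous hε
    obtain ⟨w, hw, hzw⟩ := hz j
    rw [zero_add]
    exact hj w hw.ge _ ((T.collapse_mem_tube_iff hJ).2 (hc z hz w hzw)) _
      ((T.collapse_mem_tube_iff hJ).2 hzw)

lemma exists_collapse_postSet {w : List (Fin (numKids m))} {p : ThickTorus m} (hp : p ∈ postSet m) :
    ∃ z ∈ range J, z ∉ T.limitSet ∧ 0 < z.2 ∧ T.collapse z = J (kidWord m w p) := by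
  have h1 : ∀ v, v.length = w.length + 1 → J (kidWord m w p) ∉ tube J v := by
    intro v hv h
    obtain ⟨v', l, rfl⟩ : ∃ v' l, v = v' ++ [l] :=
      ⟨_, _, (List.dropLast_append_getLast (show v ≠ [] by rintro rfl; simp at hv)).symm⟩
    have h2 := eq_of_mem_tube hJ.injective (by simpa using hv) (tube_append_subset _ _ h)
      (show J (kidWord m w p) ∈ tube J w from ⟨p, rfl⟩)
    subst h2
    obtain ⟨q, hq⟩ := h
    simp only [Function.comp_apply, range_kidWord_concat_subset] at hq
    have h3 := (isOpenEmbedding_kidWord v').injective (hJ.injective hq)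
    exact disjoint_left.1 (disjoint_postSet_kidMap _) hp ⟨q, h3⟩
  have h2 : T.H (w.length + 1) (J (kidWord m w p)) = T.H w.length (J (kidWord m w p)) := by
    refine T.H_succ _ _ ?_
    rintro v hv ⟨q, hq, hqp⟩
    obtain ⟨-, rfl⟩ := kidWord_eq_of_length hv (hJ.injective hqp)
    exact disjoint_left.1 disjoint_reachSet_postSet hq hp
  have h3 := T.collapse_H hJ h1
  refine ⟨_, ?_, h3.2, ?_, h3.1⟩
  · rw [← T.collapse_mem_range_iff hJ, h3.1]; exact ⟨_, rfl⟩
  · rw [h2]; exact T.H_pos w p (postSet_subset_keepSet hp)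

/-- If the tower is bounded, `collapse` is a closed map. -/
lemma isClosedMap_collapse {B : Set (V × ℝ)} (hB : IsCompact B) (hJB : range J ⊆ B) :
    IsClosedMap T.collapse := by
  intro F hF
  have : T.collapse '' F = T.collapse '' (F ∩ B) ∪ (F ∩ (range J)ᶜ) := by
    ext x
    constructor
    · rintro ⟨z, hz, rfl⟩
      by_cases h : z ∈ range J
      · exact Or.inl ⟨z, ⟨hz, hJB h⟩, rfl⟩
      · rw [T.collapse_eq_self hJ h]; exact Or.inr ⟨hz, h⟩
    · rintro (⟨z, hz, rfl⟩ | ⟨hx, hx'⟩)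
      · exact ⟨z, hz.1, rfl⟩
      · exact ⟨x, hx, T.collapse_eq_self hJ hx'⟩
  rw [this]
  exact ((hB.inter_left hF).image (T.continuous_collapse hJ)).isClosed.union
    (hF.inter hJ.isOpen_range.isClosed_compl)

end Tower

end

section

/-- A permutation is a shift if it has countably infinitely many orbits, all of them infinite. -/
def IsShift {S : Type*} (g : Equiv.Perm S) : Prop :=
  ∃ Φ : S ≃ ℤ × ℕ, ∀ s, Φ (g s) = ((Φ s).1 + 1, (Φ s).2)

lemma isShift_of_level {S : Type*} {g : Equiv.Perm S} (l : S → ℤ) (hl : ∀ s, l (g s) = l s + 1)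
    [Denumerable {s // l s = 0}] : IsShift g := by
  have hz : ∀ (n : ℤ) (s : S), l ((g ^ n) s) = l s + n := by
    intro n s
    induction n with
    | zero => simp
    | succ n ih =>
      rw [zpow_add_one, ← (Commute.self_zpow g n).eq, Equiv.Perm.mul_apply, hl, ih]; ring
    | pred n ih =>
      have h : (g ^ (-(n : ℤ))) s = g ((g ^ (-(n : ℤ) - 1)) s) := by
        rw [← Equiv.Perm.mul_apply, ← zpow_one_add]; congr 2; ring
      rw [h, hl] at ih
      linarith
  let e := Denumerable.eqv {s // l s = 0}
  have h0 : ∀ s, l ((g ^ (-l s)) s) = 0 := fun s => by rw [hz]; ring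
  refine ⟨⟨fun s => (l s, e ⟨(g ^ (-l s)) s, h0 s⟩), fun n => (g ^ n.1) (e.symm n.2), fun s => ?_,
    fun n => ?_⟩, fun s => ?_⟩
  · simp
  · have h1 : l ((g ^ n.1) (e.symm n.2)) = n.1 := by rw [hz, (e.symm n.2).2, zero_add]
    refine Prod.ext h1 ?_
    have h2 : (⟨(g ^ (-l ((g ^ n.1) (e.symm n.2)))) ((g ^ n.1) (e.symm n.2)),
        h0 _⟩ : {s // l s = 0})
        = e.symm n.2 := Subtype.ext (by simp [h1])
    simp only [h2, Equiv.apply_symm_apply]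
  · refine Prod.ext (hl s) ?_
    have h2 : (g ^ (-l (g s))) (g s) = (g ^ (-l s)) s := by
      rw [hl, neg_add, zpow_add]; simp
    simp only [Equiv.coe_fn_mk, h2]

/-- Every shift is a commutator involving itself and another shift. -/
lemma IsShift.exists_mul_eq {S : Type*} {g : Equiv.Perm S} (hg : IsShift g) :
    ∃ D : Equiv.Perm S, IsShift D ∧ D * g = g * g * D := by
  obtain ⟨Φ, hΦ⟩ := hg
  let β : ℕ ≃ ℕ × ℤ := (Denumerable.eqv (ℕ × ℤ)).symm
  let Ψ : S ≃ ℤ × (ℕ × ℤ) := Φ.trans ((Equiv.refl ℤ).prodCongr β)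
  have hΨ : ∀ s, Ψ (g s) = ((Ψ s).1 + 1, (Ψ s).2) := fun s => by
    change ((Φ (g s)).1, β (Φ (g s)).2) = _
    rw [hΦ]; rfl
  let d : Equiv.Perm (ℤ × (ℕ × ℤ)) :=
    { toFun := fun s => (2 * s.1 + (s.2.1 % 2 : ℕ), (s.2.1 / 2, s.2.2 + 1))
      invFun := fun s => (s.1 / 2, (2 * s.2.1 + (s.1 % 2).toNat, s.2.2 - 1))
      left_inv := fun s => by
        refine Prod.ext ?_ (Prod.ext ?_ ?_) <;> dsimp only <;> omega
      right_inv := fun s => by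
        refine Prod.ext ?_ (Prod.ext ?_ ?_) <;> dsimp only <;> omega }
  have hD : ∀ s, Ψ ((Ψ.trans (d.trans Ψ.symm)) s) = d (Ψ s) := fun s => by simp
  refine ⟨Ψ.trans (d.trans Ψ.symm), ?_, ?_⟩
  · have : Infinite {s : S // (Ψ s).2.2 = 0} := by
      refine Infinite.of_injective (fun n : ℤ => (⟨Ψ.symm (n, (0, 0)),
          by simp⟩ : {s : S // (Ψ s).2.2 = 0}))
        fun a b h => ?_
      simpa using congrArg (fun s => Ψ s.1) h
    have : Countable S := Φ.injective.countable
    have : Denumerable {s : S // (Ψ s).2.2 = 0} := (nonempty_denumerable _).some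
    refine isShift_of_level (fun s => (Ψ s).2.2) fun s => ?_
    rw [hD]; rfl
  · refine Equiv.ext fun s => Ψ.injective ?_
    simp only [Equiv.Perm.mul_apply]
    rw [hD, hΨ, hΨ, hΨ, hD]
    refine Prod.ext ?_ rfl
    change 2 * ((Ψ s).1 + 1) + _ = 2 * (Ψ s).1 + _ + 1 + 1
    ring

/-- The standard shift. -/
def stdShift : Equiv.Perm (ℤ × ℕ) := (Equiv.addRight (1 : ℤ)).prodCongr (Equiv.refl ℕ)

lemma isShift_stdShift : IsShift stdShift := ⟨Equiv.refl _, fun _ => rfl⟩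

open Classical in
/-- A shift `D` with `D g = g² D`. -/
def doubler (g : Equiv.Perm (ℤ × ℕ)) : Equiv.Perm (ℤ × ℕ) :=
  if h : IsShift g then h.exists_mul_eq.choose else 1

lemma isShift_doubler {g : Equiv.Perm (ℤ × ℕ)} (h : IsShift g) : IsShift (doubler g) := by
  rw [doubler, dif_pos h]; exact h.exists_mul_eq.choose_spec.1

lemma doubler_mul {g : Equiv.Perm (ℤ × ℕ)} (h : IsShift g) : doubler g * g = g * g * doubler g := by
  rw [doubler, dif_pos h]; exact h.exists_mul_eq.choose_spec.2

/-- The pair of permutations attached to a stage of the tower. -/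
def stageState {m : ℕ} (w : List (Fin (numKids m))) : Bool → Equiv.Perm (ℤ × ℕ) :=
  w.foldl (fun s i e => if e then s (decide (Even (i : ℕ))) else doubler (s (decide (Even (i :
      ℕ)))))
    (fun _ => stdShift)

@[simp] lemma stageState_nil {m : ℕ} (e : Bool) : stageState (m := m) [] e = stdShift := rfl

lemma stageState_concat {m : ℕ} (w : List (Fin (numKids m))) (i : Fin (numKids m)) (e : Bool) :
    stageState (w ++ [i]) e = if e then stageState w (decide (Even (i : ℕ)))
      else doubler (stageState w (decide (Even (i : ℕ)))) := by
  simp [stageState]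

lemma isShift_stageState {m : ℕ} (w : List (Fin (numKids m))) (e : Bool) :
    IsShift (stageState w e) := by
  induction w using List.reverseRecOn generalizing e with
  | nil => exact isShift_stdShift
  | append_singleton w i ih =>
    rw [stageState_concat]
    split_ifs
    · exact ih _
    · exact isShift_doubler (ih _)

lemma stageState_concat_mul {m : ℕ} (w : List (Fin (numKids m))) (i : Fin (numKids m)) :
    stageState (w ++ [i]) false * stageState (w ++ [i]) true =
      stageState (w ++ [i]) true * stageState (w ++ [i]) true * stageState (w ++ [i]) false := by
  simp only [stageState_concat]
  exact doubler_mul (isShift_stageState _ _)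

end

section

variable {m : ℕ}

/-- The parity of a child, `true` for even children. -/
def kidParity (i : Fin (numKids m)) : Bool := decide (Even (i : ℕ))

/-- The plane coordinate transverse to the children of parity `e`. -/
def coordAt (e : Bool) (p : ThickTorus m) : ℝ := if e then p.2.im else p.2.re

lemma continuous_coordAt (e : Bool) : Continuous (coordAt (m := m) e) := by
  unfold coordAt; cases e <;> simp <;> fun_prop

lemma coordAt_kidMap_self (i : Fin (numKids m)) (p : ThickTorus m) :
    coordAt (kidParity i) (kidMap m i p) = (shrink p.2).im / 20 := by
  unfold coordAt kidParity
  rw [kidMap_snd]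
  unfold kidCoord
  by_cases h : Even (i : ℕ) <;> simp [h] <;> rfl

lemma coordAt_kidMap_not (i : Fin (numKids m)) (p : ThickTorus m) :
    coordAt (!kidParity i) (kidMap m i p) = (kidPlane (lastPair p)).im := by
  unfold coordAt kidParity
  rw [kidMap_snd]
  unfold kidCoord
  by_cases h : Even (i : ℕ) <;> simp [h]

/-- The union of the flat disks, in the plane of the vanishing of `coordAt e`, spanned by the cores
of the children of parity `e`; here open disks, extended in the transverse direction. -/
def openDisks (m : ℕ) (e : Bool) : Set (ThickTorus m) :=
  {p | ∃ l : Fin (numKids m), kidParity l = e ∧ ∃ x, p.1 0 = arcPt m l x ∧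
    x ^ 2 + coordAt (!e) p ^ 2 < 1 / 4}

/-- The closed version of `openDisks`. -/
def closedDisks (m : ℕ) (e : Bool) : Set (ThickTorus m) :=
  {p | ∃ l : Fin (numKids m), kidParity l = e ∧ ∃ x, p.1 0 = arcPt m l x ∧
    x ^ 2 + coordAt (!e) p ^ 2 ≤ 1 / 4}

/-- The wall across which the permutation of parity `e` acts. -/
def wall (m : ℕ) (e : Bool) : Set (ThickTorus m) := {p | coordAt e p = 0 ∧ p ∉ openDisks m e}

/-- The disks complementary to a wall. -/
def lid (m : ℕ) (e : Bool) : Set (ThickTorus m) := {p | coordAt e p = 0 ∧ p ∈ closedDisks m e}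

lemma isOpen_openDisks (e : Bool) : IsOpen (openDisks m e) := by
  have key : openDisks m e = ⋃ (l : Fin (numKids m)) (_ : kidParity l = e),
      (fun q : (ℝ × (Fin (m + 1) → Circle)) × ℂ =>
        ((Fin.cons (arcPt m l q.1.1) q.1.2, q.2) : ThickTorus m)) ''
        {q | q.1.1 ^ 2 + (if (!e) then q.2.im else q.2.re) ^ 2 < 1 / 4} := by
    ext p
    simp only [openDisks, mem_ofPred_eq, mem_iUnion, mem_image, Prod.exists, exists_prop]
    refine exists_congr fun l => and_congr_right fun _ => ?_
    constructor
    · rintro ⟨x, hx, h⟩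
      exact ⟨x, Fin.tail p.1, p.2, h, by rw [← hx]; exact Prod.ext (Fin.cons_self_tail _) rfl⟩
    · rintro ⟨x, q, v, h, rfl⟩
      exact ⟨x, rfl, h⟩
  rw [key]
  refine isOpen_iUnion fun l => isOpen_iUnion fun _ => ?_
  have ho : IsOpenMap (fun q : (ℝ × (Fin (m + 1) → Circle)) × ℂ =>
        ((Fin.cons (arcPt m l q.1.1) q.1.2, q.2) : ThickTorus m)) := by
    let h : (ℝ × (Fin (m + 1) → Circle)) × ℂ ≃ₜ (Fin (m + 1) → Circle) × (ℝ × ℂ) :=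
      { toFun := fun q => (q.1.2, (q.1.1, q.2))
        invFun := fun q => ((q.2.1, q.1), q.2.2)
        left_inv := fun _ => rfl
        right_inv := fun _ => rfl
        continuous_toFun := by fun_prop
        continuous_invFun := by fun_prop }
    exact ((splitFirst m).isOpenMap.comp (IsOpenMap.id.prodMap
      ((isOpenMap_arcPt m l).prodMap IsOpenMap.id))).comp h.isOpenMap
  refine ho _ (isOpen_lt ?_ continuous_const)
  cases e <;> simp <;> fun_prop

lemma isClosed_closedDisks (e : Bool) : IsClosed (closedDisks m e) := by
  have key : closedDisks m e = ⋃ l ∈ {l : Fin (numKids m) | kidParity l = e},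
      (Prod.snd : Icc (-1 : ℝ) 1 × ThickTorus m → ThickTorus m) ''
        {q | q.2.1 0 = arcPt m l q.1 ∧ (q.1 : ℝ) ^ 2 + coordAt (!e) q.2 ^ 2 ≤ 1 / 4} := by
    ext p
    simp only [closedDisks, mem_ofPred_eq, mem_iUnion, mem_image, Prod.exists, exists_prop,
      Subtype.exists, exists_eq_right]
    refine exists_congr fun l => and_congr_right fun _ => exists_congr fun x => ?_
    constructor
    · rintro ⟨h1, h2⟩
      exact ⟨⟨by nlinarith [sq_nonneg (coordAt (!e) p)],
          by nlinarith [sq_nonneg (coordAt (!e) p)]⟩, h1, h2⟩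
    · rintro ⟨-, h⟩
      exact h
  rw [key]
  refine (Set.toFinite _).isClosed_biUnion fun l _ => isClosedMap_snd_of_compactSpace _ ?_
  have h1 := continuous_arcPt m l
  have h2 := continuous_coordAt (m := m) (!e)
  exact (isClosed_eq (f := fun q : Icc (-1 : ℝ) 1 × ThickTorus m => q.2.1 0)
    (g := fun q => arcPt m l q.1) (by fun_prop) (by fun_prop)).inter
      (isClosed_le (f :=
          fun q : Icc (-1 : ℝ) 1 × ThickTorus m => (q.1 : ℝ) ^ 2 + coordAt (!e) q.2 ^ 2)
        (by fun_prop) continuous_const)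

lemma isClosed_wall (e : Bool) : IsClosed (wall m e) :=
  (isClosed_eq (continuous_coordAt e) continuous_const).inter (isOpen_openDisks e).isClosed_compl

lemma isClosed_lid (e : Bool) : IsClosed (lid m e) :=
  (isClosed_eq (continuous_coordAt e) continuous_const).inter (isClosed_closedDisks e)

lemma openDisks_subset_closedDisks (e : Bool) : openDisks m e ⊆ closedDisks m e := by
  rintro p ⟨l, hl, x, hx, h⟩
  exact ⟨l, hl, x, hx, h.le⟩

lemma mem_wall_or_mem_lid {e : Bool} {p : ThickTorus m} (h : coordAt e p = 0) :
    p ∈ wall m e ∨ p ∈ lid m e := by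
  by_cases hp : p ∈ openDisks m e
  · exact Or.inr ⟨h, openDisks_subset_closedDisks e hp⟩
  · exact Or.inl ⟨h, hp⟩

lemma exists_eq_arcPt (c : Circle) : ∃ (l : Fin (numKids m)) (x : ℝ), c = arcPt m l x ∧
    |x| ≤ 0.375 := by
  obtain ⟨a, rfl⟩ := Circle.exp_surjective c
  have hk : (numKids m : ℝ) ≠ 0 := by exact_mod_cast NeZero.ne _
  have hkz : (numKids m : ℤ) ≠ 0 := by exact_mod_cast NeZero.ne _
  have hκ := (angScale_pos m).ne'
  let b := a / angScale m / 0.75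
  have hn : 0 ≤ round b % (numKids m : ℤ) := Int.emod_nonneg _ hkz
  have hn' : round b % (numKids m : ℤ) < numKids m := Int.emod_lt_of_pos _ (by omega)
  refine ⟨⟨(round b % (numKids m : ℤ)).toNat, by omega⟩, 0.75 * (b - round b), ?_, ?_⟩
  · rw [arcPt, Circle.exp_eq_exp]
    refine ⟨round b / (numKids m : ℤ), ?_⟩
    have h1 : ((round b % (numKids m : ℤ)).toNat : ℝ) = (round b % (numKids m : ℤ) : ℤ) := by
      exact_mod_cast Int.toNat_of_nonneg hn
    have h2 : (round b : ℝ) = (numKids m : ℝ) * (round b / (numKids m : ℤ) : ℤ) +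
        (round b % (numKids m : ℤ) : ℤ) := by
      exact_mod_cast (Int.mul_ediv_add_emod (round b) (numKids m)).symm
    have h3 : 2 * Real.pi = angScale m * (0.75 * numKids m) := by
      unfold angScale; field_simp; ring
    have h4 : a = angScale m * (0.75 * b) := by simp only [b]; field_simp
    simp only [h1]
    rw [h3]
    linear_combination h4 + angScale m * 0.75 * h2
  · rw [abs_mul]
    have := abs_sub_round b
    norm_num; linarith

lemma disjoint_wall {p : ThickTorus m} {e : Bool} (h : p ∈ wall m e) : p ∉ wall m (!e) := by
  intro h'
  obtain ⟨l, x, hl, hx⟩ := exists_eq_arcPt (m := m) (p.1 0)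
  have hx2 : x ^ 2 < 1 / 4 := by
    rw [← sq_abs]; nlinarith [abs_nonneg x]
  have h0 : ∀ e', coordAt e' p = 0 := by
    intro e'
    rcases Bool.eq_or_eq_not e' e with rfl | rfl
    · exact h.1
    · exact h'.1
  have : p ∈ openDisks m (kidParity l) := ⟨l, rfl, x, hl, by rw [h0]; linarith⟩
  rcases Bool.eq_or_eq_not (kidParity l) e with h1 | h1
  · exact h.2 (h1 ▸ this)
  · exact h'.2 (h1 ▸ this)

/-- A point of a wall lying on a lid is on the core circle of a child. -/
lemma mem_core_of_mem_wall_lid {p : ThickTorus m} {e : Bool} (h : p ∈ wall m e) (h' : p ∈ lid m e) :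
    ∃ (l : Fin (numKids m)) (q : ThickTorus m), ‖q.2‖ ≤ 1 ∧ kidMap m l q = p := by
  obtain ⟨-, l, hl, x, hx, hle⟩ := h'
  have heq : x ^ 2 + coordAt (!e) p ^ 2 = 1 / 4 :=
    hle.antisymm (not_lt.1 fun hlt => h.2 ⟨l, hl, x, hx, hlt⟩)
  let c : Circle := ⟨(2 : ℝ) * (⟨x, coordAt (!e) p⟩ : ℂ), by
    refine mem_sphere_zero_iff_norm.2 ?_
    rw [norm_mul, Complex.norm_real, Complex.norm_eq_sqrt_sq_add_sq, heq]
    norm_num⟩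
  let q : ThickTorus m := (Fin.snoc (α := fun _ => Circle) (Fin.tail p.1) c, 0)
  have hq : lastPair q = (c, 0) := by simp [lastPair, q]
  have hk : kidPlane (lastPair q) = ⟨x, coordAt (!e) p⟩ := by
    rw [hq]
    simp [kidPlane, polar, c, shrink_eq]
  have hs : kidSide (lastPair q) = 0 := by
    simp [hq, kidSide, shrink_eq]
  refine ⟨l, q, by simp [q], Prod.ext ?_ ?_⟩
  · funext j
    refine Fin.cases ?_ (fun j => ?_) j
    · rw [kidMap_zero, hk, hx]
    · rw [kidMap_succ]; simp [q, Fin.tail]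
  · rw [kidMap_snd, hk, hs]
    have h0 := h.1
    subst hl
    clear_value q
    unfold kidCoord coordAt kidParity at *
    by_cases hE : Even (l : ℕ)
    · simp only [hE, decide_true, if_true, Bool.not_true] at h0 ⊢
      simp [Complex.ext_iff, h0]
    · simp only [hE, decide_false, if_false, Bool.not_false] at h0 ⊢
      simp at h0
      simp [Complex.ext_iff, h0]

lemma norm_kidPlane_lt_half_iff (p : Circle × ℂ) : ‖kidPlane p‖ < 1 / 2 ↔ p.2.re < 0 := by
  rw [norm_kidPlane, div_lt_div_iff_of_pos_right two_pos, Real.exp_lt_one_iff, shrink_re]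
  have : 0 < (√(1 + ‖p.2‖ ^ 2))⁻¹ := by positivity
  constructor
  · intro h; by_contra! h'; have := mul_nonneg this.le h'; linarith
  · intro h; have := mul_neg_of_pos_of_neg this h; linarith

lemma norm_kidPlane_le_half_iff (p : Circle × ℂ) : ‖kidPlane p‖ ≤ 1 / 2 ↔ p.2.re ≤ 0 := by
  rw [norm_kidPlane, div_le_div_iff_of_pos_right two_pos, Real.exp_le_one_iff, shrink_re]
  have : 0 < (√(1 + ‖p.2‖ ^ 2))⁻¹ := by positivity
  constructor
  · intro h; by_contra! h'; have := mul_pos this h'; linarith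
  · intro h; have := mul_nonpos_of_nonneg_of_nonpos this.le h; linarith

/-- The offset of a point of a child in a disk of the same parity is its own offset. -/
lemma offset_eq_of_parity_eq {i l : Fin (numKids m)} (h : kidParity l =
    kidParity i) {p : ThickTorus m}
    {x : ℝ} (hx : (kidMap m i p).1 0 = arcPt m l x) (hx' : |x| < 0.6) :
    x = (kidPlane (lastPair p)).re := by
  rw [kidMap_zero] at hx
  obtain ⟨d, r, hd, hdr⟩ := exists_int_of_arcPt_eq hx
  have hev : ¬ Odd d := fun ho => by
    have := odd_iff_of_offset hdr ho
    simp only [kidParity, decide_eq_decide] at h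
    tauto
  rcases offset_cases hd (by linarith [abs_kidPlane_re_lt (lastPair p)]) hx' with rfl | rfl | rfl
  · push_cast at hd; linarith
  · exact absurd (by decide) hev
  · exact absurd (by decide) hev

lemma abs_lt_of_sq_add_le {x y : ℝ} (h : x ^ 2 + y ^ 2 ≤ 1 / 4) : |x| < 0.6 :=
  lt_of_pow_lt_pow_left₀ 2 (by norm_num) (by rw [sq_abs]; nlinarith [sq_nonneg y])

lemma kidMap_mem_openDisks_iff (i : Fin (numKids m)) (p : ThickTorus m) :
    kidMap m i p ∈ openDisks m (kidParity i) ↔ p.2.re < 0 := by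
  have hn := sq_norm_kidPlane (lastPair p)
  rw [show p.2 = (lastPair p).2 from rfl, ← norm_kidPlane_lt_half_iff]
  constructor
  · rintro ⟨l, hl, x, hx, h⟩
    rw [offset_eq_of_parity_eq hl hx (abs_lt_of_sq_add_le h.le), coordAt_kidMap_not, ← hn] at h
    exact lt_of_pow_lt_pow_left₀ 2 (by norm_num) (h.trans_eq (by norm_num))
  · intro h
    refine ⟨i, rfl, _, kidMap_zero i p, ?_⟩
    rw [coordAt_kidMap_not, ← hn]
    nlinarith [norm_nonneg (kidPlane (lastPair p))]

lemma kidMap_mem_closedDisks_iff (i : Fin (numKids m)) (p : ThickTorus m) :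
    kidMap m i p ∈ closedDisks m (kidParity i) ↔ p.2.re ≤ 0 := by
  have hn := sq_norm_kidPlane (lastPair p)
  rw [show p.2 = (lastPair p).2 from rfl, ← norm_kidPlane_le_half_iff]
  constructor
  · rintro ⟨l, hl, x, hx, h⟩
    rw [offset_eq_of_parity_eq hl hx (abs_lt_of_sq_add_le h), coordAt_kidMap_not, ← hn] at h
    exact le_of_sq_le_sq (h.trans_eq (by norm_num)) (by norm_num)
  · intro h
    refine ⟨i, rfl, _, kidMap_zero i p, ?_⟩
    rw [coordAt_kidMap_not, ← hn]
    nlinarith [norm_nonneg (kidPlane (lastPair p))]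

lemma coordAt_kidMap_eq_zero_iff (i : Fin (numKids m)) (p : ThickTorus m) :
    coordAt (kidParity i) (kidMap m i p) = 0 ↔ p.2.im = 0 := by
  have : (√(1 + ‖p.2‖ ^ 2))⁻¹ ≠ 0 := by positivity
  rw [coordAt_kidMap_self, shrink_im, div_eq_zero_iff]
  simp [this]

lemma coordAt_kidMap_nonneg_iff (i : Fin (numKids m)) (p : ThickTorus m) :
    0 ≤ coordAt (kidParity i) (kidMap m i p) ↔ 0 ≤ p.2.im := by
  have : 0 < (√(1 + ‖p.2‖ ^ 2))⁻¹ / 20 := by positivity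
  rw [coordAt_kidMap_self, shrink_im, mul_div_right_comm, mul_nonneg_iff_of_pos_left this]

lemma kidMap_mem_wall_iff (i : Fin (numKids m)) (p : ThickTorus m) :
    kidMap m i p ∈ wall m (kidParity i) ↔ p.2.im = 0 ∧ 0 ≤ p.2.re := by
  rw [← not_lt, ← kidMap_mem_openDisks_iff i p, ← coordAt_kidMap_eq_zero_iff i p]; rfl

lemma kidMap_mem_lid_iff (i : Fin (numKids m)) (p : ThickTorus m) :
    kidMap m i p ∈ lid m (kidParity i) ↔ p.2.im = 0 ∧ p.2.re ≤ 0 := by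
  rw [← kidMap_mem_closedDisks_iff i p, ← coordAt_kidMap_eq_zero_iff i p]; rfl

/-- A child does not meet the wall of the opposite parity. -/
lemma kidMap_notMem_wall_not (i : Fin (numKids m)) (p : ThickTorus m) :
    kidMap m i p ∉ wall m (!kidParity i) := by
  rintro ⟨h0, h⟩
  rw [coordAt_kidMap_not] at h0
  have hn := sq_norm_kidPlane (lastPair p)
  have h1 := lt_norm_kidPlane (lastPair p)
  have h2 := norm_kidPlane_lt' (lastPair p)
  have hside := abs_kidSide_lt (lastPair p)
  obtain ⟨l, x, hl, hx⟩ := exists_eq_arcPt (m := m) ((kidMap m i p).1 0)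
  rw [h0] at hn
  have h3 : 0.475 < |(kidPlane (lastPair p)).re| := by
    refine lt_of_pow_lt_pow_left₀ 2 (abs_nonneg _) ?_
    rw [sq_abs]; nlinarith
  by_cases hp : kidParity l = kidParity i
  · have := offset_eq_of_parity_eq hp hl (by linarith)
    rw [← this] at h3
    linarith
  · refine h ⟨l, ?_, x, hl, ?_⟩
    · cases h4 : kidParity l <;> cases h5 : kidParity i <;> simp_all
    · rw [Bool.not_not, coordAt_kidMap_self]
      have h6 : ((shrink p.2).im / 20) ^ 2 < 0.05 ^ 2 :=
          sq_lt_sq' (abs_lt.1 hside).1 (abs_lt.1 hside).2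
      have h7 : x ^ 2 ≤ 0.375 ^ 2 := by rw [← sq_abs]; gcongr
      linarith

lemma coordAt_ne_of_lt {p : ThickTorus m} {e : Bool} (hp : 1 < ‖p.2‖) (h0 : coordAt e p = 0) :
    1 < |coordAt (!e) p| := by
  have := Complex.norm_eq_sqrt_sq_add_sq p.2
  have h1 : ‖p.2‖ ≤ |coordAt (!e) p| := by
    refine (Complex.norm_le_abs_re_add_abs_im p.2).trans ?_
    cases e <;> simp_all [coordAt]
  linarith

lemma notMem_lid_of_lt {p : ThickTorus m} {e : Bool} (hp : 1 < ‖p.2‖) : p ∉ lid m e := by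
  rintro ⟨h0, l, -, x, -, h⟩
  have := coordAt_ne_of_lt hp h0
  have h2 := abs_lt_of_sq_add_le (add_comm (x ^ 2) _ ▸ h)
  linarith

lemma coordAt_ne_zero_of_notMem_wall {p : ThickTorus m} {e : Bool} (hp : 1 < ‖p.2‖)
    (h : p ∉ wall m e) : coordAt e p ≠ 0 := fun h0 =>
  (mem_wall_or_mem_lid h0).elim h (notMem_lid_of_lt hp)

end

section

open Filter Topology

variable {m : ℕ} {G : Type*} [Group G]

/-- The element `g` on the nonnegative half-line, and `1` on the negative one. -/
def halfStep (g : G) (t : ℝ) : G := if 0 ≤ t then g else 1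

lemma halfStep_of_nonneg {g : G} {t : ℝ} (h : 0 ≤ t) : halfStep g t = g := if_pos h

lemma halfStep_of_neg {g : G} {t : ℝ} (h : t < 0) : halfStep g t = 1 := if_neg h.not_ge

lemma eventuallyConst_halfStep {X : Type*} [TopologicalSpace X] {f : X → ℝ} {x : X} (g : G)
    (hf : ContinuousAt f x) (h : f x ≠ 0) : EventuallyConst (fun y => halfStep g (f y)) (𝓝 x) := by
  rw [eventuallyConst_iff_exists_eventuallyEq]
  rcases h.lt_or_gt with h | h
  · exact ⟨1, (hf.eventually (gt_mem_nhds h)).mono fun y hy => halfStep_of_neg hy⟩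
  · exact ⟨g, (hf.eventually (lt_mem_nhds h)).mono fun y hy => halfStep_of_nonneg (le_of_lt hy)⟩

/-- The domains of the charts of a stage; the chart `none` avoids both walls, and the chart `some e`
crosses the wall of parity `e`. -/
def chartDom (m : ℕ) : Option Bool → Set (ThickTorus m)
  | none => {p | ∀ e, p ∉ wall m e}
  | some e => {p | p ∉ lid m e ∧ p ∉ wall m (!e)}

/-- The jumps of the charts of a stage. -/
def chartFun (s : Bool → G) : Option Bool → ThickTorus m → G
  | none, _ => 1
  | some e, p => halfStep (s e) (coordAt e p)

/-- The jumps of the chart of the previous stage on the collar of a stage. -/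
def collarFun (s : Bool → G) (p : ThickTorus m) : G :=
    halfStep (s true) p.2.im * halfStep (s false) p.2.re

lemma isOpen_chartDom (κ : Option Bool) : IsOpen (chartDom m κ) := by
  cases κ with
  | none =>
    have : chartDom m none = ⋂ e, (wall m e)ᶜ := by ext; simp [chartDom]
    rw [this]
    exact isOpen_iInter_of_finite fun e => (isClosed_wall e).isOpen_compl
  | some e => exact (isClosed_lid e).isOpen_compl.inter (isClosed_wall _).isOpen_compl

lemma exists_mem_chartDom {p : ThickTorus m}
    (hp : ∀ (l : Fin (numKids m)) (q : ThickTorus m), ‖q.2‖ ≤ 1 → kidMap m l q ≠ p) :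
    ∃ κ, p ∈ chartDom m κ := by
  by_cases h : ∀ e, p ∉ wall m e
  · exact ⟨none, h⟩
  · push Not at h
    obtain ⟨e, he⟩ := h
    refine ⟨some e, fun hl => ?_, disjoint_wall he⟩
    obtain ⟨l, q, hq, hqp⟩ := mem_core_of_mem_wall_lid he hl
    exact hp l q hq hqp

lemma eventuallyConst_chartFun (s : Bool → G) (e : Bool) {p : ThickTorus m} (h : coordAt e p ≠ 0) :
    EventuallyConst (chartFun s (some e)) (𝓝 p) :=
  eventuallyConst_halfStep _ (continuous_coordAt e).continuousAt h

lemma coordAt_ne_zero_of_notMem {p : ThickTorus m} {e : Bool} (h : p ∉ wall m e)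
    (h' : p ∉ lid m e) :
    coordAt e p ≠ 0 := fun h0 => (mem_wall_or_mem_lid h0).elim h h'

lemma eventuallyConst_chartFun_mul_inv (s : Bool → G) {κ κ' : Option Bool} {p : ThickTorus m}
    (h : p ∈ chartDom m κ) (h' : p ∈ chartDom m κ') :
    EventuallyConst (fun q => chartFun s κ' q * (chartFun s κ q)⁻¹) (𝓝 p) := by
  by_cases hκ : κ' = κ
  · subst hκ
    simp only [mul_inv_cancel]
    exact .const _
  have key : ∀ κ₁ κ₂ : Option Bool, κ₁ ≠ κ₂ → p ∈ chartDom m κ₁ → p ∈ chartDom m κ₂ →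
      EventuallyConst (chartFun s κ₁) (𝓝 p) := by
    rintro (_ | e) (_ | e') hne h h'
    · exact absurd rfl hne
    · exact .const _
    · exact eventuallyConst_chartFun s e (coordAt_ne_zero_of_notMem (h' e) h.1)
    · have : e' = !e := by cases e <;> cases e' <;> simp_all
      subst this
      have h2 := h'.2
      rw [Bool.not_not] at h2
      exact eventuallyConst_chartFun s e (coordAt_ne_zero_of_notMem h2 h.1)
  exact (key _ _ hκ h' h).mul (key _ _ (Ne.symm hκ) h h').inv

lemma continuous_im_snd : Continuous fun q : ThickTorus m => q.2.im := by fun_prop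

lemma continuous_re_snd : Continuous fun q : ThickTorus m => q.2.re := by fun_prop

/-- On the collar, the chart functions compare with those of the previous stage. -/
lemma collar_cases (s : Bool → G) {κ : Option Bool} {p : ThickTorus m} (hp : 1 < ‖p.2‖)
    (h : p ∈ chartDom m κ) :
    (p.2.im ≠ 0 ∧ EventuallyConst (fun q => chartFun s κ q * (collarFun s q)⁻¹) (𝓝 p)) ∨
      (p.2.im = 0 ∧ p.2.re ≠ 0 ∧ (fun q => chartFun s κ q * (collarFun s q)⁻¹) =ᶠ[𝓝 p]
        fun q => halfStep (s true) q.2.im * (halfStep (s false) p.2.re)⁻¹ * (halfStep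
            (s true) q.2.im)⁻¹) := by
  have hz : p.2.im ≠ 0 → EventuallyConst (fun q : ThickTorus m => halfStep (s true) q.2.im) (𝓝 p) :=
    fun h => eventuallyConst_halfStep _ continuous_im_snd.continuousAt h
  have hy : p.2.re ≠ 0 → EventuallyConst (fun q : ThickTorus m => halfStep (s false) q.2.re)
      (𝓝 p) :=
    fun h => eventuallyConst_halfStep _ continuous_re_snd.continuousAt h
  match κ, h with
  | none, h =>
    have h1 := coordAt_ne_zero_of_notMem_wall hp (h true)
    have h2 := coordAt_ne_zero_of_notMem_wall hp (h false)
    exact Or.inl ⟨h1, (EventuallyConst.const (1 : G)).mul ((hz h1).mul (hy h2)).inv⟩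
  | some false, h =>
    left
    have h1 : p.2.im ≠ 0 := coordAt_ne_zero_of_notMem_wall hp h.2
    have : (fun q : ThickTorus m => chartFun s (some false) q * (collarFun s q)⁻¹) =
        fun q => (halfStep (s true) q.2.im)⁻¹ := by
      funext q
      simp [chartFun, collarFun, coordAt]
    refine ⟨h1, ?_⟩
    rw [this]
    exact (hz h1).inv
  | some true, h =>
    have h1 : p.2.re ≠ 0 := coordAt_ne_zero_of_notMem_wall hp h.2
    by_cases h2 : p.2.im = 0
    · refine Or.inr ⟨h2, h1, ?_⟩
      obtain ⟨c, hc⟩ := eventuallyConst_iff_exists_eventuallyEq.1 (hy h1)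
      have hcp := hc.self_of_nhds
      filter_upwards [hc] with q hq
      simp only at hq hcp
      simp [chartFun, collarFun, coordAt, mul_assoc, hq, hcp]
    · exact Or.inl ⟨h2, (hz h2).mul ((hz h2).mul (hy h1)).inv⟩

lemma eventuallyConst_collar_of_const (g : G) {κ : Option Bool} {p : ThickTorus m} (hp : 1 < ‖p.2‖)
    (h : p ∈ chartDom m κ) :
    EventuallyConst (fun q => chartFun (fun _ => g) κ q * (collarFun (fun _ => g) q)⁻¹) (𝓝 p) := by
  rcases collar_cases (fun _ => g) hp h with ⟨-, h⟩ | ⟨-, -, h⟩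
  · exact h
  · rw [eventuallyConst_iff_exists_eventuallyEq]
    refine ⟨(halfStep g p.2.re)⁻¹, h.mono fun q hq => hq.trans ?_⟩
    by_cases h1 : 0 ≤ p.2.re <;> by_cases h2 : 0 ≤ q.2.im <;> simp [halfStep, h1, h2]

lemma chartFun_kidMap_cases (s : Bool →
    G) {i : Fin (numKids m)} {κ : Option Bool} {p : ThickTorus m}
    (h : kidMap m i p ∈ chartDom m κ) :
    (EventuallyConst (fun q => chartFun s κ (kidMap m i q)) (𝓝 p) ∧ ¬ (p.2.im = 0 ∧ 0 ≤ p.2.re)) ∨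
      ((∀ q, chartFun s κ (kidMap m i q) = halfStep (s (kidParity i)) q.2.im) ∧
        ¬ (p.2.im = 0 ∧ p.2.re ≤ 0)) := by
  match κ, h with
  | none, h => exact Or.inl ⟨.const _, (kidMap_mem_wall_iff i p).not.1 (h _)⟩
  | some e, h =>
    by_cases he : e = kidParity i
    · subst he
      refine Or.inr ⟨fun q => ?_, (kidMap_mem_lid_iff i p).not.1 h.1⟩
      have := coordAt_kidMap_nonneg_iff i q
      simp only [chartFun, halfStep, this]
    · have he' : e = !kidParity i := by cases e <;> cases h : kidParity i <;> simp_all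
      subst he'
      have h2 := h.2
      rw [Bool.not_not] at h2
      refine Or.inl ⟨?_, (kidMap_mem_wall_iff i p).not.1 h2⟩
      exact (eventuallyConst_chartFun s _
        (coordAt_ne_zero_of_notMem (kidMap_notMem_wall_not i p) h.1)).comp_tendsto
          (isOpenEmbedding_kidMap i).continuous.continuousAt

/-- The relation between the permutations of a stage and of its child makes the transition
functions locally constant. -/
lemma eventuallyConst_collar_kidMap (s s' : Bool → G) {i : Fin (numKids m)}
    (hs : s' true = s (kidParity i)) (hs' : s' false * s' true = s' true * s' true * s' false)
    {κ κ' : Option Bool} {p : ThickTorus m} (hp : 1 < ‖p.2‖) (h : kidMap m i p ∈ chartDom m κ)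
    (h' : p ∈ chartDom m κ') :
    EventuallyConst (fun q => chartFun s' κ' q * (collarFun s' q)⁻¹ *
      (chartFun s κ (kidMap m i q))⁻¹) (𝓝 p) := by
  rcases collar_cases s' hp h' with ⟨hz, h1⟩ | ⟨hz, hy, h1⟩
  · rcases chartFun_kidMap_cases s h with ⟨h2, -⟩ | ⟨h2, h3⟩
    · exact h1.mul h2.inv
    · simp only [h2]
      exact h1.mul (eventuallyConst_halfStep _ continuous_im_snd.continuousAt hz).inv
  · rcases chartFun_kidMap_cases s h with ⟨h2, h3⟩ | ⟨h2, h3⟩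
    · refine EventuallyConst.mul ?_ h2.inv
      have hy' : p.2.re < 0 := by by_contra! h4; exact h3 ⟨hz, h4⟩
      rw [eventuallyConst_iff_exists_eventuallyEq]
      refine ⟨1, h1.mono fun q hq => hq.trans ?_⟩
      rw [halfStep_of_neg hy']; group
    · have hy' : 0 ≤ p.2.re := by by_contra! h4; exact h3 ⟨hz, h4.le⟩
      rw [eventuallyConst_iff_exists_eventuallyEq]
      refine ⟨(s' false)⁻¹, h1.mono fun q hq => ?_⟩
      simp only at hq
      simp only [hq, h2, ← hs, halfStep_of_nonneg hy']
      unfold halfStep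
      split_ifs
      · rw [← inv_inj]
        simp only [mul_inv_rev, inv_inv]
        rw [← mul_assoc, ← mul_assoc, ← hs', mul_inv_cancel_right]
      · simp

end

section

open Filter Topology

section Lift

variable {Y S ι : Type*} [TopologicalSpace Y]

/-- The bundle with discrete fiber `S` defined by a family of permutations whose ratios are locally
constant. -/
def gaugeBundle [TopologicalSpace S] [DiscreteTopology S] (U : ι → Set Y) (hU : ∀ i, IsOpen (U i))
    (k : Y → ι) (hk : ∀ y, y ∈ U (k y)) (g : ι → Y → Equiv.Perm S)
    (hg : ∀ i j, ∀ y ∈ U i ∩ U j, EventuallyConst (fun x => g j x * (g i x)⁻¹) (𝓝 y)) :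
    FiberBundleCore ι Y S where
  baseSet := U
  isOpen_baseSet := hU
  indexAt := k
  mem_baseSet_at := hk
  coordChange i j y s := (g j y * (g i y)⁻¹) s
  coordChange_self i y _ s := by simp
  continuousOn_coordChange i j := by
    rintro ⟨y, s⟩ ⟨hy, -⟩
    obtain ⟨c, hc⟩ := eventuallyConst_iff_exists_eventuallyEq.1 (hg i j y hy)
    have h1 : ContinuousAt (fun q : Y × S => c q.2) (y, s) :=
      (continuous_of_discreteTopology (f := c)).continuousAt.comp continuous_snd.continuousAt
    refine (h1.congr ?_).continuousWithinAt
    have h2 : Tendsto Prod.fst (𝓝 (y, s)) (𝓝 y) := continuous_fst.continuousAt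
    filter_upwards [h2.eventually hc] with q hq
    rw [hq]
  coordChange_comp i j l y _ s := by simp

open FundamentalGroup in
/-- If the fundamental group is generated by loops in the domain of one chart, then the
bundle defined by a family of gauges has a flat section. -/
theorem exists_flat_section [PathConnectedSpace Y] [LocallyPathConnectedSpace Y] [Nonempty S]
    (U : ι → Set Y) (hU : ∀ i, IsOpen (U i)) (hcov : ∀ y, ∃ i, y ∈ U i) (g : ι → Y → Equiv.Perm S)
    (hg : ∀ i j, ∀ y ∈ U i ∩ U j, EventuallyConst (fun x => g j x * (g i x)⁻¹) (𝓝 y))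
    {y₀ : Y} {i₀ : ι} (hy₀ : y₀ ∈ U i₀) (T : Set (Path y₀ y₀)) (hTU : ∀ γ ∈ T, ∀ t, γ t ∈ U i₀)
    (hT : Subgroup.closure ((fun γ => fromPath (Path.Homotopic.Quotient.mk γ)) '' T) = ⊤) :
    ∃ τ : Y → S, ∀ i, ∀ y ∈ U i, EventuallyConst (fun x => g i x (τ x)) (𝓝 y) := by
  choose k hk using hcov
  let _ : TopologicalSpace S := ⊥
  have : DiscreteTopology S := ⟨rfl⟩
  let Z := gaugeBundle U hU k hk g hg
  have cov : IsCoveringMap Z.proj := FiberBundle.isCoveringMap (F := S) (E := Z.Fiber)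
  obtain ⟨s⟩ := ‹Nonempty S›
  have hsec : ContinuousOn (fun y => (Z.localTriv i₀).toOpenPartialHomeomorph.symm (y, s))
      (U i₀) := by
    refine (Z.localTriv i₀).continuousOn_invFun.comp (by fun_prop) fun y hy => ?_
    exact (Z.mem_localTriv_target i₀ (y, s)).2 hy
  have hproj : ∀ y ∈ U i₀, Z.proj ((Z.localTriv i₀).toOpenPartialHomeomorph.symm (y, s)) = y :=
      fun y hy =>
    (Z.localTriv i₀).proj_symm_apply ((Z.mem_localTriv_target i₀ (y, s)).2 hy)
  set e₀ : Z.TotalSpace := (Z.localTriv i₀).toOpenPartialHomeomorph.symm (y₀, s) with he₀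
  have he : Z.proj e₀ = (ContinuousMap.id Y) y₀ := hproj y₀ hy₀
  obtain ⟨F, ⟨-, hF⟩, -⟩ := cov.existsUnique_continuousMap_lifts_of_range_le
    (f := ContinuousMap.id Y) he (by
      refine le_trans le_top ?_
      refine hT.symm.trans_le ((Subgroup.closure_le _).2 ?_)
      rintro _ ⟨γ, hγ, rfl⟩
      let Γ : Path e₀ e₀ :=
        { toFun := fun t => (Z.localTriv i₀).toOpenPartialHomeomorph.symm (γ t, s)
          continuous_toFun := hsec.comp_continuous γ.continuous (hTU γ hγ)
          source' := by rw [γ.source]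
          target' := by rw [γ.target] }
      refine ⟨fromPath (Path.Homotopic.Quotient.mk Γ), ?_⟩
      rw [mapOfEq_apply]
      change Path.Homotopic.Quotient.mk _ = Path.Homotopic.Quotient.mk _
      congr 1)
  refine ⟨fun y => (g (k y) y)⁻¹ (F y).2, fun i y hy => ?_⟩
  have hFp : ∀ x, (F x).1 = x := fun x => congrFun hF x
  have h1 : ContinuousAt (fun x => (Z.localTriv i (F x)).2) y :=
    continuous_snd.continuousAt.comp (((Z.localTriv i).continuousAt (by
      rw [Z.mem_localTriv_source]
      exact (hFp y).symm ▸ hy)).comp F.continuous.continuousAt)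
  have h2 : ∀ᶠ x in 𝓝 y, (Z.localTriv i (F x)).2 = (Z.localTriv i (F y)).2 :=
    h1.eventually (p := fun c => c = (Z.localTriv i (F y)).2) ((isOpen_discrete {_}).mem_nhds rfl)
  rw [eventuallyConst_iff_exists_eventuallyEq]
  refine ⟨(Z.localTriv i (F y)).2, h2.mono fun x hx => ?_⟩
  rw [← hx]
  change g i x ((g (k x) x)⁻¹ (F x).2) = (g i (F x).1 * (g (k (F x).1) (F x).1)⁻¹) (F x).2
  rw [hFp x]
  rfl

end Lift

end

section

open Filter Topology

variable {m : ℕ} {X : Type*} {J : ThickTorus m → X}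

/-- The part of the domain of a chart of a stage that avoids the children. -/
def nodeDom (m : ℕ) (κ : Option Bool) : Set (ThickTorus m) :=
  {p | p ∈ chartDom m κ ∧ ∀ (i : Fin (numKids m)) (q : ThickTorus m), ‖q.2‖ ≤ 1 → kidMap m i q ≠ p}

/-- The gauge of a chart of a stage. -/
def nodeGauge {G : Type*} [Group G] (s : Bool → G) (κ : Option Bool) (p : ThickTorus m) : G :=
  chartFun s κ p * if 1 < ‖p.2‖ then (collarFun s p)⁻¹ else 1

/-- The indices of the charts. -/
abbrev ChartIdx (m : ℕ) : Type := Option (List (Fin (numKids m)) × Option Bool)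

/-- The domains of the charts covering the complement of the intersection of the stages. -/
def gaugeDom (J : ThickTorus m → X) : ChartIdx m → Set X
  | none => (J '' {p | ‖p.2‖ ≤ 1})ᶜ
  | some i => J ∘ kidWord m i.1 '' nodeDom m i.2

/-- The gauges of the charts covering the complement of the intersection of the stages. -/
def gaugeFun (J : ThickTorus m → X) : ChartIdx m → X → Equiv.Perm (ℤ × ℕ)
  | none, _ => 1
  | some i, x => nodeGauge (stageState i.1) i.2 (Function.invFun (J ∘ kidWord m i.1) x)

lemma isOpen_nodeDom (κ : Option Bool) : IsOpen (nodeDom m κ) := by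
  have : nodeDom m κ = chartDom m κ ∩ (⋃ i, kidMap m i '' {q | ‖q.2‖ ≤ 1})ᶜ := by
    ext p
    simp [nodeDom]
  rw [this]
  exact (isOpen_chartDom κ).inter (isCompact_iUnion fun i =>
    (isCompact_norm_le 1).image (isOpenEmbedding_kidMap i).continuous).isClosed.isOpen_compl

lemma gaugeFun_apply (hJ : Function.Injective J) (w : List (Fin (numKids m))) (κ : Option Bool)
    (p : ThickTorus m) :
    gaugeFun J (some (w, κ)) (J (kidWord m w p)) = nodeGauge (stageState w) κ p := by
  have := Function.leftInverse_invFun (hJ.comp (isOpenEmbedding_kidWord w).injective) p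
  simp only [Function.comp_apply] at this
  simp only [gaugeFun, this]

lemma nodeGauge_of_le {G : Type*} [Group G] (s : Bool → G) (κ : Option Bool) {p : ThickTorus m}
    (h : ‖p.2‖ ≤ 1) : nodeGauge s κ p = chartFun s κ p := by
  rw [nodeGauge, if_neg h.not_gt, mul_one]

lemma norm_kidMap_le_one (i : Fin (numKids m)) (p : ThickTorus m) : ‖(kidMap m i p).2‖ ≤ 1 :=
  (norm_kidMap_le i p).trans (by norm_num)

variable [TopologicalSpace X] [T2Space X]

lemma isOpen_gaugeDom (hJ : IsOpenEmbedding J) (i : ChartIdx m) : IsOpen (gaugeDom J i) := by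
  cases i with
  | none => exact ((isCompact_norm_le 1).image hJ.continuous).isClosed.isOpen_compl
  | some i => exact (hJ.comp (isOpenEmbedding_kidWord _)).isOpenMap _ (isOpen_nodeDom _)

omit [TopologicalSpace X] [T2Space X] in
lemma exists_mem_gaugeDom {x : X} (hx : x ∉ towerSet J) : ∃ i, x ∈ gaugeDom J i := by
  by_cases h0 : x ∈ J '' {p | ‖p.2‖ ≤ 1}
  · let P : ℕ → Prop := fun j => ∃ w : List (Fin (numKids m)), w.length = j ∧
      x ∈ J ∘ kidWord m w '' {p | ‖p.2‖ ≤ 1}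
    have hP0 : P 0 := ⟨[], rfl, by simpa using h0⟩
    have hP : ¬ ∀ j, P j := by
      intro h
      refine hx fun j => ?_
      obtain ⟨w, hw, hxw⟩ := h j
      exact ⟨w, hw, image_subset_range _ _ hxw⟩
    have : ∃ j, P j ∧ ¬ P (j + 1) := by
      by_contra! h
      exact hP fun j => Nat.rec hP0 h j
    obtain ⟨j, ⟨w, hw, p, hp, rfl⟩, hj⟩ := this
    have hkid : ∀ (i : Fin (numKids m)) (q : ThickTorus m), ‖q.2‖ ≤ 1 → kidMap m i q ≠ p := by
      rintro i q hq rfl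
      refine hj ⟨w ++ [i], by simp [hw], q, hq, ?_⟩
      simp only [Function.comp_apply, range_kidWord_concat_subset]
    obtain ⟨κ, hκ⟩ := exists_mem_chartDom hkid
    exact ⟨some (w, κ), p, ⟨hκ, hkid⟩, rfl⟩
  · exact ⟨none, h0⟩

omit [T2Space X] in
lemma eventuallyConst_nhds_iff {X' α : Type*} [TopologicalSpace X'] {J : X' → X}
    (hJ : IsOpenEmbedding J) {f : X → α} {p : X'} :
    EventuallyConst f (𝓝 (J p)) ↔ EventuallyConst (f ∘ J) (𝓝 p) := by
  rw [← hJ.map_nhds_eq, EventuallyConst, EventuallyConst, map_map]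

omit [T2Space X] in
lemma eventuallyConst_mul_inv_symm {G : Type*} [Group G] {f g : X → G} {x : X}
    (h : EventuallyConst (fun y => f y * (g y)⁻¹) (𝓝 x)) :
    EventuallyConst (fun y => g y * (f y)⁻¹) (𝓝 x) :=
  h.inv.congr (.of_forall fun y => by simp)

omit [T2Space X] in
theorem eventuallyConst_gauge (hJ : IsOpenEmbedding J) (i j : ChartIdx m) {x : X}
    (hx : x ∈ gaugeDom J i ∩ gaugeDom J j) :
    EventuallyConst (fun y => gaugeFun J j y * (gaugeFun J i y)⁻¹) (𝓝 x) := by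
  have hout : ∀ (w : List (Fin (numKids m))) (κ : Option Bool),
      ∀ x ∈ gaugeDom J none ∩ gaugeDom J (some (w, κ)),
      EventuallyConst (fun y => gaugeFun J (some (w, κ)) y * (gaugeFun J none y)⁻¹) (𝓝 x) := by
    rintro w κ _ ⟨h0, p, hp, rfl⟩
    cases w with
    | cons i w => exact absurd (mem_image_of_mem J (norm_kidMap_le_one i _)) h0
    | nil =>
      have hp1 : 1 < ‖p.2‖ := by
        by_contra! h
        exact h0 ⟨p, h, rfl⟩
      rw [eventuallyConst_nhds_iff (hJ.comp (isOpenEmbedding_kidWord _))]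
      refine (eventuallyConst_collar_of_const stdShift hp1 hp.1).congr ?_
      have : ∀ᶠ q : ThickTorus m in 𝓝 p, 1 < ‖q.2‖ :=
        (continuous_norm.comp continuous_snd).continuousAt.eventually (lt_mem_nhds hp1)
      filter_upwards [this] with q hq
      rw [Function.comp_apply, Function.comp_apply, gaugeFun_apply hJ.injective, nodeGauge,
          if_pos hq]
      simp [gaugeFun]; rfl
  have hin : ∀ (w : List (Fin (numKids m))) (κ : Option Bool) (w' : List (Fin (numKids m)))
      (κ' : Option Bool),
      w.length ≤ w'.length → ∀ x ∈ gaugeDom J (some (w, κ)) ∩ gaugeDom J (some (w', κ')),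
      EventuallyConst (fun y => gaugeFun J (some (w', κ')) y * (gaugeFun J (some (w, κ)) y)⁻¹)
          (𝓝 x) := by
    rintro w κ w' κ' hl x ⟨⟨p, hp, rfl⟩, p', hp', hpp⟩
    obtain ⟨u, rfl⟩ := exists_append_of_mem_tube hJ.injective hl ⟨p', hpp⟩ ⟨p, rfl⟩
    have hpu : kidWord m u p' = p := by
      rw [kidWord_append] at hpp
      exact (hJ.comp (isOpenEmbedding_kidWord w)).injective hpp
    match u, hpu with
    | [], hpu =>
      rw [List.append_nil] at *
      change p' = p at hpu
      subst hpu
      rw [eventuallyConst_nhds_iff (hJ.comp (isOpenEmbedding_kidWord _))]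
      refine (eventuallyConst_chartFun_mul_inv (stageState w) hp.1 hp'.1).congr
        (.of_forall fun q => ?_)
      simp only [Function.comp_apply]
      rw [gaugeFun_apply hJ.injective, gaugeFun_apply hJ.injective]
      by_cases h : 1 < ‖q.2‖ <;> simp [nodeGauge, h]
    | [i], hpu =>
      change kidMap m i p' = p at hpu
      subst hpu
      have hp1 : 1 < ‖p'.2‖ := by
        by_contra! h
        exact hp.2 i p' h rfl
      rw [← hpp, eventuallyConst_nhds_iff (hJ.comp (isOpenEmbedding_kidWord _))]
      refine (eventuallyConst_collar_kidMap (stageState w) (stageState (w ++ [i])) (i := i) ?_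
        (stageState_concat_mul w i) hp1 hp.1 hp'.1).congr ?_
      · rw [stageState_concat, if_pos rfl]; rfl
      have : ∀ᶠ q : ThickTorus m in 𝓝 p', 1 < ‖q.2‖ :=
        (continuous_norm.comp continuous_snd).continuousAt.eventually (lt_mem_nhds hp1)
      filter_upwards [this] with q hq
      simp only [Function.comp_apply]
      rw [gaugeFun_apply hJ.injective, nodeGauge, if_pos hq, range_kidWord_concat_subset,
        gaugeFun_apply hJ.injective, nodeGauge_of_le _ _ (norm_kidMap_le_one i q)]
    | i :: l :: u, hpu =>
      exact absurd hpu (hp.2 i (kidWord m (l :: u) p') (norm_kidMap_le_one l _))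
  match i, j, hx with
  | none, none, _ => simp [gaugeFun]
  | none, some (w, κ), hx => exact hout w κ x hx
  | some (w, κ), none, hx => exact eventuallyConst_mul_inv_symm (hout w κ x hx.symm)
  | some (w, κ), some (w', κ'), hx =>
    rcases le_total w.length w'.length with h | h
    · exact hin w κ w' κ' h x hx
    · exact eventuallyConst_mul_inv_symm (hin w' κ' w κ h x hx.symm)

/-- The angle of a complex number, measured in turns from `0` to `1`. -/
def turns (z : ℂ) : ℝ := z.arg / (2 * Real.pi) + if z.im < 0 then 1 else 0

lemma turns_eq_of_re_neg {z : ℂ} (hz : z.re < 0) :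
    turns z = ((-z).arg + Real.pi) / (2 * Real.pi) := by
  have := Real.pi_pos
  unfold turns
  split_ifs with h
  · rw [Complex.arg_neg_eq_arg_add_pi_of_im_neg h]; field_simp; ring
  · have h2 : (-z).arg = z.arg - Real.pi := by
      rw [Complex.arg_neg_eq_arg_sub_pi_iff]
      rcases (not_lt.1 h).eq_or_lt with h | h
      · exact Or.inr ⟨h.symm, hz⟩
      · exact Or.inl h
    rw [h2]; field_simp; ring

lemma exp_turns_sub {z : ℂ} (hz : z ≠ 0) (k : ℤ) :
    Complex.exp (2 * Real.pi * ((turns z - k : ℝ) : ℂ) * Complex.I) = z / ‖z‖ := by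
  have h1 : ∃ l : ℤ, turns z - k = z.arg / (2 * Real.pi) + l := by
    unfold turns
    split_ifs
    · exact ⟨1 - k, by push_cast; ring⟩
    · exact ⟨-k, by push_cast; ring⟩
  obtain ⟨l, hl⟩ := h1
  have hpi : (Real.pi : ℂ) ≠ 0 := by exact_mod_cast Real.pi_ne_zero
  have h2 : (2 * Real.pi * ((turns z - k : ℝ) : ℂ) * Complex.I) =
      z.arg * Complex.I + l * (2 * Real.pi * Complex.I) := by
    rw [hl]; push_cast; field_simp
  rw [h2, Complex.exp_add, Complex.exp_int_mul_two_pi_mul_I, mul_one, eq_div_iff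
    (by exact_mod_cast norm_ne_zero_iff.2 hz), mul_comm, Complex.norm_mul_exp_arg_mul_I]

/-- The first child of the first stage. -/
def legMap (J : ThickTorus m → X) : ThickTorus m → X := J ∘ kidMap m 0

omit [T2Space X] in
/-- The winding function of a flat section over the leg. -/
theorem exists_winding (hJ : IsOpenEmbedding J) {Y : Type*} [TopologicalSpace Y] {f : Y → X}
    (hf : Continuous f) {τ : Y → ℤ × ℕ}
    (hτ : ∀ i, ∀ y, f y ∈ gaugeDom J i → EventuallyConst (fun x => gaugeFun J i (f x) (τ x))
        (𝓝 y)) :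
    ∃ t : Y → ℝ, ∀ y p, p ∈ legSet m → f y = legMap J p → ContinuousAt t y ∧
      Complex.exp (2 * Real.pi * (t y : ℂ) * Complex.I) = p.2 / ‖p.2‖ := by
  have hL : IsOpenEmbedding (legMap J) := hJ.comp (isOpenEmbedding_kidMap 0)
  let z : Y → ℂ := fun y => (Function.invFun (legMap J) (f y)).2
  have hz : ∀ {y p}, f y = legMap J p → z y = p.2 := fun {y p} h => by
    simp only [z, h, Function.leftInverse_invFun hL.injective p]
  have hzc : ∀ {y p}, f y = legMap J p → ContinuousAt z y := fun {y p} h => by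
    refine continuous_snd.continuousAt.comp (ContinuousAt.comp (g :=
        Function.invFun (legMap J)) ?_ hf.continuousAt)
    rw [h, ContinuousAt, ← hL.map_nhds_eq, tendsto_map'_iff]
    have : Function.invFun (legMap J) ∘ legMap J = id :=
        funext (Function.leftInverse_invFun hL.injective)
    rw [this, Function.leftInverse_invFun hL.injective]
    exact tendsto_id
  refine ⟨fun y => turns (z y) - (τ y).1, fun y p hp h => ⟨?_, ?_⟩⟩
  · have hp1 : 1 < ‖p.2‖ := hp.2
    have hkid : ∀ (i : Fin (numKids m)) (q : ThickTorus m), ‖q.2‖ ≤ 1 →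
        kidMap m i q ≠ kidMap m 0 p := by
      intro i q hq he
      obtain ⟨-, rfl⟩ := kidMap_eq_iff.1 he
      exact absurd hq hp1.not_ge
    have hev : ∀ᶠ x in 𝓝 y, ∃ q, f x = legMap J q :=
      (hf.continuousAt.eventually (hL.isOpen_range.mem_nhds (h ▸ mem_range_self p))).mono
        fun x ⟨q, hq⟩ => ⟨q, hq.symm⟩
    have hgauge : ∀ κ q, gaugeFun J (some ([], κ)) (legMap J q) = chartFun (stageState (m :=
        m) []) κ (kidMap m 0 q) := by
      intro κ q
      rw [← nodeGauge_of_le _ _ (norm_kidMap_le_one 0 q), ← gaugeFun_apply hJ.injective]; rfl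
    have hmem : ∀ κ, kidMap m 0 p ∈ chartDom m κ → f y ∈ gaugeDom J (some ([], κ)) := fun κ hκ =>
      ⟨kidMap m 0 p, ⟨hκ, hkid⟩, h.symm⟩
    have hpar : kidParity (0 : Fin (numKids m)) = true := by simp [kidParity]
    by_cases hcase : p.2.im = 0 ∧ p.2.re ≤ 0
    · have hre : p.2.re < 0 := by
        refine hcase.2.lt_of_ne fun h0 => ?_
        have : p.2 = 0 := Complex.ext h0 hcase.1
        rw [this] at hp1; norm_num at hp1
      have hdom : kidMap m 0 p ∈ chartDom m none := by
        rintro (_ | _)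
        · have := kidMap_notMem_wall_not (0 : Fin (numKids m)) p
          rwa [hpar] at this
        · have := (kidMap_mem_wall_iff (0 : Fin (numKids m)) p).not.2 fun h => h.2.not_gt hre
          rwa [hpar] at this
      obtain ⟨c, hc⟩ := eventuallyConst_iff_exists_eventuallyEq.1 (hτ _ y (hmem none hdom))
      have h1 : ContinuousAt (fun x => ((-z x).arg + Real.pi) / (2 * Real.pi) - c.1) y := by
        have : ContinuousAt (fun x => (-z x).arg) y := by
          refine ContinuousAt.comp (g := Complex.arg) (Complex.continuousAt_arg ?_) (hzc h).neg
          rw [hz h]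
          exact Or.inl (by simpa using hre)
        fun_prop
      refine h1.congr ?_
      have h2 : ∀ᶠ x in 𝓝 y, (z x).re < 0 :=
        (Complex.continuous_re.continuousAt.comp (hzc h)).eventually (gt_mem_nhds (by
          rw [Function.comp_apply, hz h]; exact hre))
      filter_upwards [hev, hc, h2] with x ⟨q, hq⟩ hx hx2
      rw [hq, hgauge] at hx
      simp only [chartFun, Equiv.Perm.one_apply] at hx
      rw [turns_eq_of_re_neg hx2, hx]
    · have hdom : kidMap m 0 p ∈ chartDom m (some true) := by
        refine ⟨?_, ?_⟩
        · have := (kidMap_mem_lid_iff (0 : Fin (numKids m)) p).not.2 hcase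
          rwa [hpar] at this
        · have := kidMap_notMem_wall_not (0 : Fin (numKids m)) p
          rwa [hpar] at this
      obtain ⟨c, hc⟩ := eventuallyConst_iff_exists_eventuallyEq.1 (hτ _ y (hmem _ hdom))
      have h1 : ContinuousAt (fun x => (z x).arg / (2 * Real.pi) + 1 - c.1) y := by
        have : ContinuousAt (fun x => (z x).arg) y := by
          refine ContinuousAt.comp (g := Complex.arg) (Complex.continuousAt_arg ?_) (hzc h)
          rw [hz h, Complex.mem_slitPlane_iff]
          by_contra! h3
          exact hcase ⟨h3.2, h3.1⟩
        fun_prop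
      refine h1.congr ?_
      filter_upwards [hev, hc] with x ⟨q, hq⟩ hx
      rw [hq, hgauge] at hx
      have h4 := coordAt_kidMap_nonneg_iff (0 : Fin (numKids m)) q
      rw [hpar] at h4
      simp only [chartFun, halfStep, h4] at hx
      rw [hz hq, turns]
      by_cases h5 : 0 ≤ q.2.im
      · rw [if_pos h5] at hx
        rw [if_neg h5.not_gt, ← hx]
        simp [stdShift]
      · rw [if_neg h5] at hx
        rw [if_pos (not_le.1 h5), ← hx]
        simp
  · rw [exp_turns_sub, hz h]
    rw [hz h]
    rintro h0
    have := hp.2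
    rw [h0] at this; norm_num at this

end

section

open Filter Topology

variable {m : ℕ} {X : Type*} {J : ThickTorus m → X}

/-- The address of length `j` all of whose letters are `0`. -/
abbrev zeroWord (m j : ℕ) : List (Fin (numKids m)) := List.replicate j 0

lemma zeroWord_add (j i : ℕ) : zeroWord m (j + i) = zeroWord m j ++ zeroWord m i :=
  List.replicate_add ..

lemma mem_towerSet_of_forall_zeroWord {x : X} (h : ∀ j, x ∈ tube J (zeroWord m j)) :
    x ∈ towerSet J := fun j => ⟨_, List.length_replicate, h j⟩

lemma towerSet_comp_kidWord_subset (w : List (Fin (numKids m))) :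
    towerSet (J ∘ kidWord m w) ⊆ towerSet J := by
  intro x hx j
  obtain ⟨u, hu, p, hp⟩ := hx j
  refine ⟨(w ++ u).take j, by simp [hu], ?_⟩
  have : x ∈ tube J (w ++ u) := ⟨p, by rw [kidWord_append]; exact hp⟩
  rw [← List.take_append_drop j (w ++ u)] at this
  exact tube_append_subset _ _ this

variable [TopologicalSpace X] [T2Space X]

lemma exists_disjoint_tube_zeroWord (hJ : Continuous J) {K : Set X} (hK : IsCompact K)
    (hd : Disjoint K (towerSet J)) : ∃ j, Disjoint K (tube J (zeroWord m j)) := by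
  by_contra! h
  have hne : ∀ j, (K ∩ J ∘ kidWord m (zeroWord m j) '' hullSet m).Nonempty := by
    intro j
    obtain ⟨x, hx, hx'⟩ := not_disjoint_iff.1 (h (j + 1))
    rw [zeroWord_add] at hx'
    exact ⟨x, hx, tube_concat_subset _ _ hx'⟩
  obtain ⟨x, hx⟩ := IsCompact.nonempty_iInter_of_sequence_nonempty_isCompact_isClosed _
    (fun j => inter_subset_inter_right K (by
      rw [zeroWord_add]
      exact (image_hull_subset _).trans (tube_concat_subset _ _))) hne
    (hK.inter_right (isCompact_image_hull hJ _).isClosed)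
    (fun j => hK.isClosed.inter (isCompact_image_hull hJ _).isClosed)
  rw [mem_iInter] at hx
  exact disjoint_left.1 hd (hx 0).1
    (mem_towerSet_of_forall_zeroWord fun j => image_hull_subset _ (hx j).2)

/-- A map from a space with finitely generated fundamental group to the complement of the
intersection of the stages unwinds deep legs. -/
theorem exists_winding_of_fg (hJ : IsOpenEmbedding J) {Y : Type*} [TopologicalSpace Y]
    [PathConnectedSpace Y] [LocallyPathConnectedSpace Y] {y₀ : Y}
    (hfg : Group.FG (FundamentalGroup Y y₀)) {f : Y → X} (hf : Continuous f)
    (hA : ∀ y, f y ∉ towerSet J) :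
    ∃ j, ∃ t : Y → ℝ, ∀ y p, p ∈ legSet m → f y = legMap (J ∘ kidWord m (zeroWord m j)) p →
      ContinuousAt t y ∧ Complex.exp (2 * Real.pi * (t y : ℂ) * Complex.I) = p.2 / ‖p.2‖ := by
  obtain ⟨S, hS, hSf⟩ := (Group.fg_iff).1 hfg
  let P : FundamentalGroup Y y₀ → Path y₀ y₀ := fun g => (FundamentalGroup.toPath g).out
  have hP : ∀ g, FundamentalGroup.fromPath (Path.Homotopic.Quotient.mk (P g)) = g := fun g =>
    Quotient.out_eq (FundamentalGroup.toPath g)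
  let K : Set X := {f y₀} ∪ ⋃ g ∈ S, f '' range (P g)
  have hK : IsCompact K := isCompact_singleton.union
    (hSf.isCompact_biUnion fun g _ => (isCompact_range (P g).continuous).image hf)
  have hd : Disjoint K (towerSet J) := by
    rw [disjoint_left]
    rintro x (rfl | hx)
    · exact hA _
    · simp only [mem_iUnion] at hx
      obtain ⟨g, -, y, -, rfl⟩ := hx
      exact hA _
  obtain ⟨j, hj⟩ := exists_disjoint_tube_zeroWord hJ.continuous hK hd
  refine ⟨j, ?_⟩
  set J' := J ∘ kidWord m (zeroWord m j)
  have hJ' : IsOpenEmbedding J' := hJ.comp (isOpenEmbedding_kidWord _)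
  have hnone : ∀ x ∈ K, x ∈ gaugeDom J' none := fun x hx hx' =>
    disjoint_left.1 hj hx (image_subset_range _ _ hx')
  obtain ⟨τ, hτ⟩ := exists_flat_section (S := ℤ × ℕ) (fun i => f ⁻¹' gaugeDom J' i)
    (fun i => (isOpen_gaugeDom hJ' i).preimage hf)
    (fun y => exists_mem_gaugeDom fun h => hA y (towerSet_comp_kidWord_subset _ h))
    (fun i y => gaugeFun J' i (f y))
    (fun i k y hy => (eventuallyConst_gauge hJ' i k hy).comp_tendsto hf.continuousAt)
    (i₀ := none) (hnone _ (Or.inl rfl)) (P '' S)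
    (by
      rintro _ ⟨g, hg, rfl⟩ t
      exact hnone _ (Or.inr (mem_biUnion hg ⟨_, mem_range_self t, rfl⟩)))
    (by
      rw [image_image]
      simpa only [hP, image_id'] using hS)
  exact exists_winding hJ' hf hτ

end

section

open Filter Topology

section NormedSpace

variable {W : Type*} [NormedAddCommGroup W] [NormedSpace ℝ W] [FiniteDimensional ℝ W]

theorem mem_image_of_injOn_boundary_of_finiteDimensional (hW : 1 < Module.rank ℝ W)
    {X B V : Set W} {f : W → W} {c y : W}
    (hX : IsCompact X) (hB : IsCompact B) (hBX : B ⊆ X) (hfr : frontier X ⊆ B) (hcX : c ∈ X)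
    (hcB : c ∉ B) (hf : ContinuousOn f X) (hi : InjOn f B) (hV : IsOpen V) (hVc : IsPreconnected V)
    (hVB : Disjoint V (f '' B)) (hfX : f '' X ⊆ f '' B ∪ V) (hy : y ∈ V) : y ∈ f '' X := by
  let Φ := (toEuclidean (E := W)).toHomeomorph
  have hrank : 1 < Module.rank ℝ (EuclideanSpace ℝ (Fin (Module.finrank ℝ W))) := by
    rw [← Module.finrank_eq_rank] at hW ⊢
    rw [finrank_euclideanSpace_fin]
    exact_mod_cast hW
  have him : ∀ S : Set W, (Φ ∘ f ∘ Φ.symm) '' (Φ '' S) = Φ '' (f '' S) := fun S => by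
    simp only [image_image, Function.comp_apply, Φ.symm_apply_apply]
  have hΦ := Φ.injective
  have key := mem_image_of_injOn_boundary hrank (X := Φ '' X) (B := Φ '' B) (V := Φ '' V)
    (f := Φ ∘ f ∘ Φ.symm) (c := Φ c) (y := Φ y) (hX.image Φ.continuous) (hB.image Φ.continuous)
    (image_mono hBX) (by rw [← Φ.image_frontier]; exact image_mono hfr) (mem_image_of_mem _ hcX)
    (by rwa [hΦ.mem_set_image])
    (Φ.continuous.comp_continuousOn (hf.comp Φ.symm.continuous.continuousOn (by
      rintro _ ⟨x, hx, rfl⟩; simpa using hx)))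
    (by
      rintro _ ⟨x, hx, rfl⟩ _ ⟨y, hy, rfl⟩ h
      simp only [Function.comp_apply, Φ.symm_apply_apply] at h
      rw [hi hx hy (hΦ h)])
    (Φ.isOpenMap _ hV) (hVc.image _ Φ.continuous.continuousOn)
    (by rw [him]; exact (disjoint_image_iff hΦ).2 hVB)
    (by rw [him, him, ← image_union]; exact image_mono hfX) (mem_image_of_mem _ hy)
  rwa [him, hΦ.mem_set_image] at key

end NormedSpace

/-- A planar crumpled cube: a compact set and a bounded complementary domain. -/
structure IsPlanarCube {W : Type*} [PseudoMetricSpace W] (B U : Set W) : Prop where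
  isCompact : IsCompact B
  isOpen : IsOpen U
  isPreconnected : IsPreconnected U
  nonempty : U.Nonempty
  disjoint : Disjoint U B
  closure_subset : closure U ⊆ U ∪ B
  isBounded : Bornology.IsBounded U

section Unwind

variable {m : ℕ}

/-- A bump function on the leg, depending only on the modulus of the plane coordinate. -/
def legBump (p : ThickTorus m) : ℝ :=
  max 0 (1 - 2 * dist (p.1, ‖p.2‖) ((fun _ => 1 : Fin (m + 2) → Circle), (2 : ℝ)))

/-- The point of a thick torus obtained by prescribing the argument of the plane coordinate. -/
def setAngle (p : ThickTorus m) (t : ℝ) : ThickTorus m :=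
  (p.1, ‖p.2‖ * Complex.exp (2 * Real.pi * (t : ℂ) * Complex.I))

/-- A bounded function used to unwind the leg. -/
def squash (t : ℝ) : ℝ := 1 / 2 + 1 / 4 * (t / (1 + |t|))

lemma continuous_squash : Continuous squash := by
  unfold squash
  have : ∀ t : ℝ, 1 + |t| ≠ 0 := fun t => by positivity
  fun_prop (disch := exact this _)

lemma squash_mem_Ioo (t : ℝ) : squash t ∈ Ioo (0 : ℝ) 1 := by
  have h : |t / (1 + |t|)| ≤ 1 := by
    rw [abs_div, abs_of_pos (by positivity : 0 < 1 + |t|), div_le_one (by positivity)]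
    linarith
  rw [abs_le] at h
  unfold squash
  constructor <;> linarith

lemma continuous_legBump : Continuous (legBump (m := m)) := by
  unfold legBump; fun_prop

lemma continuous_setAngle : Continuous fun q : ThickTorus m × ℝ => setAngle q.1 q.2 := by
  unfold setAngle; fun_prop

lemma norm_setAngle (p : ThickTorus m) (t : ℝ) : ‖(setAngle p t).2‖ = ‖p.2‖ := by
  have : (2 * Real.pi * (t : ℂ) * Complex.I) = ((2 * Real.pi * t : ℝ) : ℂ) * Complex.I := by
    push_cast; ring
  rw [setAngle, norm_mul, this, Complex.norm_exp_ofReal_mul_I]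
  simp

lemma setAngle_eq {p : ThickTorus m} {t : ℝ} (hp : p.2 ≠ 0)
    (h : Complex.exp (2 * Real.pi * (t : ℂ) * Complex.I) = p.2 / ‖p.2‖) : setAngle p t = p := by
  refine Prod.ext rfl ?_
  rw [setAngle, h]
  exact mul_div_cancel₀ _ (by exact_mod_cast norm_ne_zero_iff.2 hp)

lemma setAngle_ne {t : ℝ} (ht : t ∈ Ioo (0 : ℝ) 1) {p : ThickTorus m} {r : ℝ} (hr : 0 < r) :
    (setAngle p t).2 ≠ r := by
  intro h
  have h1 := norm_setAngle p t
  rw [h, Complex.norm_real, Real.norm_of_nonneg hr.le] at h1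
  rw [setAngle, ← h1, mul_eq_left₀ (by exact_mod_cast hr.ne'), Complex.exp_eq_one_iff] at h
  obtain ⟨k, hk⟩ := h
  have h2 : (t : ℂ) = k := by
    have : (2 * Real.pi * Complex.I : ℂ) ≠ 0 := Complex.two_pi_I_ne_zero
    refine mul_right_cancel₀ this ?_
    rw [← hk]; ring
  have h3 : t = k := by exact_mod_cast h2
  rw [h3] at ht
  have := ht.1; have := ht.2
  norm_cast at *
  omega

lemma setAngle_mem_legSet {p : ThickTorus m} (hp : p ∈ legSet m) (t : ℝ) :
    setAngle p t ∈ legSet m := ⟨hp.1, by rw [norm_setAngle]; exact hp.2⟩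

/-- The support of the bump function. -/
def legCore (m : ℕ) : Set (ThickTorus m) :=
  {p | dist (p.1, ‖p.2‖) ((fun _ => 1 : Fin (m + 2) → Circle), (2 : ℝ)) ≤ 1 / 2}

lemma legBump_eq_zero {p : ThickTorus m} (hp : p ∉ legCore m) : legBump p = 0 := by
  have h : ¬ dist (p.1, ‖p.2‖) ((fun _ => 1 : Fin (m + 2) → Circle), (2 : ℝ)) ≤ 1 / 2 := hp
  rw [not_le] at h
  exact max_eq_left (by linarith)

lemma isCompact_legCore : IsCompact (legCore m) := by
  refine (isCompact_norm_le (m := m) 3).of_isClosed_subset ?_ fun p hp => ?_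
  · exact isClosed_le (by fun_prop) continuous_const
  · have h : max _ _ ≤ (1 / 2 : ℝ) := hp
    have h := (le_max_right _ _).trans h
    rw [Real.dist_eq, abs_le] at h
    show ‖p.2‖ ≤ 3
    linarith [h.2]

lemma legCore_subset : legCore m ⊆ legSet m := by
  intro p hp
  have h : max _ _ ≤ (1 / 2 : ℝ) := hp
  refine ⟨fun j => ?_, ?_⟩
  · have h1 := (le_max_left _ _).trans h
    have h2 := (dist_le_pi_dist _ _ j.succ).trans h1
    have h3 : ‖((p.1 j.succ : Circle) : ℂ) - 1‖ ≤ 1 / 2 := by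
      rw [← Complex.dist_eq]; exact h2
    have h4 := (abs_le.1 ((Complex.abs_re_le_norm _).trans h3)).1
    rw [Complex.sub_re, Complex.one_re] at h4
    show 0 < ((p.1 j.succ : Circle) : ℂ).re
    linarith
  · have h := (le_max_right _ _).trans h
    rw [Real.dist_eq, abs_le] at h
    show 1 < ‖p.2‖
    linarith [h.1]

/-- A map onto a planar crumpled cube whose boundary contains a tower set cannot start from
a cube with finitely generated fundamental group. -/
theorem not_fg_of_map {W : Type*} [NormedAddCommGroup W] [NormedSpace ℝ W] [FiniteDimensional ℝ W]
    (hW : 1 < Module.rank ℝ W) {J : ThickTorus m → W} (hJ : IsOpenEmbedding J)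
    {B U B' U' : Set W} (hBU : IsPlanarCube B U) (hBU' : IsPlanarCube B' U')
    (hA : Disjoint (towerSet J) U')
    (hpost : ∀ j, J ∘ kidWord m (zeroWord m j) '' postSet m ⊆ U')
    {f : W → W} (hf : ContinuousOn f (B ∪ U)) (hi : InjOn f B) (hfB : f '' B = B')
    (hfU : MapsTo f U U') (u₀ : U) : ¬ Group.FG (FundamentalGroup U u₀) := by
  classical
  intro hfg
  have : LocallyPathConnectedSpace U := hBU.isOpen.locallyPathConnectedSpace
  have hUc : IsConnected U := ⟨hBU.nonempty, hBU.isPreconnected⟩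
  have : ConnectedSpace U := isConnected_iff_connectedSpace.1 hUc
  have : PathConnectedSpace U := pathConnectedSpace_iff_connectedSpace.2 inferInstance
  obtain ⟨j, t, ht⟩ := exists_winding_of_fg hJ hfg (f := fun y : U => f y)
    (hf.mono subset_union_right).domRestrict fun y hy => disjoint_left.1 hA hy (hfU y.2)
  let L : ThickTorus m → W := legMap (J ∘ kidWord m (zeroWord m j))
  have hL : IsOpenEmbedding L :=
    (hJ.comp (isOpenEmbedding_kidWord _)).comp (isOpenEmbedding_kidMap 0)
  have hLU : ∀ p ∈ legSet m, L p ∈ U' := fun p hp => by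
    refine hpost (j + 1) ⟨p, legSet_subset_postSet hp, ?_⟩
    rw [zeroWord_add]
    simp [L, legMap, zeroWord, kidWord_append, kidWord_cons]
  let q : W → ThickTorus m := fun y => Function.invFun L (f y)
  have hq : ∀ {y p}, f y = L p → q y = p := fun {y p} h => by
    simp only [q, h, Function.leftInverse_invFun hL.injective p]
  let τ : W → ℝ := fun y => if h : y ∈ U then t ⟨y, h⟩ else 0
  let s : W → ℝ := fun y => (1 - legBump (q y)) * τ y + legBump (q y) * squash (τ y)
  let N : Set W := {y | y ∈ U ∧ f y ∈ L '' legSet m}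
  let f₁ : W → W := fun y => if y ∈ N then L (setAngle (q y) (s y)) else f y
  have hLo : IsOpen (L '' legSet m) := hL.isOpenMap _ isOpen_legSet
  have hfc : ∀ y ∈ U, ContinuousAt f y := fun y hy =>
    (hf.mono subset_union_right).continuousAt (hBU.isOpen.mem_nhds hy)
  have hNB : ∀ y ∈ B, y ∉ N := fun y hy h => disjoint_left.1 hBU.disjoint h.1 hy
  have hfB' : ∀ y ∈ B, f y ∉ U' := fun y hy h =>
    disjoint_left.1 hBU'.disjoint h (hfB ▸ mem_image_of_mem _ hy)
  have heq : ∀ y ∈ N, legBump (q y) = 0 → L (setAngle (q y) (s y)) = f y := by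
    rintro y ⟨hy, p, hp, hpy⟩ h0
    have := (ht ⟨y, hy⟩ p hp hpy.symm).2
    rw [hq hpy.symm] at h0 ⊢
    have hs : s y = t ⟨y, hy⟩ := by simp [s, τ, hq hpy.symm, h0, hy]
    rw [hs, setAngle_eq (norm_pos_iff.1 (one_pos.trans hp.2)) this, hpy]
  have hcont : ContinuousOn f₁ (B ∪ U) := by
    intro y hy
    by_cases hyN : y ∈ N
    · obtain ⟨hyU, p, hp, hpy⟩ := hyN
      have hev : ∀ᶠ x in 𝓝 y, x ∈ N := by
        filter_upwards [hBU.isOpen.mem_nhds hyU,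
          (hfc y hyU).eventually_mem (hLo.mem_nhds ⟨p, hp, hpy⟩)] with x h1 h2 using ⟨h1, h2⟩
      have hqc : ContinuousAt q y := by
        refine ContinuousAt.comp (g := Function.invFun L) ?_ (hfc y hyU)
        rw [← hpy, ← hL.continuousAt_iff]
        have : Function.invFun L ∘ L = id := funext (Function.leftInverse_invFun hL.injective)
        rw [this]; exact continuousAt_id
      have hτ : ContinuousAt τ y := by
        have h1 := (ht ⟨y, hyU⟩ p hp hpy.symm).1
        have : τ ∘ ((↑) : U → W) = t := by
          funext x; simp [τ, x.2]
        have h2 := hBU.isOpen.isOpenEmbedding_subtypeVal.continuousAt_iff (g := τ) (x := ⟨y, hyU⟩)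
        rw [this] at h2
        exact h2.1 h1
      have hb : ContinuousAt (fun x => legBump (q x)) y := continuous_legBump.continuousAt.comp hqc
      have hs : ContinuousAt s y :=
        ((continuousAt_const.sub hb).mul hτ).add
          (hb.mul (continuous_squash.continuousAt.comp hτ))
      have hc : ContinuousAt (fun x => L (setAngle (q x) (s x))) y :=
        hL.continuous.continuousAt.comp
          (continuous_setAngle.continuousAt.comp (f := fun x => (q x, s x)) (hqc.prodMk hs))
      refine (hc.congr ?_).continuousWithinAt
      filter_upwards [hev] with x hx
      exact (if_pos hx).symm
    · have hyc : f y ∉ L '' legCore m := by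
        intro h
        rcases hy with hy | hy
        · obtain ⟨p, hp, hpy⟩ := h
          exact hfB' y hy (hpy ▸ hLU p (legCore_subset hp))
        · exact hyN ⟨hy, image_mono legCore_subset h⟩
      have hev := (hf y hy).eventually_mem
        ((isCompact_legCore.image hL.continuous).isClosed.isOpen_compl.mem_nhds hyc)
      refine (hf y hy).congr_of_eventuallyEq ?_ (if_neg hyN)
      filter_upwards [hev] with x hx
      by_cases hxN : x ∈ N
      · refine (if_pos hxN).trans (heq x hxN (legBump_eq_zero fun h => hx ?_))
        obtain ⟨-, p, hp, hpx⟩ := hxN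
        rw [hq hpx.symm] at h
        exact ⟨p, h, hpx⟩
      · exact if_neg hxN
  have hBeq : EqOn f₁ f B := fun y hy => if_neg (hNB y hy)
  have him : f₁ '' B = B' := hBeq.image_eq.trans hfB
  let z : ThickTorus m := (fun _ => 1, ((2 : ℝ) : ℂ))
  have hz : z ∈ legSet m := by
    refine legCore_subset ?_
    show dist _ _ ≤ (1 / 2 : ℝ)
    simp [z]
  have hmiss : L z ∉ f₁ '' (B ∪ U) := by
    rintro ⟨y, hy, hyz⟩
    by_cases hyN : y ∈ N
    · have h1 : setAngle (q y) (s y) = z := hL.injective ((if_pos hyN).symm.trans hyz)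
      have h2 : (q y).1 = z.1 := (congrArg Prod.fst h1 :)
      have h3 : ‖(q y).2‖ = 2 := by rw [← norm_setAngle _ (s y), h1]; simp [z]
      have h4 : legBump (q y) = 1 := by
        rw [legBump, h2, h3]; simp [z]
      have h5 : s y = squash (τ y) := by simp [s, h4]
      rw [h5] at h1
      exact setAngle_ne (squash_mem_Ioo _) two_pos (congrArg Prod.snd h1)
    · have h1 : f y = L z := (if_neg hyN).symm.trans hyz
      rcases hy with hy | hy
      · exact hfB' y hy (h1 ▸ hLU z hz)
      · exact hyN ⟨hy, z, hz, h1.symm⟩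
  refine hmiss (mem_image_of_injOn_boundary_of_finiteDimensional hW (c := (u₀ : W)) ?_
    hBU.isCompact subset_union_left ?_ (Or.inr u₀.2) (disjoint_left.1 hBU.disjoint u₀.2) hcont
    (hi.congr hBeq.symm) hBU'.isOpen hBU'.isPreconnected (him ▸ hBU'.disjoint) ?_ (hLU z hz))
  · refine Metric.isCompact_of_isClosed_isBounded ?_ (hBU.isCompact.isBounded.union hBU.isBounded)
    refine isClosed_of_closure_subset ?_
    rw [closure_union, hBU.isCompact.isClosed.closure_eq]
    exact union_subset subset_union_left (hBU.closure_subset.trans (union_comm _ _).subset)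
  · rintro x ⟨h1, h2⟩
    rw [closure_union, hBU.isCompact.isClosed.closure_eq] at h1
    have h3 : x ∉ U := fun h => h2 (interior_mono subset_union_right
      (hBU.isOpen.interior_eq.symm ▸ h))
    rcases h1 with h1 | h1
    · exact h1
    · exact (hBU.closure_subset h1).resolve_left h3
  · rw [image_union]
    refine union_subset_union_right _ ?_
    rintro _ ⟨y, hy, rfl⟩
    by_cases hyN : y ∈ N
    · have h : f₁ y = L (setAngle (q y) (s y)) := if_pos hyN
      rw [h]
      obtain ⟨-, p, hp, hpy⟩ := hyN
      exact hLU _ (setAngle_mem_legSet (by rwa [hq hpy.symm]) _)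
    · have h : f₁ y = f y := if_neg hyN
      rw [h]; exact hfU hy

end Unwind

end

section

open Filter Topology

section Place

variable {m : ℕ}

lemma IsPreconnected.union_of_mem_closure {X : Type*} [TopologicalSpace X] {A B : Set X}
    (hA : IsPreconnected A) (hB : IsPreconnected B) {x : X} (hxA : x ∈ A) (hxB : x ∈ closure B) :
    IsPreconnected (A ∪ B) := by
  have h1 : IsPreconnected (insert x B) :=
    hB.subset_closure (subset_insert _ _) (insert_subset hxB subset_closure)
  have h2 := hA.union x hxA (mem_insert _ _) h1
  rwa [union_insert, ← insert_union, insert_eq_of_mem hxA] at h2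

lemma isPreconnected_iUnion_postSet {X : Type*} [TopologicalSpace X] {J : ThickTorus m → X}
    (hJ : Continuous J) :
    IsPreconnected (⋃ j, J ∘ kidWord m (zeroWord m j) '' postSet m) := by
  let P : ℕ → Set X := fun j => J ∘ kidWord m (zeroWord m j) '' postSet m
  have hc : ∀ j, Continuous (J ∘ kidWord m (zeroWord m j)) := fun j =>
    hJ.comp (isOpenEmbedding_kidWord _).continuous
  have hP : ∀ j, IsPreconnected (P j) := fun j =>
    isPreconnected_postSet.image _ (hc j).continuousOn
  obtain ⟨p, hp, hpl⟩ := exists_mem_closure_legSet (m := m)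
  have hQ : ∀ j, IsPreconnected (P j ∪ P (j + 1)) := fun j => by
    refine (hP j).union_of_mem_closure (hP (j + 1)) (mem_image_of_mem _ hp) ?_
    have h1 := image_closure_subset_closure_image (hc j) (mem_image_of_mem _ hpl)
    refine closure_mono ?_ h1
    rintro _ ⟨_, ⟨q, hq, rfl⟩, rfl⟩
    refine ⟨q, legSet_subset_postSet hq, ?_⟩
    rw [zeroWord_add]
    simp [zeroWord, kidWord_append, kidWord_cons]
  have h := IsPreconnected.iUnion_of_chain hQ fun j =>
    ⟨_, Or.inr (mem_image_of_mem _ hp), Or.inl (mem_image_of_mem _ hp)⟩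
  have : ⋃ j, (P j ∪ P (j + 1)) = ⋃ j, P j := by
    refine Subset.antisymm (iUnion_subset fun j => union_subset (subset_iUnion P j)
      (subset_iUnion P (j + 1))) (iUnion_mono fun j => subset_union_left)
  rwa [this] at h

lemma postSet_nonempty : (postSet m).Nonempty := (exists_mem_closure_legSet (m :=
    m)).imp fun _ h => h.1

/-- The thick torus with its plane coordinate squeezed into a disc of radius two. -/
def squeeze (p : ThickTorus m) : ThickTorus m := (p.1, 2 * shrink p.2)

lemma isOpenEmbedding_squeeze : IsOpenEmbedding (squeeze (m := m)) := by
  have h : IsOpenEmbedding fun w : ℂ => 2 * shrink w :=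
    (Homeomorph.mulLeft₀ (2 : ℂ) two_ne_zero).isOpenEmbedding.comp isOpenEmbedding_shrink
  exact IsOpenEmbedding.id.prodMap h

lemma norm_squeeze_lt (p : ThickTorus m) : ‖(squeeze p).2‖ < 2 := by
  have := norm_shrink_lt_one p.2
  rw [squeeze, norm_mul, Complex.norm_two]
  linarith

lemma squeeze_keepSet_subset :
    squeeze '' keepSet m ⊆ {p | ‖p.2‖ ≤ 3 / 2 ∨ 0 ≤ cre (p.1 1)} := by
  rintro _ ⟨p, hp | hp, rfl⟩
  · refine Or.inl (le_of_not_gt fun h => ?_)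
    have h1 : 0.75 < ‖shrink p.2‖ := by
      rw [squeeze, norm_mul, Complex.norm_two] at h
      linarith
    exact absurd (one_lt_norm_of_lt_norm_shrink h1) (not_lt.2 hp)
  · exact Or.inr hp

/-- A thick torus can be placed in any given box so that it stays above the bottom of the box
over the set `keepSet`, but not everywhere. -/
theorem exists_placed_torus (x₀ : EuclideanSpace ℝ (Fin (m + 3))) {r h : ℝ} (hr : 0 < r)
    (hh : 0 < h) : ∃ J : ThickTorus m → EuclideanSpace ℝ (Fin (m + 3)) × ℝ, IsOpenEmbedding J ∧
      (∃ K ⊆ ball x₀ r ×ˢ Ioo (-h) h, IsCompact K ∧ range J ⊆ K) ∧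
      (∀ p ∈ keepSet m, 0 < (J p).2) ∧ ∃ p, (J p).2 ≤ 0 := by
  obtain ⟨J₀, hJ₀, htop⟩ := exists_isOpenEmbedding_thickTorus m
  let B : Set (ThickTorus m) := {p | ‖p.2‖ ≤ 2}
  let C : Set (ThickTorus m) := {p | ‖p.2‖ ≤ 3 / 2 ∨ 0 ≤ cre (p.1 1)}
  have hC : IsClosed C :=
    (isClosed_le (f := fun p : ThickTorus m => ‖p.2‖) (by fun_prop) continuous_const).union
      (isClosed_le continuous_const (continuous_cre.comp (by fun_prop)))
  have hTc : IsCompact (J₀ '' (B ∩ C)) :=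
      ((isCompact_norm_le 2).inter_right hC).image hJ₀.continuous
  set T := J₀ '' (B ∩ C) with hT
  let γ : ℝ → EuclideanSpace ℝ (Fin (m + 3)) × ℝ := fun y => J₀ (fun _ => -1, (y : ℂ))
  have hγ : Continuous γ := hJ₀.continuous.comp (by fun_prop)
  have hγT : ∀ y, 3 / 2 < y → γ y ∈ Tᶜ := by
    rintro y hy ⟨p, ⟨-, hp⟩, hpy⟩
    rw [hJ₀.injective hpy] at hp
    rcases hp with hp | hp
    · simp only [Complex.norm_real, Real.norm_eq_abs] at hp
      linarith [le_abs_self y]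
    · simp [cre] at hp
      linarith
  obtain ⟨p₀, y₀, hy₀, hp₀⟩ : ∃ p₀ : ThickTorus m, ∃ y₀, 3 / 2 < y₀ ∧ J₀ (squeeze p₀) = γ y₀ := by
    refine ⟨(fun _ => -1, 10), 2 * ((√(1 + ‖(10 : ℂ)‖ ^ 2))⁻¹ * 10), ?_, ?_⟩
    · have h10 : ‖(10 : ℂ)‖ = 10 := by simp
      rw [h10]
      have h1 : √(1 + (10 : ℝ) ^ 2) < 40 / 3 := by
        rw [Real.sqrt_lt' (by norm_num)]; norm_num
      have h2 : 0 < √(1 + (10 : ℝ) ^ 2) := by positivity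
      rw [inv_mul_eq_div, ← mul_div_assoc, lt_div_iff₀ h2]
      linarith
    · simp [γ, squeeze, shrink_eq]
  obtain ⟨M, hM⟩ := hTc.bddAbove_image (f := Prod.snd) continuous_snd.continuousOn
  let D := connectedComponentIn Tᶜ (γ y₀)
  have hDo : IsOpen D := hTc.isClosed.isOpen_compl.connectedComponentIn
  obtain ⟨y₁, hy₁, hyM⟩ := ((eventually_ge_atTop y₀).and
    (htop.eventually (eventually_gt_atTop (M + 1)))).exists
  have hD1 : γ y₁ ∈ D := by
    have := (isPreconnected_Ici (a := y₀)).image γ hγ.continuousOn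
    refine this.subset_connectedComponentIn (mem_image_of_mem _ self_mem_Ici) ?_
      (mem_image_of_mem _ hy₁)
    rintro _ ⟨y, hy, rfl⟩
    exact hγT y (hy₀.trans_le hy)
  obtain ⟨g, hg, hgy⟩ := exists_suppIn_apply_eq hDo isPreconnected_connectedComponentIn
    (mem_connectedComponentIn (hγT y₀ hy₀)) hD1
  have hgT : ∀ x ∈ T, g x = x := fun x hx =>
    hg.apply_eq fun h => connectedComponentIn_subset _ _ h hx
  have hKc : IsCompact (g '' (J₀ '' B)) :=
    ((isCompact_norm_le 2).image hJ₀.continuous).image g.continuous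
  obtain ⟨R, hR0, hR⟩ := hKc.isBounded.exists_pos_norm_le
  obtain ⟨δ, hδ, hδr, hδh⟩ : ∃ δ : ℝ, 0 < δ ∧ δ * R < r ∧ δ * (|M + 1| + R) < h := by
    have h1 : Tendsto (fun δ : ℝ => δ * R) (𝓝 0) (𝓝 0) := by
      have : Continuous fun δ : ℝ => δ * R := by fun_prop
      simpa using this.tendsto 0
    have h2 : Tendsto (fun δ : ℝ => δ * (|M + 1| + R)) (𝓝 0) (𝓝 0) := by
      have : Continuous fun δ : ℝ => δ * (|M + 1| + R) := by fun_prop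
      simpa using this.tendsto 0
    have h3 : ∀ᶠ δ : ℝ in 𝓝[>] 0, 0 < δ := self_mem_nhdsWithin
    obtain ⟨δ, h3, h1, h2⟩ := (h3.and (((h1.eventually (gt_mem_nhds hr)).and
      (h2.eventually (gt_mem_nhds hh))).filter_mono nhdsWithin_le_nhds)).exists
    exact ⟨δ, h3, h1, h2⟩
  let A : EuclideanSpace ℝ (Fin (m + 3)) × ℝ ≃ₜ EuclideanSpace ℝ (Fin (m + 3)) × ℝ :=
    ((Homeomorph.smulOfNeZero δ hδ.ne').trans (Homeomorph.addLeft x₀)).prodCongr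
      ((Homeomorph.subLeft (M + 1)).trans (Homeomorph.smulOfNeZero δ hδ.ne'))
  have hA : ∀ z, A z = (x₀ + δ • z.1, δ * (M + 1 - z.2)) := fun z => rfl
  refine ⟨A ∘ g ∘ J₀ ∘ squeeze, A.isOpenEmbedding.comp (g.isOpenEmbedding.comp
    (hJ₀.comp isOpenEmbedding_squeeze)), ⟨A '' (g '' (J₀ '' B)), ?_, hKc.image A.continuous, ?_⟩,
    fun p hp => ?_, p₀, ?_⟩
  · rintro _ ⟨z, hz, rfl⟩
    rw [hA]
    have h1 := (norm_fst_le z).trans (hR z hz)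
    have h2 := (norm_snd_le z).trans (hR z hz)
    constructor
    · rw [mem_ball, dist_eq_norm]
      simp only [add_sub_cancel_left, norm_smul, Real.norm_of_nonneg hδ.le]
      exact (mul_le_mul_of_nonneg_left h1 hδ.le).trans_lt hδr
    · show _ < _ ∧ _ < _
      rw [← abs_lt]
      simp only [abs_mul, abs_of_pos hδ]
      refine (mul_le_mul_of_nonneg_left ?_ hδ.le).trans_lt hδh
      exact (abs_sub _ _).trans (add_le_add_right h2 _)
  · rintro _ ⟨p, rfl⟩
    exact mem_image_of_mem _ (mem_image_of_mem _ (mem_image_of_mem _ (norm_squeeze_lt p).le))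
  · have h1 : J₀ (squeeze p) ∈ T := mem_image_of_mem _
      ⟨(norm_squeeze_lt p).le, squeeze_keepSet_subset (mem_image_of_mem _ hp)⟩
    have h2 : (J₀ (squeeze p)).2 ≤ M := hM (mem_image_of_mem _ h1)
    simp only [Function.comp_apply, hA, hgT _ h1]
    exact mul_pos hδ (by linarith)
  · have h1 : M + 1 < (γ y₁).2 := hyM
    simp only [Function.comp_apply, hp₀, hgy, hA]
    exact mul_nonpos_of_nonneg_of_nonpos hδ.le (by linarith)

end Place

end

section

open Filter Topology

section Squash

variable {m : ℕ} {V : Type*} [NormedAddCommGroup V] [InnerProductSpace ℝ V] [FiniteDimensional ℝ V]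
  {J : ThickTorus m → V × ℝ} {E : ℕ → Set V} (T : Tower J E)

lemma infDist_eq_zero_iff_mem {X : Type*} [PseudoMetricSpace X] {s : Set X} (hs : IsClosed s)
    (hne : s.Nonempty) {x : X} : infDist x s = 0 ↔ x ∈ s := (hs.mem_iff_infDist_zero hne).symm

/-- A set meeting a domain and missing its topological boundary stays in the domain. -/
lemma IsPreconnected.subset_of_isPlanarCube {W : Type*} [PseudoMetricSpace W] {B U S : Set W}
    (hBU : IsPlanarCube B U) (hS : IsPreconnected S) (hSB : Disjoint S B)
    (hSU : (S ∩ U).Nonempty) : S ⊆ U := by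
  refine hS.subset_left_of_subset_union hBU.isOpen isClosed_closure.isOpen_compl
    (disjoint_compl_right.mono_left subset_closure) (fun x hx => ?_) hSU
  by_cases h : x ∈ closure U
  · exact Or.inl ((hBU.closure_subset h).resolve_right (disjoint_left.1 hSB hx))
  · exact Or.inr h

omit [InnerProductSpace ℝ V] [FiniteDimensional ℝ V] in
include T in
lemma Tower.limitSet_nonempty (hJ : IsOpenEmbedding J) : T.limitSet.Nonempty := by
  have hw : IsBranch fun j => zeroWord m j := by
    refine ⟨fun j => List.length_replicate .., fun j => ⟨0, ?_⟩⟩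
    exact zeroWord_add j 1
  obtain ⟨z, -, hz⟩ := T.exists_mem_limitSet_of_isBranch hJ hw
  exact ⟨z, fun j => ⟨_, List.length_replicate .., hz j⟩⟩

/-- A self-map of the space flattening the limit set to its part in the plane, with the identity
outside the upper half of a box. -/
lemma Tower.exists_flatten (hJ : IsOpenEmbedding J) {x₀ : V} {r h : ℝ} (hr : 0 < r)
    (hJQ : range J ⊆ ball x₀ r ×ˢ Ioo (-h) h) :
    ∃ F : V × ℝ → V × ℝ, Continuous F ∧ (∀ z ∉ ball x₀ r ×ˢ Ioo 0 h, F z = z) ∧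
      (∀ z ∈ ball x₀ r ×ˢ Ioo 0 h, z ∉ T.limitSet → F z ∈ ball x₀ r ×ˢ Ioo 0 h) ∧
      ∀ z ∈ T.limitSet, (F z ∈ T.limitSet ∧ (F z).2 ≤ 0) ∧ T.collapse (F z) = T.collapse z := by
  obtain ⟨c₀, hc₀, hcX⟩ := T.exists_retract hJ
  have hXc := T.isCompact_limitSet hJ
  have hXne := T.limitSet_nonempty hJ
  have hXQ : ∀ z ∈ T.limitSet, z ∈ ball x₀ r ×ˢ Ioo (-h) h := fun z hz =>
    hJQ (T.limitSet_subset hz)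
  let β := OpenPartialHomeomorph.univBall x₀ r
  have hβt : β.target = ball x₀ r := OpenPartialHomeomorph.univBall_target x₀ hr
  have hβs : β.source = univ := OpenPartialHomeomorph.univBall_source x₀ r
  have hcball : ∀ z ∈ T.limitSet, c₀ z ∈ β.target := fun z hz => by
    rw [hβt]; exact (hXQ _ (hcX z hz).1).1
  obtain ⟨d, hd, hdX⟩ := ContinuousOn.exists_extension_of_isClosed hXc.isClosed
    (f := β.symm ∘ c₀) (β.symm.continuousOn.comp hc₀ hcball)
  let c : V × ℝ → V := β ∘ d
  have hc : Continuous c := (OpenPartialHomeomorph.continuous_univBall x₀ r).comp hd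
  have hcb : ∀ z, c z ∈ ball x₀ r := fun z => by
    rw [← hβt]; exact β.map_source (by rw [hβs]; trivial)
  have hceq : ∀ z ∈ T.limitSet, c z = c₀ z := fun z hz => by
    simp only [c, Function.comp_apply, hdX z hz]
    exact β.right_inv (hcball z hz)
  have hcX' : ∀ z ∈ T.limitSet, (c z, (0 : ℝ)) ∈ T.limitSet ∧ T.collapse (c z, 0) = T.collapse z :=
    fun z hz => by rw [hceq z hz]; exact hcX z hz
  let P : Set (V × ℝ) := (ball x₀ r ×ˢ Ioo 0 h)ᶜ
  have hP : IsClosed P := (isOpen_ball.prod isOpen_Ioo).isClosed_compl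
  have hPne : P.Nonempty := ⟨(x₀, 0), fun hz => lt_irrefl _ hz.2.1⟩
  have hPX : ∀ z ∈ P, z ∈ T.limitSet → z.2 ≤ 0 := fun z hz hzX => by
    by_contra! hpos
    exact hz ⟨(hXQ z hzX).1, hpos, (hXQ z hzX).2.2⟩
  have hfix : ∀ z ∈ P, z ∈ T.limitSet → (c z, (0 : ℝ)) = z := fun z hz hzX =>
    T.collapse_injOn hJ (fun _ => le_rfl) (fun _ => hPX z hz hzX) (hcX' z hzX).2
  let a : V × ℝ → ℝ := fun z => infDist z P
  let b : V × ℝ → ℝ := fun z => infDist z T.limitSet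
  have ha0 : ∀ z, a z = 0 ↔ z ∈ P := fun z => infDist_eq_zero_iff_mem hP hPne
  have hb0 : ∀ z, b z = 0 ↔ z ∈ T.limitSet := fun z =>
    infDist_eq_zero_iff_mem hXc.isClosed hXne
  have hann : ∀ z, 0 ≤ a z := fun z => infDist_nonneg
  have hbnn : ∀ z, 0 ≤ b z := fun z => infDist_nonneg
  let l : V × ℝ → ℝ := fun z => a z / (a z + b z)
  have hl0 : ∀ z, 0 ≤ l z := fun z => div_nonneg (hann z) (add_nonneg (hann z) (hbnn z))
  have hl1 : ∀ z, l z ≤ 1 := fun z => div_le_one_of_le₀ (le_add_of_nonneg_right (hbnn z))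
    (add_nonneg (hann z) (hbnn z))
  let F : V × ℝ → V × ℝ := fun z => z + l z • ((c z, (0 : ℝ)) - z)
  have hFP : ∀ z ∈ P, F z = z := fun z hz => by simp [F, l, (ha0 z).2 hz]
  have hFX : ∀ z ∈ T.limitSet, F z = (c z, 0) := fun z hz => by
    by_cases hzP : z ∈ P
    · rw [hFP z hzP, hfix z hzP hz]
    · have : a z ≠ 0 := fun h => hzP ((ha0 z).1 h)
      simp [F, l, (hb0 z).2 hz, div_self this]
  refine ⟨F, ?_, fun z hz => hFP z hz, fun z hz hzX => ?_, fun z hz => ?_⟩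
  · have hv : Continuous fun z => (c z, (0 : ℝ)) - z := by fun_prop
    rw [continuous_iff_continuousAt]
    intro z
    by_cases hz : z ∈ P ∧ z ∈ T.limitSet
    · have h1 : Tendsto (fun y => l y • ((c y, (0 : ℝ)) - y)) (𝓝 z) (𝓝 0) := by
        refine squeeze_zero_norm (a := fun y => ‖(c y, (0 : ℝ)) - y‖) (fun y => ?_) ?_
        · rw [norm_smul, Real.norm_of_nonneg (hl0 y)]
          exact mul_le_of_le_one_left (norm_nonneg _) (hl1 y)
        · have := hv.norm.tendsto z
          rwa [hfix z hz.1 hz.2, sub_self, norm_zero] at this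
      have h2 : Tendsto F (𝓝 z) (𝓝 (z + 0)) := tendsto_id.add h1
      rw [add_zero] at h2
      show Tendsto F (𝓝 z) (𝓝 (F z))
      rwa [hFP z hz.1]
    · have hne : a z + b z ≠ 0 := fun h => hz
        ⟨(ha0 z).1 (by linarith [hann z, hbnn z]), (hb0 z).1 (by linarith [hann z, hbnn z])⟩
      have hac : ContinuousAt a z := (continuous_infDist_pt P).continuousAt
      have hbc : ContinuousAt b z := (continuous_infDist_pt T.limitSet).continuousAt
      exact continuousAt_id.add ((hac.div (hac.add hbc) hne).smul hv.continuousAt)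
  · have hb : 0 < b z := lt_of_le_of_ne (hbnn z) fun h => hzX ((hb0 z).1 h.symm)
    have hl : l z < 1 := (div_lt_one (by linarith [hann z])).2 (by linarith)
    have hcomb : F z = (1 - l z) • z + l z • (c z, (0 : ℝ)) := by
      simp only [F, smul_sub, sub_smul, one_smul]; abel
    rw [hcomb]
    constructor
    · exact (convex_ball x₀ r) hz.1 (hcb z) (by linarith) (hl0 z) (by ring)
    · have h2 : ((1 - l z) • z + l z • (c z, (0 : ℝ))).2 = (1 - l z) * z.2 := by simp
      rw [h2]
      have h3 := hz.2
      refine ⟨mul_pos (by linarith) h3.1, lt_of_le_of_lt ?_ h3.2⟩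
      exact mul_le_of_le_one_left h3.1.le (by linarith [hl0 z])
  · rw [hFX z hz]
    exact ⟨⟨(hcX' z hz).1, le_rfl⟩, (hcX' z hz).2⟩

/-- Collapsing the branches of the limit set turns a planar crumpled cube into a wilder one. -/
theorem Tower.exists_planarCube (hJ : IsOpenEmbedding J) {x₀ : V} {r h : ℝ} (hr : 0 < r)
    {K : Set (V × ℝ)} (hK : IsCompact K) (hJK : range J ⊆ K) (hKQ : K ⊆ ball x₀ r ×ˢ Ioo (-h) h)
    {B U : Set (V × ℝ)} (hBU : IsPlanarCube B U) (hQU : ball x₀ r ×ˢ Ioo 0 h ⊆ U)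
    (hXB : ∀ z ∈ T.limitSet, z.2 ≤ 0 → z ∈ B) :
    ∃ B' U', IsPlanarCube B' U' ∧ Disjoint (towerSet J) U' ∧
      (∀ j, J ∘ kidWord m (zeroWord m j) '' postSet m ⊆ U') ∧
      ∃ g : V × ℝ → V × ℝ, Continuous g ∧ InjOn g B' ∧ g '' B' = B ∧ MapsTo g U' U := by
  obtain ⟨F, hF, hFP, hFQ, hFX⟩ := T.exists_flatten hJ (h := h) hr (hJK.trans hKQ)
  have hBQ : ∀ z ∈ B, z ∉ ball x₀ r ×ˢ Ioo 0 h :=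
      fun z hz hq => disjoint_left.1 hBU.disjoint (hQU hq) hz
  have hBX : ∀ z ∈ B, z ∈ T.limitSet → z.2 ≤ 0 := fun z hz hzX => by
    by_contra! hpos
    have := hKQ (hJK (T.limitSet_subset hzX))
    exact hBQ z hz ⟨this.1, hpos, this.2.2⟩
  have hθ := T.continuous_collapse hJ
  have hinj := T.collapse_injOn hJ
  have hsurj : Function.Surjective T.collapse := fun x =>
    (T.exists_collapse_eq hJ x).imp fun _ h => h.2
  have hquot := (T.isClosedMap_collapse hJ hK hJK).isQuotientMap hθ hsurj
  have hfib : ∀ z z', T.collapse z = T.collapse z' → F z = F z' := by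
    intro z z' hzz
    by_cases hz : z ∈ T.limitSet
    · have hz' : z' ∈ T.limitSet := by
        rwa [← T.collapse_mem_towerSet_iff hJ, ← hzz, T.collapse_mem_towerSet_iff hJ]
      refine hinj (fun _ => (hFX z hz).1.2) (fun _ => (hFX z' hz').1.2) ?_
      rw [(hFX z hz).2, (hFX z' hz').2, hzz]
    · have hz' : z' ∉ T.limitSet := by
        rwa [← T.collapse_mem_towerSet_iff hJ, ← hzz, T.collapse_mem_towerSet_iff hJ]
      rw [hinj (fun h => absurd h hz) (fun h => absurd h hz') hzz]
  let g : V × ℝ → V × ℝ := F ∘ Function.surjInv hsurj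
  have hgθ : ∀ z, g (T.collapse z) = F z := fun z => hfib _ _ (Function.surjInv_eq hsurj _)
  have hg : Continuous g := hquot.continuous_iff.2 (by
    rw [show g ∘ T.collapse = F from funext hgθ]; exact hF)
  let B' := T.collapse '' B
  have hgB : ∀ z ∈ B, g (T.collapse z) = z := fun z hz => by rw [hgθ, hFP z (hBQ z hz)]
  have hgB' : g '' B' = B := by
    rw [image_image]
    exact (image_congr hgB).trans (image_id' B)
  have hgi : InjOn g B' := by
    rintro _ ⟨x, hx, rfl⟩ _ ⟨y, hy, rfl⟩ hxy
    rw [hgB x hx, hgB y hy] at hxy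
    rw [hxy]
  have hgc : ∀ x ∉ B', g x ∉ B := by
    intro x hx
    obtain ⟨z, hz, rfl⟩ := T.exists_collapse_eq hJ x
    have hzB : z ∉ B := fun h => hx (mem_image_of_mem _ h)
    rw [hgθ]
    by_cases hzQ : z ∈ ball x₀ r ×ˢ Ioo 0 h
    · have hzX : z ∉ T.limitSet := fun h => hzB (hXB z h (hz h))
      exact fun h => hBQ _ h (hFQ z hzQ hzX)
    · rwa [hFP z hzQ]
  have hpost : ∀ w, ∀ p ∈ postSet m, J (kidWord m w p) ∉ B' ∧ g (J (kidWord m w p)) ∈ U := by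
    intro w p hp
    obtain ⟨z, hzJ, hzX, hz0, hzp⟩ := T.exists_collapse_postSet hJ (w := w) hp
    have hzQ : z ∈ ball x₀ r ×ˢ Ioo 0 h :=
      ⟨(hKQ (hJK hzJ)).1, hz0, (hKQ (hJK hzJ)).2.2⟩
    rw [← hzp]
    refine ⟨?_, ?_⟩
    · rintro ⟨y, hy, hyz⟩
      rw [hinj (fun h => hBX y hy h) (fun h => absurd h hzX) hyz] at hy
      exact hBQ z hy hzQ
    · rw [hgθ]; exact hQU (hFQ z hzQ hzX)
  obtain ⟨p₀, hp₀⟩ := postSet_nonempty (m := m)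
  let y₀ := J p₀
  have hy₀ := hpost [] p₀ hp₀
  have hB'c : IsCompact B' := hBU.isCompact.image hθ
  let U' := connectedComponentIn B'ᶜ y₀
  have hU'c : IsPreconnected U' := isPreconnected_connectedComponentIn
  have hU'B : Disjoint U' B' :=
    disjoint_left.2 fun x hx => connectedComponentIn_subset _ _ hx
  have hy₀U : y₀ ∈ U' := mem_connectedComponentIn hy₀.1
  have hgU : MapsTo g U' U := by
    rw [mapsTo_iff_image_subset]
    refine (hU'c.image g hg.continuousOn).subset_of_isPlanarCube hBU ?_
      ⟨_, mem_image_of_mem _ hy₀U, hy₀.2⟩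
    rw [disjoint_left]
    rintro _ ⟨x, hx, rfl⟩
    exact hgc x (disjoint_left.1 hU'B hx)
  refine ⟨B', U', ⟨hB'c, hB'c.isClosed.isOpen_compl.connectedComponentIn, hU'c, ⟨_, hy₀U⟩, hU'B,
    fun x hx => ?_, ?_⟩, ?_, fun j => ?_, g, hg, hgi, hgB', hgU⟩
  · by_contra! hn
    rw [mem_union, not_or] at hn
    have h1 : IsPreconnected (insert x U') :=
      hU'c.subset_closure (subset_insert _ _) (insert_subset hx subset_closure)
    exact hn.1 (h1.subset_connectedComponentIn (mem_insert_of_mem _ hy₀U)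
      (insert_subset hn.2 (connectedComponentIn_subset _ _)) (mem_insert _ _))
  · refine (hBU.isBounded.union hK.isBounded).subset fun x hx => ?_
    by_cases hxK : x ∈ range J
    · exact Or.inr (hJK hxK)
    · left
      by_cases hxQ : x ∈ ball x₀ r ×ˢ Ioo 0 h
      · exact hQU hxQ
      · have h1 := hgθ x
        rw [T.collapse_eq_self hJ hxK, hFP x hxQ] at h1
        exact h1 ▸ hgU hx
  · rw [disjoint_left]
    intro x hx hxU
    refine disjoint_left.1 hU'B hxU ?_
    obtain ⟨z, hz, rfl⟩ := T.exists_collapse_eq hJ x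
    have hzX := (T.collapse_mem_towerSet_iff hJ).1 hx
    exact mem_image_of_mem _ (hXB z hzX (hz hzX))
  · refine (subset_iUnion (fun j => J ∘ kidWord m (zeroWord m j) '' postSet m) j).trans
      ((isPreconnected_iUnion_postSet hJ.continuous).subset_connectedComponentIn
        (mem_iUnion.2 ⟨0, p₀, hp₀, rfl⟩) (iUnion_subset fun j => ?_))
    rintro _ ⟨p, hp, rfl⟩
    exact (hpost _ p hp).1

end Squash

end

section

open Filter Topology

section Floor

/-- A bounded function which is continuous at the points of a compact set has a continuous
majorant agreeing with it on the compact set. -/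
lemma exists_continuous_majorant {X : Type*} [MetricSpace X] {K S : Set X} (hK : IsCompact K)
    (hKS : K ⊆ S) {τ : X → ℝ} {M : ℝ} (hM : ∀ x ∈ S, τ x ≤ M)
    (hc : ∀ x ∈ K, ContinuousWithinAt τ S x) :
    ∃ T : X → ℝ, Continuous T ∧ (∀ x ∈ S, τ x ≤ T x) ∧ (∀ x, T x ≤ M) ∧ ∀ x ∈ K, T x = τ x := by
  rcases K.eq_empty_or_nonempty with rfl | hne
  · exact ⟨fun _ => M, continuous_const, hM, fun _ => le_rfl, by simp⟩
  have hτK : ContinuousOn τ K := fun x hx => (hc x hx).mono hKS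
  obtain ⟨t₀, ht₀, htτ₀⟩ := ContinuousOn.exists_extension_of_isClosed hK.isClosed hτK
  obtain ⟨μ, hμ⟩ := hK.bddBelow_image hτK
  let t : X → ℝ := fun x => max (t₀ x) μ
  have ht : Continuous t := ht₀.max continuous_const
  have htτ : ∀ x ∈ K, t x = τ x := fun x hx => by
    simp only [t, htτ₀ x hx]
    exact max_eq_left (hμ (mem_image_of_mem _ hx))
  obtain ⟨x₁, hx₁⟩ := hne
  have hμM : μ ≤ M := (hμ (mem_image_of_mem _ hx₁)).trans (hM x₁ (hKS hx₁))
  let D : ℝ := M - μ + 1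
  have hD : 0 < D := by simp only [D]; linarith
  have heD : ∀ x ∈ S, τ x - t x < D := fun x hx => by
    have := hM x hx
    have : μ ≤ t x := le_max_right _ _
    simp only [D]; linarith
  have hsmall : ∀ ε : ℝ, 0 < ε → ∃ δ : ℝ, 0 < δ ∧ ∀ x ∈ S, infDist x K < δ → τ x - t x < ε := by
    intro ε hε
    have h1 : ∀ k ∈ K, ∃ O, IsOpen O ∧ k ∈ O ∧ ∀ x ∈ O ∩ S, τ x - t x < ε := fun k hk => by
      have h2 : ContinuousWithinAt (fun x => τ x - t x) S k :=
        (hc k hk).sub ht.continuousWithinAt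
      have h3 := h2.eventually (gt_mem_nhds
        (show τ k - t k < ε by rw [htτ k hk, sub_self]; exact hε))
      obtain ⟨O, hO, hkO, h4⟩ := mem_nhdsWithin.1 h3
      exact ⟨O, hO, hkO, fun x hx => h4 hx⟩
    choose! O hO hkO hOS using h1
    obtain ⟨δ, hδ, hδO⟩ := hK.exists_thickening_subset_open
      (isOpen_biUnion fun k hk => hO k hk) (fun k hk => mem_biUnion hk (hkO k hk))
    refine ⟨δ, hδ, fun x hx hxd => ?_⟩
    obtain ⟨k, hk, hxk⟩ := mem_iUnion₂.1 (hδO ((mem_thickening_iff_infDist_lt ⟨x₁, hx₁⟩).2 hxd))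
    exact hOS k hk x ⟨hxk, hx⟩
  choose δ hδ hδe using fun k : ℕ => hsmall (D * (1 / 2) ^ k) (by positivity)
  let v : ℕ → X → ℝ := fun k x => 2 * D * (1 / 2) ^ k * min 1 (infDist x K / δ k)
  have hv0 : ∀ k x, 0 ≤ v k x := fun k x => by
    have := div_nonneg (infDist_nonneg (x := x) (s := K)) (hδ k).le
    exact mul_nonneg (by positivity) (le_min zero_le_one this)
  have hvle : ∀ k x, v k x ≤ 2 * D * (1 / 2) ^ k := fun k x =>
    mul_le_of_le_one_right (by positivity) (min_le_left _ _)
  have hsum : Summable fun k : ℕ => 2 * D * (1 / 2 : ℝ) ^ k :=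
    summable_geometric_two.mul_left _
  have hvs : ∀ x, Summable fun k => v k x := fun x =>
    Summable.of_nonneg_of_le (fun k => hv0 k x) (fun k => hvle k x) hsum
  have hu : Continuous fun x => ∑' k, v k x := by
    refine continuous_tsum (fun k => ?_) hsum fun k x => ?_
    · exact continuous_const.mul (continuous_const.min ((continuous_infDist_pt K).div_const _))
    · rw [Real.norm_of_nonneg (hv0 k x)]; exact hvle k x
  refine ⟨fun x => min (t x + ∑' k, v k x) M, (ht.add hu).min continuous_const,
    fun x hx => le_min ?_ (hM x hx), fun x => min_le_right _ _, fun x hx => ?_⟩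
  · have hu0 : 0 ≤ ∑' k, v k x := tsum_nonneg fun k => hv0 k x
    rcases le_or_gt (τ x - t x) 0 with he | he
    · linarith
    · have hex : ∃ k, δ k ≤ infDist x K := by
        obtain ⟨k, hk⟩ := exists_pow_lt_of_lt_one (div_pos he hD) (by norm_num : (1 / 2 : ℝ) < 1)
        refine ⟨k, le_of_not_gt fun h => ?_⟩
        have h1 := hδe k x hx h
        rw [lt_div_iff₀ hD] at hk
        linarith
      classical
      have hk := Nat.find_spec hex
      have hterm : v (Nat.find hex) x = 2 * D * (1 / 2) ^ Nat.find hex := by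
        simp only [v]
        rw [min_eq_left ((one_le_div (hδ _)).2 hk), mul_one]
      have hle : v (Nat.find hex) x ≤ ∑' k, v k x := (hvs x).le_tsum _ fun k _ => hv0 k x
      suffices h : τ x - t x ≤ v (Nat.find hex) x by linarith
      rw [hterm]
      cases hn : Nat.find hex with
      | zero => have := heD x hx; simp only [pow_zero, mul_one]; linarith
      | succ n =>
        have h1 := Nat.find_min hex (m := n) (by omega)
        have h2 := hδe n x hx (not_le.1 h1)
        rw [pow_succ]
        linarith
  · have h1 : infDist x K = 0 := infDist_zero_of_mem hx
    have h2 : ∀ k, v k x = 0 := fun k => by simp [v, h1]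
    simp only [h2, tsum_zero, add_zero, htτ x hx]
    exact min_eq_left (hM x (hKS hx))

lemma IsPlanarCube.preimage {W : Type*} [MetricSpace W] [ProperSpace W] {B U : Set W}
    (hBU : IsPlanarCube B U) (Φ : W ≃ₜ W) : IsPlanarCube (Φ ⁻¹' B) (Φ ⁻¹' U) where
  isCompact := Φ.isCompact_preimage.2 hBU.isCompact
  isOpen := hBU.isOpen.preimage Φ.continuous
  isPreconnected := Φ.isPreconnected_preimage.2 hBU.isPreconnected
  nonempty := hBU.nonempty.preimage Φ.surjective
  disjoint := hBU.disjoint.preimage Φ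
  closure_subset := by
    rw [← Φ.preimage_closure]
    exact preimage_mono hBU.closure_subset
  isBounded := (Φ.isCompact_preimage.2 hBU.isBounded.isCompact_closure).isBounded.subset
    (preimage_mono subset_closure)

variable {V : Type*} [NormedAddCommGroup V] [NormedSpace ℝ V] [FiniteDimensional ℝ V]

/-- The upper boundary of the part of a crumpled cube boundary lying below a box in its interior. -/
lemma IsPlanarCube.exists_floor {B U : Set (V × ℝ)} (hBU : IsPlanarCube B U) :
    ∃ (x₀ : V) (r s₀ : ℝ) (τ : V → ℝ), 0 < r ∧
      (∀ x ∈ closedBall x₀ r, τ x ≤ s₀ ∧ (x, τ x) ∈ B ∧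
        ∀ s, τ x < s → s < s₀ + r → (x, s) ∈ U) ∧
      ∀ q, IsClosed {x | x ∈ closedBall x₀ r ∧ q ≤ τ x} := by
  obtain ⟨⟨x₀, s₀⟩, hxs⟩ := hBU.nonempty
  obtain ⟨r, hr, hrU⟩ := Metric.nhds_basis_closedBall.mem_iff.1 (hBU.isOpen.mem_nhds hxs)
  have hbox : ∀ x ∈ closedBall x₀ r, ∀ s, |s - s₀| ≤ r → (x, s) ∈ U := fun x hx s hs =>
    hrU (by
      rw [← closedBall_prod_same]
      exact ⟨hx, by rwa [mem_closedBall, Real.dist_eq]⟩)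
  let A : V → Set ℝ := fun x => {s | s ≤ s₀ ∧ (x, s) ∈ B}
  have hcx : ∀ x : V, Continuous fun s : ℝ => (x, s) := fun x => by fun_prop
  have hAcl : ∀ x, IsClosed (A x) := fun x =>
    isClosed_Iic.inter (hBU.isCompact.isClosed.preimage (hcx x))
  have hAbd : ∀ x, BddAbove (A x) := fun x => ⟨s₀, fun s hs => hs.1⟩
  have hAne : ∀ x ∈ closedBall x₀ r, (A x).Nonempty := by
    intro x hx
    by_contra! hn
    have h1 : (fun s : ℝ => (x, s)) '' Iic s₀ ⊆ U := by
      refine (isPreconnected_Iic.image _ (hcx x).continuousOn).subset_of_isPlanarCube hBU ?_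
        ⟨_, mem_image_of_mem _ self_mem_Iic, hbox x hx s₀ (by simpa using hr.le)⟩
      rw [disjoint_left]
      rintro _ ⟨s, hs, rfl⟩ hB
      exact (hn ▸ (⟨hs, hB⟩ : s ∈ A x) : s ∈ (∅ : Set ℝ))
    obtain ⟨R, hR⟩ := hBU.isBounded.exists_norm_le
    have h2 := (norm_snd_le _).trans (hR _ (h1 (mem_image_of_mem _
      (show min s₀ (-R - 1) ∈ Iic s₀ from mem_Iic.2 (min_le_left _ _)))))
    have h3 := neg_le_of_abs_le h2
    have h4 : min s₀ (-R - 1) ≤ -R - 1 := min_le_right _ _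
    simp only at h3
    linarith
  let τ : V → ℝ := fun x => sSup (A x)
  have hτ : ∀ x ∈ closedBall x₀ r, τ x ∈ A x := fun x hx =>
    (hAcl x).csSup_mem (hAne x hx) (hAbd x)
  refine ⟨x₀, r, s₀, τ, hr, fun x hx => ⟨(hτ x hx).1, (hτ x hx).2, fun s hs hs' => ?_⟩, fun q => ?_⟩
  · have hlt : τ x < s₀ := by
      refine lt_of_le_of_ne (hτ x hx).1 fun h => ?_
      refine disjoint_left.1 hBU.disjoint (hbox x hx s₀ (by simpa using hr.le)) ?_
      rw [← h]; exact (hτ x hx).2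
    have h1 : (fun s : ℝ => (x, s)) '' Ioo (τ x) (s₀ + r) ⊆ U := by
      refine (isPreconnected_Ioo.image _ (hcx x).continuousOn).subset_of_isPlanarCube hBU ?_
        ⟨_, mem_image_of_mem _ (⟨hlt, by linarith⟩ : s₀ ∈ Ioo (τ x) (s₀ + r)),
          hbox x hx s₀ (by simpa using hr.le)⟩
      rw [disjoint_left]
      rintro _ ⟨a, ha, rfl⟩ hB
      rcases le_or_gt a s₀ with h | h
      · exact (le_csSup (hAbd x) (⟨h, hB⟩ : a ∈ A x)).not_gt ha.1
      · refine disjoint_left.1 hBU.disjoint (hbox x hx a ?_) hB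
        rw [abs_le]
        constructor <;> linarith [ha.2]
    exact h1 (mem_image_of_mem _ ⟨hs, hs'⟩)
  · have h1 : {x | x ∈ closedBall x₀ r ∧ q ≤ τ x} =
        Prod.fst '' (B ∩ closedBall x₀ r ×ˢ Icc q s₀) := by
      ext x
      constructor
      · rintro ⟨hx, hq⟩
        exact ⟨(x, τ x), ⟨(hτ x hx).2, hx, hq, (hτ x hx).1⟩, rfl⟩
      · rintro ⟨⟨x, s⟩, ⟨hB, hx, hq, hs⟩, rfl⟩
        exact ⟨hx, hq.trans (le_csSup (hAbd x) (⟨hs, hB⟩ : s ∈ A x))⟩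
    rw [h1]
    have : ProperSpace V := FiniteDimensional.proper ℝ V
    exact ((hBU.isCompact.inter_right (isClosed_closedBall.prod isClosed_Icc)).image
      continuous_fst).isClosed

/-- A vertical shear. -/
def shear {V : Type*} [TopologicalSpace V] {T : V → ℝ} (hT : Continuous T) : V × ℝ ≃ₜ V × ℝ where
  toFun z := (z.1, z.2 + T z.1)
  invFun z := (z.1, z.2 - T z.1)
  left_inv z := by simp
  right_inv z := by simp
  continuous_toFun := by fun_prop
  continuous_invFun := by fun_prop

/-- Every planar crumpled cube is the target of a map from a wilder one. -/
theorem IsPlanarCube.exists_wilder {m : ℕ} {B U : Set (EuclideanSpace ℝ (Fin (m + 3)) × ℝ)}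
    (hBU : IsPlanarCube B U) :
    ∃ (J : ThickTorus m → EuclideanSpace ℝ (Fin (m + 3)) × ℝ) (B' U' : _), IsOpenEmbedding J ∧
      IsPlanarCube B' U' ∧ Disjoint (towerSet J) U' ∧
      (∀ j, J ∘ kidWord m (zeroWord m j) '' postSet m ⊆ U') ∧
      ∃ g : EuclideanSpace ℝ (Fin (m + 3)) × ℝ → EuclideanSpace ℝ (Fin (m + 3)) × ℝ,
        Continuous g ∧ InjOn g B' ∧ g '' B' = B ∧ MapsTo g U' U := by
  obtain ⟨x₀, r, s₀, τ, hr, hτ, hcl⟩ := hBU.exists_floor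
  obtain ⟨J, hJ, ⟨K, hKQ, hK, hJK⟩, hpos, hneg⟩ := exists_placed_torus (m := m) x₀ hr hr
  let A : ℚ → Set (EuclideanSpace ℝ (Fin (m + 3))) := fun q => {x | x ∈ closedBall x₀ r ∧ q ≤ τ x}
  let E : ℕ → Set (EuclideanSpace ℝ (Fin (m + 3))) := fun j =>
    (frontier (A ((Denumerable.eqv ℚ).symm j)))ᶜ
  obtain ⟨T⟩ := exists_tower hJ (E := E) (fun j => isClosed_frontier.isOpen_compl)
    (fun j => interior_eq_empty_iff_dense_compl.1 (interior_frontier (hcl _))) hpos hneg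
  have hcont : ∀ x ∈ ball x₀ r, (∀ j, x ∈ E j) → ContinuousAt τ x := by
    intro x hx hE
    have hE' : ∀ q, x ∉ frontier (A q) := fun q => by
      have h : x ∉ frontier (A ((Denumerable.eqv ℚ).symm (Denumerable.eqv ℚ q))) := hE _
      rwa [Equiv.symm_apply_apply] at h
    refine tendsto_order.2 ⟨fun a ha => ?_, fun a ha => ?_⟩
    · obtain ⟨q, hq, hqx⟩ := exists_rat_btwn ha
      have hxA : x ∈ A q := ⟨ball_subset_closedBall hx, hqx.le⟩
      have hxi : x ∈ interior (A q) := by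
        by_contra h
        exact hE' q ⟨subset_closure hxA, h⟩
      filter_upwards [mem_interior_iff_mem_nhds.1 hxi] with y hy using hq.trans_le hy.2
    · obtain ⟨q, hq, hqx⟩ := exists_rat_btwn ha
      have hxA : x ∈ (A q)ᶜ := fun h => hq.not_ge h.2
      filter_upwards [(hcl q).isOpen_compl.mem_nhds hxA, isOpen_ball.mem_nhds hx] with y hy hyb
      exact (lt_of_not_ge fun h => hy ⟨ball_subset_closedBall hyb, h⟩).trans hqx
  have hX := T.isCompact_limitSet hJ
  let L : Set (EuclideanSpace ℝ (Fin (m + 3))) := Prod.fst '' (T.limitSet ∩ {z | z.2 ≤ 0})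
  have hL : IsCompact L :=
    (hX.inter_right (isClosed_le continuous_snd continuous_const)).image continuous_fst
  have hLb : L ⊆ ball x₀ r := by
    rintro _ ⟨z, ⟨hz, -⟩, rfl⟩
    exact (hKQ (hJK (T.limitSet_subset hz))).1
  obtain ⟨t, ht, htτ, hts, htL⟩ := exists_continuous_majorant hL
    (hLb.trans ball_subset_closedBall) (fun x hx => (hτ x hx).1) (fun x hx => by
      refine (hcont x (hLb hx) ?_).continuousWithinAt
      obtain ⟨z, ⟨hz, hz0⟩, rfl⟩ := hx
      exact (T.mem_plane hJ hz hz0).2)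
  obtain ⟨B', U', h1, h2, h3, g, h4, h5, h6, h7⟩ := T.exists_planarCube hJ hr hK hJK hKQ
    (hBU.preimage (shear ht)) (fun z hz => by
      have hzb := ball_subset_closedBall hz.1
      refine (hτ z.1 hzb).2.2 _ ?_ ?_
      · have := htτ _ hzb; have := hz.2.1; linarith
      · have := hts z.1; have := hz.2.2; linarith)
    (fun z hz hz0 => by
      have h0 := (T.mem_plane hJ hz hz0).1
      have hzL : z.1 ∈ L := ⟨z, ⟨hz, hz0⟩, rfl⟩
      show (z.1, z.2 + t z.1) ∈ B
      rw [h0, zero_add, htL _ hzL]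
      exact (hτ _ (ball_subset_closedBall (hLb hzL))).2.1)
  refine ⟨J, B', U', hJ, h1, h2, h3, shear ht ∘ g, (shear ht).continuous.comp h4,
    (shear ht).injective.injOn.comp h5 (mapsTo_univ _ _), ?_, h7⟩
  rw [image_comp, h6, image_preimage_eq _ (shear ht).surjective]

end Floor

end

section

open Filter Topology

section SphereChart

instance factFinrankAmb (n : ℕ) : Fact (Module.finrank ℝ (Amb n) = n + 1) := ⟨by simp⟩

lemma isCompact_sph (n : ℕ) : IsCompact (Sph n) := isCompact_sphere 0 1

/-- An embedding of `W` onto the sphere minus a point. -/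
structure IsSphereChart {n : ℕ} {W : Type*} [TopologicalSpace W] (ψ : W → Amb n) (p : Amb n) :
    Prop where
  isEmbedding : IsEmbedding ψ
  range_eq : range ψ = Sph n \ {p}

lemma exists_isSphereChart {n : ℕ} {W : Type*} [NormedAddCommGroup W] [NormedSpace ℝ W]
    [FiniteDimensional ℝ W] (hW : Module.finrank ℝ W = n) {p : Amb n} (hp : p ∈ Sph n) :
    ∃ ψ : W → Amb n, IsSphereChart ψ p := by
  let L : W ≃L[ℝ] EuclideanSpace ℝ (Fin n) := ContinuousLinearEquiv.ofFinrankEq (by simpa using hW)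
  let v : sphere (0 : Amb n) 1 := ⟨p, hp⟩
  let S := stereographic' n v
  have hS : IsOpenEmbedding S.symm :=
    S.symm.isOpenEmbedding (by simp [S])
  refine ⟨fun w => (S.symm (L w) : Amb n),
    (IsEmbedding.subtypeVal.comp hS.isEmbedding).comp L.toHomeomorph.isEmbedding, ?_⟩
  ext x
  constructor
  · rintro ⟨w, rfl⟩
    refine ⟨(S.symm (L w)).2, fun h => ?_⟩
    have h1 : S.symm (L w) ∈ S.source := S.map_target (by simp [S])
    rw [stereographic'_source] at h1
    exact h1 (Subtype.ext h)
  · rintro ⟨hx, hxp⟩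
    refine ⟨L.symm (S ⟨x, hx⟩), ?_⟩
    have h1 : (⟨x, hx⟩ : sphere (0 : Amb n) 1) ∈ S.source := by
      rw [stereographic'_source]
      exact fun h => hxp (congrArg Subtype.val h)
    simp only [ContinuousLinearEquiv.apply_symm_apply]
    rw [S.left_inv h1]

variable {n : ℕ} {W : Type*} {ψ : W → Amb n} {p : Amb n}

lemma IsSphereChart.mem_sph [TopologicalSpace W] (hψ : IsSphereChart ψ p) (w : W) : ψ w ∈ Sph n :=
  (hψ.range_eq.subset (mem_range_self w)).1

/-- The image of a planar crumpled cube in a chart is a component of the complement. -/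
lemma IsSphereChart.subset_image [PseudoMetricSpace W] [ProperSpace W] (hψ : IsSphereChart ψ p)
    {B U : Set W} (hBU : IsPlanarCube B U) {Z : Set (Amb n)} (hZ : IsPreconnected Z)
    (hZS : Z ⊆ Sph n \ ψ '' B) (hne : (Z ∩ ψ '' U).Nonempty) : Z ⊆ ψ '' U := by
  obtain ⟨O, hO, hOU⟩ := hψ.isEmbedding.isOpen_iff.1 hBU.isOpen
  have himg : ψ '' U = O ∩ (Sph n \ {p}) := by
    rw [← hOU, image_preimage_eq_inter_range, hψ.range_eq]
  have hcl : IsClosed (ψ '' closure U) :=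
    (hBU.isBounded.isCompact_closure.image hψ.isEmbedding.continuous).isClosed
  have hsub : Z ⊆ O \ {p} := by
    refine isPreconnected_iff_subset_of_disjoint.1 hZ (O \ {p}) (ψ '' closure U)ᶜ
      (hO.sdiff isClosed_singleton) hcl.isOpen_compl ?_ ?_ |>.resolve_right ?_
    · intro x hx
      refine or_iff_not_imp_right.2 fun h => ?_
      obtain ⟨w, hw, rfl⟩ := not_not.1 h
      rcases hBU.closure_subset hw with hw | hw
      · have h := himg.subset (mem_image_of_mem ψ hw)
        exact ⟨h.1, h.2.2⟩
      · exact absurd (mem_image_of_mem ψ hw) (hZS hx).2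
    · refine eq_empty_of_forall_notMem fun x hx => hx.2.2 ?_
      exact image_mono subset_closure (himg.superset ⟨hx.2.1.1, (hZS hx.1).1, hx.2.1.2⟩)
    · obtain ⟨x, hx, hxU⟩ := hne
      exact fun h => h hx (image_mono subset_closure hxU)
  rw [himg]
  exact fun x hx => ⟨(hsub hx).1, (hZS hx).1, (hsub hx).2⟩

end SphereChart

namespace CrumpledCube

variable {n : ℕ} (C : CrumpledCube n)

lemma isCompact_bd : IsCompact C.bd := by
  obtain ⟨e, he, -, h⟩ := C.exists_embedding
  have : CompactSpace ↥(Sph (n - 1)) := isCompact_iff_compactSpace.1 (isCompact_sph _)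
  exact h ▸ isCompact_range he

lemma int_subset : C.int ⊆ Sph n \ C.bd := by
  obtain ⟨x, -, h⟩ := C.int_component
  exact h ▸ connectedComponentIn_subset _ _

lemma isPreconnected_int : IsPreconnected C.int := by
  obtain ⟨x, -, h⟩ := C.int_component
  exact h ▸ isPreconnected_connectedComponentIn

lemma subset_int {Z : Set (Amb n)} (hZ : IsPreconnected Z) (hZS : Z ⊆ Sph n \ C.bd)
    (hne : (Z ∩ C.int).Nonempty) : Z ⊆ C.int := by
  obtain ⟨x, -, h⟩ := C.int_component
  obtain ⟨y, hyZ, hy⟩ := hne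
  rw [h] at hy ⊢
  rw [connectedComponentIn_eq hy]
  exact hZ.subset_connectedComponentIn hyZ hZS

lemma int_nonempty : C.int.Nonempty := by
  obtain ⟨x, hx, h⟩ := C.int_component
  exact ⟨x, h ▸ mem_connectedComponentIn hx⟩

lemma carrier_subset : C.carrier ⊆ Sph n :=
  union_subset C.bd_subset_sphere (C.int_subset.trans sdiff_subset)

lemma closure_int_subset : closure C.int ⊆ C.carrier := by
  intro x hx
  by_contra hxC
  have hxS : x ∈ Sph n := closure_minimal (C.int_subset.trans sdiff_subset)
    (isCompact_sph n).isClosed hx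
  have h : insert x C.int ⊆ C.int := by
    refine C.subset_int (C.isPreconnected_int.subset_closure (subset_insert _ _)
      (insert_subset hx subset_closure)) (insert_subset ⟨hxS, fun h => hxC (Or.inl h)⟩
        C.int_subset) ?_
    obtain ⟨y, hy⟩ := C.int_nonempty
    exact ⟨y, mem_insert_of_mem _ hy, hy⟩
  exact hxC (Or.inr (h (mem_insert _ _)))

lemma isCompact_carrier : IsCompact C.carrier := by
  refine (isCompact_sph n).of_isClosed_subset (isClosed_of_closure_subset ?_) C.carrier_subset
  rw [carrier, closure_union, C.isCompact_bd.isClosed.closure_eq]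
  exact union_subset subset_union_left C.closure_int_subset

variable {W : Type*} {ψ : W → Amb n} {p : Amb n}

lemma isOpen_preimage_int [TopologicalSpace W] [LocallyConnectedSpace W] (hψ : IsSphereChart ψ p)
    (hp : p ∉ C.int) : IsOpen (ψ ⁻¹' C.int) ∧ IsPreconnected (ψ ⁻¹' C.int) := by
  have hc : IsPreconnected (ψ ⁻¹' C.int) := by
    rw [← hψ.isEmbedding.isInducing.isPreconnected_image, image_preimage_eq_of_subset]
    · exact C.isPreconnected_int
    · rw [hψ.range_eq]
      exact fun x hx => ⟨(C.int_subset hx).1, fun h => hp (h ▸ hx)⟩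
  refine ⟨?_, hc⟩
  rcases (ψ ⁻¹' C.int).eq_empty_or_nonempty with h | ⟨u, hu⟩
  · rw [h]; exact isOpen_empty
  have hcl : IsOpen (ψ ⁻¹' C.bd)ᶜ :=
    (C.isCompact_bd.isClosed.preimage hψ.isEmbedding.continuous).isOpen_compl
  have hsub : ψ ⁻¹' C.int ⊆ (ψ ⁻¹' C.bd)ᶜ := fun x hx => (C.int_subset hx).2
  have : ψ ⁻¹' C.int = connectedComponentIn (ψ ⁻¹' C.bd)ᶜ u := by
    refine (hc.subset_connectedComponentIn hu hsub).antisymm (image_subset_iff.1 ?_)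
    refine C.subset_int (isPreconnected_connectedComponentIn.image _
      hψ.isEmbedding.continuous.continuousOn) ?_ ⟨ψ u, mem_image_of_mem _
        (mem_connectedComponentIn (hsub hu)), hu⟩
    rintro _ ⟨x, hx, rfl⟩
    exact ⟨hψ.mem_sph x, connectedComponentIn_subset _ _ hx⟩
  rw [this]
  exact hcl.connectedComponentIn

lemma preimage_isPlanarCube [PseudoMetricSpace W] [LocallyConnectedSpace W]
    (hψ : IsSphereChart ψ p) (hp : p ∉ C.carrier) :
    IsPlanarCube (ψ ⁻¹' C.bd) (ψ ⁻¹' C.int) := by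
  have hrange : C.carrier ⊆ range ψ := by
    rw [hψ.range_eq]
    exact fun x hx => ⟨C.carrier_subset hx, fun h => hp (h ▸ hx)⟩
  have hcomp : ∀ K ⊆ C.carrier, IsCompact K → IsCompact (ψ ⁻¹' K) := fun K hK h =>
    (hψ.isEmbedding.isInducing.isCompact_preimage_iff (hK.trans hrange)).2 h
  have h1 := C.isOpen_preimage_int hψ fun h => hp (Or.inr h)
  have h2 := hcomp _ subset_rfl C.isCompact_carrier
  refine ⟨hcomp _ C.bd_subset_carrier C.isCompact_bd, h1.1, h1.2, ?_, ?_, ?_, ?_⟩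
  · obtain ⟨x, hx⟩ := C.int_nonempty
    obtain ⟨w, rfl⟩ := hrange (Or.inr hx)
    exact ⟨w, hx⟩
  · exact Disjoint.preimage _ (disjoint_left.2 fun x hx => (C.int_subset hx).2)
  · refine (closure_mono (preimage_mono C.closure_int_subset |>.trans' (preimage_mono
      subset_closure))).trans ?_
    rw [(C.isCompact_carrier.isClosed.preimage hψ.isEmbedding.continuous).closure_eq, carrier,
      preimage_union, union_comm]
  · exact h2.isBounded.subset (preimage_mono subset_union_right)

/-- The sphere of a crumpled cube separates, so its carrier is not everything. -/
lemma exists_notMem_carrier {m : ℕ} (C : CrumpledCube (m + 2)) :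
    ∃ p ∈ Sph (m + 2), p ∉ C.carrier := by
  by_contra! hcon
  have hrank : 1 < Module.rank ℝ (EuclideanSpace ℝ (Fin (m + 2))) := by
    rw [← Module.finrank_eq_rank, finrank_euclideanSpace_fin]
    exact_mod_cast (by omega : 1 < m + 2)
  obtain ⟨e, he, hei, her⟩ := C.exists_embedding
  obtain ⟨s, hs⟩ : (Sph (m + 1)).Nonempty := NormedSpace.sphere_nonempty.2 zero_le_one
  have hq : e ⟨s, hs⟩ ∈ C.bd := her ▸ mem_range_self _
  obtain ⟨φ, hφ⟩ := exists_isSphereChart (W := EuclideanSpace ℝ (Fin (m + 2))) (by simp)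
    (C.bd_subset_sphere hq)
  obtain ⟨h1, h2⟩ := C.isOpen_preimage_int hφ fun h => (C.int_subset h).2 hq
  obtain ⟨p, hp⟩ := C.int_nonempty
  obtain ⟨x, rfl⟩ : p ∈ range φ := by
    rw [hφ.range_eq]
    exact ⟨(C.int_subset hp).1, fun h => (C.int_subset hp).2 (h ▸ hq)⟩
  have h3 := (IsPreconnected.diff_finite hrank h1 h2 (finite_singleton x)).image φ
    hφ.isEmbedding.continuous.continuousOn
  obtain ⟨ψ, hψ⟩ := exists_isSphereChart (W := EuclideanSpace ℝ (Fin (m + 2))) (by simp)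
    (C.int_subset hp).1
  have hbr : C.bd ⊆ range ψ := by
    rw [hψ.range_eq]
    exact fun x hx => ⟨C.bd_subset_sphere hx, fun h => (C.int_subset hp).2 (h ▸ hx)⟩
  let k' : Amb (m + 2) → EuclideanSpace ℝ (Fin (m + 2)) := Function.invFun ψ
  have hk' : ∀ w, k' (ψ w) = w := Function.leftInverse_invFun hψ.isEmbedding.injective
  classical
  let e₁ : EuclideanSpace ℝ (Fin (m + 2)) → EuclideanSpace ℝ (Fin (m + 2)) := fun y =>
    if hy : y ∈ sphere (0 : EuclideanSpace ℝ (Fin (m + 2))) 1 then k' (e ⟨y, hy⟩) else 0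
  have he' : ∀ y : Sph (m + 1), ψ (e₁ y) = e y := by
    intro y
    obtain ⟨w, hw⟩ := hbr (her.subset (mem_range_self y))
    have : e₁ y = k' (e y) := dif_pos y.2
    rw [this, ← hw, hk']
  have himg : e₁ '' sphere 0 1 = ψ ⁻¹' C.bd := by
    ext w
    constructor
    · rintro ⟨y, hy, rfl⟩
      show ψ (e₁ y) ∈ C.bd
      rw [he' ⟨y, hy⟩, ← her]
      exact mem_range_self _
    · intro hw
      have hw : ψ w ∈ C.bd := hw
      rw [← her] at hw
      obtain ⟨y, hy⟩ := hw
      exact ⟨y.1, y.2, hψ.isEmbedding.injective ((he' y).trans hy)⟩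
  refine not_isPreconnected_compl_of_sphere hrank (e := e₁) ?_ ?_ ?_
  · rw [continuousOn_iff_continuous_domRestrict, hψ.isEmbedding.continuous_iff]
    exact he.congr fun y => (he' y).symm
  · intro y hy z hz h
    have := hei ((he' ⟨y, hy⟩).symm.trans ((congrArg ψ h).trans (he' ⟨z, hz⟩)))
    exact congrArg Subtype.val this
  · rw [himg, ← hψ.isEmbedding.isInducing.isPreconnected_image]
    convert h3 using 1
    rw [← preimage_compl, image_preimage_eq_inter_range, hψ.range_eq]
    ext y
    constructor
    · rintro ⟨hy, hyS, hyx⟩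
      have hyi : y ∈ C.int := (hcon y hyS).resolve_left hy
      obtain ⟨w, rfl⟩ : y ∈ range φ := by
        rw [hφ.range_eq]
        exact ⟨hyS, fun h => hy (h ▸ hq)⟩
      exact ⟨w, ⟨hyi, fun h => hyx (congrArg φ h)⟩, rfl⟩
    · rintro ⟨w, ⟨hw, hwx⟩, rfl⟩
      exact ⟨(C.int_subset hw).2, hφ.mem_sph w, fun h => hwx (hφ.isEmbedding.injective h)⟩

end CrumpledCube

end

section

open Filter Topology

section Transfer

lemma fg_fundamentalGroup_of_homeomorph {X Y : Type*} [TopologicalSpace X] [TopologicalSpace Y]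
    (e : X ≃ₜ Y) (x : X) (h : Group.FG (FundamentalGroup X x)) :
    Group.FG (FundamentalGroup Y (e x)) := by
  refine Group.fg_of_surjective (f := FundamentalGroup.map (e : C(X, Y)) x) fun q => ?_
  induction q using Path.Homotopic.Quotient.ind with | mk γ
  refine ⟨FundamentalGroup.fromPath (Path.Homotopic.Quotient.mk
    ((γ.map e.symm.continuous).cast (e.symm_apply_apply x).symm (e.symm_apply_apply x).symm)), ?_⟩
  refine congrArg Path.Homotopic.Quotient.mk (Path.ext (funext fun t => ?_))
  exact e.apply_symm_apply _

variable {n : ℕ} {W : Type*} {ψ : W → Amb n} {p : Amb n} [TopologicalSpace W]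

/-- An associated map, seen in a chart. -/
lemma MemW.exists_conj [Nonempty W] {C D : CrumpledCube n} {h : ↥C.bd ≃ₜ ↥D.bd} (hf : MemW C D h)
    (hψ : IsEmbedding ψ) (hC : C.carrier ⊆ range ψ) (hD : D.carrier ⊆ range ψ) :
    ∃ F : W → W, ContinuousOn F (ψ ⁻¹' C.bd ∪ ψ ⁻¹' C.int) ∧ InjOn F (ψ ⁻¹' C.bd) ∧
      F '' (ψ ⁻¹' C.bd) = ψ ⁻¹' D.bd ∧ MapsTo F (ψ ⁻¹' C.int) (ψ ⁻¹' D.int) := by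
  classical
  obtain ⟨f, hfc, hfh, hfb⟩ := hf
  let F : W → W := fun w =>
    if hw : ψ w ∈ C.carrier then Function.invFun ψ (f ⟨ψ w, hw⟩) else w
  have hF : ∀ w (hw : ψ w ∈ C.carrier), ψ (F w) = f ⟨ψ w, hw⟩ := fun w hw => by
    rw [show F w = _ from dif_pos hw]
    exact Function.invFun_eq (hD (f ⟨ψ w, hw⟩).2)
  have hFb : ∀ w (hw : ψ w ∈ C.bd), ψ (F w) = h ⟨ψ w, hw⟩ := fun w hw =>
    (hF w (Or.inl hw)).trans (hfh ⟨ψ w, Or.inl hw⟩ hw)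
  refine ⟨F, ?_, fun w hw w' hw' hww => ?_, ?_, fun w hw => ?_⟩
  · rw [← preimage_union, continuousOn_iff_continuous_domRestrict, hψ.continuous_iff]
    have : Continuous fun w : ψ ⁻¹' (C.bd ∪ C.int) => (f ⟨ψ w, w.2⟩ : Amb n) :=
      continuous_subtype_val.comp (hfc.comp
        ((hψ.continuous.comp continuous_subtype_val).subtype_mk _))
    exact this.congr fun w => (hF w w.2).symm
  · have h1 := (hFb w hw).symm.trans ((congrArg ψ hww).trans (hFb w' hw'))
    exact hψ.injective (congrArg Subtype.val (h.injective (Subtype.ext h1)))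
  · ext w
    constructor
    · rintro ⟨v, hv, rfl⟩
      show ψ (F v) ∈ D.bd
      rw [hFb v hv]
      exact (h ⟨ψ v, hv⟩).2
    · intro hw
      obtain ⟨⟨x, hx⟩, hxw⟩ := h.surjective ⟨ψ w, hw⟩
      obtain ⟨v, rfl⟩ := hC (Or.inl hx)
      exact ⟨v, hx, hψ.injective ((hFb v hx).trans (congrArg Subtype.val hxw))⟩
  · show ψ (F w) ∈ D.int
    rw [hF w (Or.inr hw)]
    refine (f ⟨ψ w, Or.inr hw⟩).2.resolve_left fun h1 => ?_
    exact (C.int_subset hw).2 ((hfb _).1 h1)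

/-- A map in a chart that is injective on the boundary gives an associated map. -/
lemma exists_memW [Nonempty W] {C D : CrumpledCube n} (hψ : IsEmbedding ψ)
    (hC : C.carrier ⊆ range ψ) (hD : D.bd ⊆ range ψ) {F : W → W} (hF : Continuous F)
    (hFi : InjOn F (ψ ⁻¹' C.bd)) (hFb : F '' (ψ ⁻¹' C.bd) = ψ ⁻¹' D.bd)
    (hFU : MapsTo F (ψ ⁻¹' C.int) (ψ ⁻¹' D.int)) :
    ∃ h : ↥C.bd ≃ₜ ↥D.bd, MemW C D h := by
  let k : C.carrier → W := fun x => Function.invFun ψ x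
  have hk : ∀ x, ψ (k x) = x := fun x => Function.invFun_eq (hC x.2)
  have hkc : Continuous k := by
    rw [hψ.continuous_iff]
    exact continuous_subtype_val.congr fun x => (hk x).symm
  have hb : ∀ x : C.carrier, (x : Amb n) ∈ C.bd → ψ (F (k x)) ∈ D.bd := fun x hx =>
    hFb.subset (mem_image_of_mem F (show ψ (k x) ∈ C.bd from (hk x).symm ▸ hx))
  have hi : ∀ x : C.carrier, (x : Amb n) ∈ C.int → ψ (F (k x)) ∈ D.int := fun x hx =>
    hFU (show ψ (k x) ∈ C.int from (hk x).symm ▸ hx)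
  let f : C.carrier → D.carrier := fun x => ⟨ψ (F (k x)), x.2.imp (hb x) (hi x)⟩
  have hfc : Continuous f := (hψ.continuous.comp (hF.comp hkc)).subtype_mk _
  let h₀ : C.bd → D.bd := fun x => ⟨ψ (F (k ⟨x, Or.inl x.2⟩)), hb _ x.2⟩
  have hc : Continuous h₀ := (hψ.continuous.comp (hF.comp (hkc.comp
    (continuous_subtype_val.subtype_mk _)))).subtype_mk _
  have hbij : Function.Bijective h₀ := by
    constructor
    · intro x y hxy
      have h1 := hFi (show ψ (k ⟨x, Or.inl x.2⟩) ∈ C.bd from (hk _).symm ▸ x.2)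
        (show ψ (k ⟨y, Or.inl y.2⟩) ∈ C.bd from (hk _).symm ▸ y.2)
        (hψ.injective (congrArg Subtype.val hxy))
      exact Subtype.ext ((hk _).symm.trans ((congrArg ψ h1).trans (hk _)))
    · rintro ⟨y, hy⟩
      obtain ⟨w, rfl⟩ := hD hy
      obtain ⟨v, hv, rfl⟩ := hFb.superset hy
      refine ⟨⟨ψ v, hv⟩, Subtype.ext (congrArg (ψ ∘ F) (hψ.injective (hk _)))⟩
  have : CompactSpace C.bd := isCompact_iff_compactSpace.1 C.isCompact_bd
  refine ⟨Continuous.homeoOfEquivCompactToT2 (f := Equiv.ofBijective h₀ hbij) hc, f, hfc,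
    fun x hx => rfl, fun x => ⟨fun h1 => x.2.resolve_right fun h2 => ?_, hb x⟩⟩
  exact (D.int_subset (hi x h2)).2 h1

end Transfer

/-- The crumpled cube on the sphere given by a planar one in a chart. -/
lemma exists_crumpledCube {n : ℕ} {W : Type*} [PseudoMetricSpace W] [ProperSpace W]
    {ψ : W → Amb n} {p : Amb n} (hψ : IsSphereChart ψ p) {B U : Set W} (hBU : IsPlanarCube B U)
    {e : ↥(Sph (n - 1)) → W} (he : Continuous e) (hi : Function.Injective e) (hr : range e = B) :
    ∃ C : CrumpledCube n, C.bd = ψ '' B ∧ C.int = ψ '' U := by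
  obtain ⟨u, hu⟩ := hBU.nonempty
  have hsub : ψ '' U ⊆ Sph n \ ψ '' B := by
    rintro _ ⟨w, hw, rfl⟩
    refine ⟨hψ.mem_sph w, ?_⟩
    rintro ⟨v, hv, hvw⟩
    exact disjoint_left.1 hBU.disjoint hw (hψ.isEmbedding.injective hvw ▸ hv)
  refine ⟨⟨ψ '' B, ψ '' U, image_subset_iff.2 fun w _ => hψ.mem_sph w,
    ⟨ψ ∘ e, hψ.isEmbedding.continuous.comp he, hψ.isEmbedding.injective.comp hi,
      by rw [range_comp, hr]⟩, ψ u, hsub (mem_image_of_mem ψ hu), ?_⟩, rfl, rfl⟩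
  refine ((hBU.isPreconnected.image ψ
    hψ.isEmbedding.continuous.continuousOn).subset_connectedComponentIn
      (mem_image_of_mem ψ hu) hsub).antisymm ?_
  exact hψ.subset_image hBU isPreconnected_connectedComponentIn (connectedComponentIn_subset _ _)
    ⟨ψ u, mem_connectedComponentIn (hsub (mem_image_of_mem ψ hu)), mem_image_of_mem ψ hu⟩

theorem exists_strictlyWilder {m : ℕ} (C : CrumpledCube (m + 4)) (x₀ : ↥C.int)
    (hfg : Group.FG (FundamentalGroup ↥C.int x₀)) :
    ∃ D : CrumpledCube (m + 4), StrictlyWilder D C := by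
  obtain ⟨p, hp, hpC⟩ := C.exists_notMem_carrier
  have hdim : Module.finrank ℝ (EuclideanSpace ℝ (Fin (m + 3)) × ℝ) = m + 4 := by simp
  have hrank : 1 < Module.rank ℝ (EuclideanSpace ℝ (Fin (m + 3)) × ℝ) := by
    rw [← Module.finrank_eq_rank, hdim]
    exact_mod_cast (by omega : 1 < m + 4)
  obtain ⟨ψ, hψ⟩ := exists_isSphereChart hdim hp
  have hC : C.carrier ⊆ range ψ := by
    rw [hψ.range_eq]
    exact fun x hx => ⟨C.carrier_subset hx, fun h => hpC (h ▸ hx)⟩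
  have hBU := C.preimage_isPlanarCube hψ hpC
  obtain ⟨J, B', U', hJ, hBU', hA, hpost, g, hg, hgi, hgB, hgU⟩ := hBU.exists_wilder
  obtain ⟨e, he, hei, her⟩ := C.exists_embedding
  have hsurj : ∀ y, ∃ w ∈ B', ψ (g w) = e y := by
    intro y
    obtain ⟨v, hv⟩ := hC (Or.inl (her.subset (mem_range_self y)))
    obtain ⟨w, hw, rfl⟩ := hgB.superset
      (show ψ v ∈ C.bd from hv ▸ her.subset (mem_range_self y))
    exact ⟨w, hw, hv⟩
  choose e' he'B he' using hsurj
  have hleft : ∀ w ∈ B', ∀ y, ψ (g w) = e y → e' y = w := fun w hw y h =>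
    hgi (he'B y) hw (hψ.isEmbedding.injective ((he' y).trans h.symm))
  have hce : Continuous e' := by
    have : CompactSpace B' := isCompact_iff_compactSpace.1 hBU'.isCompact
    have h1 : IsClosedEmbedding fun w : B' => ψ (g w) :=
      ((hψ.isEmbedding.continuous.comp hg).comp continuous_subtype_val).isClosedEmbedding
        fun w v h => Subtype.ext (hgi w.2 v.2 (hψ.isEmbedding.injective h))
    have h2 : Continuous fun y => (⟨e' y, he'B y⟩ : B') := by
      rw [h1.isEmbedding.continuous_iff]
      exact he.congr fun y => (he' y).symm
    exact continuous_subtype_val.comp h2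
  obtain ⟨D, hDb, hDi⟩ := exists_crumpledCube hψ hBU' hce
    (fun y z h => hei ((he' y).symm.trans ((congrArg (ψ ∘ g) h).trans (he' z)))) (by
      refine (range_subset_iff.2 he'B).antisymm fun w hw => ?_
      have h1 : ψ (g w) ∈ C.bd := hgB.subset (mem_image_of_mem g hw)
      rw [← her] at h1
      obtain ⟨y, hy⟩ := h1
      exact ⟨y, hleft w hw y hy.symm⟩)
  have hDb' : ψ ⁻¹' D.bd = B' := by rw [hDb, preimage_image_eq _ hψ.isEmbedding.injective]
  have hDi' : ψ ⁻¹' D.int = U' := by rw [hDi, preimage_image_eq _ hψ.isEmbedding.injective]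
  have hD : D.carrier ⊆ range ψ := by
    rw [CrumpledCube.carrier, hDb, hDi]
    exact union_subset (image_subset_range _ _) (image_subset_range _ _)
  refine ⟨D, exists_memW hψ.isEmbedding hD (subset_union_left.trans hC) hg (by rwa [hDb'])
    (by rwa [hDb']) (by rwa [hDi']), fun H hH => ?_⟩
  obtain ⟨F, h1, h2, h3, h4⟩ := hH.exists_conj hψ.isEmbedding hC hD
  rw [hDb'] at h3
  rw [hDi'] at h4
  let E : ψ ⁻¹' C.int ≃ₜ C.int := (hψ.isEmbedding.homeomorphImage _).trans
    (Homeomorph.setCongr (image_preimage_eq_of_subset (subset_union_right.trans hC)))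
  exact not_fg_of_map hrank hJ hBU hBU' hA hpost h1 h2 h3 h4 (E.symm x₀)
    (fg_fundamentalGroup_of_homeomorph E.symm x₀ hfg)

end

/-- **Corollary 5.1.** A crumpled `n`-cube (`n > 3`) whose interior has finitely
generated fundamental group is not maximal in the "strictly wilder than" partial
ordering. -/
theorem stmt14 (n : ℕ) (hn : 3 < n) (C : CrumpledCube n) (x₀ : ↥C.int)
    (hfg : Group.FG (FundamentalGroup ↥C.int x₀)) :
    ∃ Ct : CrumpledCube n, StrictlyWilder Ct C := by
  obtain ⟨m, rfl⟩ := Nat.exists_eq_add_of_le' hn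
  exact exists_strictlyWilder C x₀ hfg
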